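/- arXiv:2604.19437 — 5 statements merged into one kernel-verified Lean document; each statement's English description precedes it below -/
import Mathlib

section
/- Let A,B,C ∈ ℝ with A > 0 and D = A·C − B²/4 > 0, and let Q1, Q2 be the associated polynomial functions on ℝ⁴. Let P = {u + s1·v1 + s2·v2 : s1,s2 ∈ ℝ} ⊆ ℝ⁴ be a real affine plane (v1,v2 linearly independent). If the polynomial (s1,s2) ↦ (Q1² − Q2)(u + s1·v1 + s2·v2) is the square of a polynomial in ℝ[s1,s2], then either P is contained in the set {x ∈ ℝ⁴ : x2 − x3 = 0 and C·x1 + A·x4 − B·x2 = 0}, or P is contained in the set {x ∈ ℝ⁴ : C·x1 − A·x4 = 0 and B·x4 − C·(x2+x3) = 0}. -/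
open Module

/-- A path `t ↦ (t², κ t² + ω)` with `0 ≤ κ ≤ 1` and `ω > 0` meets the region where `1`, `√S`, `√W`
are the sides of a nondegenerate triangle. -/
lemma exists_heron_neg {κ ω : ℝ} (hκ : 0 ≤ κ) (hκ1 : κ ≤ 1) (hω : 0 < ω) :
    ∃ t : ℝ, (t ^ 2 - (κ * t ^ 2 + ω) - 1) ^ 2 < 4 * (κ * t ^ 2 + ω) := by
  suffices h : ∃ T : ℝ, 0 ≤ T ∧ (T - (κ * T + ω) - 1) ^ 2 < 4 * (κ * T + ω) by
    obtain ⟨T, hT, h⟩ := h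
    exact ⟨√T, by rwa [Real.sq_sqrt hT]⟩
  rcases lt_or_ge ω 3 with h3 | h3
  · exact ⟨1, zero_le_one, by nlinarith⟩
  rcases hκ1.eq_or_lt with rfl | hlt
  · exact ⟨ω ^ 2 + 1, by positivity, by nlinarith⟩
  · have h1 : 0 < 1 - κ := by linarith
    have hT : ω / (1 - κ) * (1 - κ) = ω := by field_simp
    have hT0 : 0 < ω / (1 - κ) := by positivity
    refine ⟨ω / (1 - κ), hT0.le, ?_⟩
    generalize ω / (1 - κ) = T at *
    have hT' : κ * T + ω = T := by linarith
    rw [hT']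
    nlinarith

section AffineMaps

variable {V E F : Type*} [AddCommGroup V] [Module ℝ V]
  [NormedAddCommGroup E] [InnerProductSpace ℝ E] [NormedAddCommGroup F] [InnerProductSpace ℝ F]

lemma norm_add_smul_sq (x y : E) (t : ℝ) :
    ‖x + t • y‖ ^ 2 = ‖x‖ ^ 2 + 2 * t * inner ℝ x y + t ^ 2 * ‖y‖ ^ 2 := by
  rw [norm_add_sq_real, inner_smul_right, norm_smul, mul_pow, Real.norm_eq_abs, sq_abs]
  ring

/-- If the linear part of one affine map dominates that of the other, the Heron expression can only
be nonnegative everywhere when the dominated map vanishes. -/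
lemma eq_zero_of_heron_nonneg_of_norm_le (hV : finrank ℝ V = 2) (hE : finrank ℝ E = 2)
    (z : V →ₗ[ℝ] E) (w : V →ₗ[ℝ] F) (z₀ : E) (w₀ : F)
    (hinj : ∀ v, z v = 0 → w v = 0 → v = 0) (hle : ∀ v, ‖w v‖ ≤ ‖z v‖)
    (h : ∀ v, 4 * ‖w₀ + w v‖ ^ 2 ≤ (‖z₀ + z v‖ ^ 2 - ‖w₀ + w v‖ ^ 2 - 1) ^ 2) (v : V) :
    w₀ + w v = 0 := by
  have : FiniteDimensional ℝ V := .of_finrank_pos (by omega)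
  have : FiniteDimensional ℝ E := .of_finrank_pos (by omega)
  have hz : ∀ v, z v = 0 → v = 0 := fun v hv =>
    hinj v hv (norm_le_zero_iff.1 (by simpa [hv] using hle v))
  have hsurj : Function.Surjective z :=
    (LinearMap.injective_iff_surjective_of_finrank_eq_finrank (hV.trans hE.symm)).1
      ((injective_iff_map_eq_zero z).2 hz)
  obtain ⟨c, hc⟩ := hsurj (-z₀)
  have hray (θ : V) (t : ℝ) : 4 * ‖w₀ + w c + t • w θ‖ ^ 2 ≤
      (t ^ 2 * ‖z θ‖ ^ 2 - ‖w₀ + w c + t • w θ‖ ^ 2 - 1) ^ 2 := by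
    have := h (c + t • θ)
    simpa [hc, ← add_assoc, norm_smul, mul_pow] using this
  have hunit (θ : V) (hθ : θ ≠ 0) : 0 < ‖z θ‖ := norm_pos_iff.2 fun h => hθ (hz θ h)
  by_cases hω : w₀ + w c = 0
  · have hw (θ : V) : w θ = 0 := by
      by_contra hθ
      have hpos := hunit θ fun h => hθ (by simp [h])
      have hwpos := norm_pos_iff.2 hθ
      have hr := hray θ ‖z θ‖⁻¹
      have h1 : ‖z θ‖⁻¹ ^ 2 * ‖z θ‖ ^ 2 = 1 := by field_simp
      rw [hω, zero_add, norm_smul, norm_inv, norm_norm, h1] at hr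
      have hκ : 0 < ‖z θ‖⁻¹ * ‖w θ‖ := by positivity
      have hκ1 : ‖z θ‖⁻¹ * ‖w θ‖ ≤ 1 := by
        rw [inv_mul_le_iff₀ hpos]; simpa using hle θ
      generalize ‖z θ‖⁻¹ * ‖w θ‖ = k at *
      have : 0 < k ^ 2 := by positivity
      have : k ^ 2 ≤ 1 := pow_le_one₀ hκ.le hκ1
      nlinarith
    simpa [hw] using hω
  · exfalso
    obtain ⟨θ, hθ, hθ0⟩ : ∃ θ : V, inner ℝ (w₀ + w c) (w θ) = 0 ∧ θ ≠ 0 := by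
      have := LinearMap.ker_ne_bot_of_finrank_lt
        (f := (innerₗ F (w₀ + w c)).comp w) (by simp [hV])
      obtain ⟨θ, hθ, hθ0⟩ := (Submodule.ne_bot_iff _).1 this
      exact ⟨θ, by simpa [inner_add_left] using hθ, hθ0⟩
    have hpos := hunit θ hθ0
    have hωpos := norm_pos_iff.2 hω
    obtain ⟨t, ht⟩ := exists_heron_neg (κ := (‖w θ‖ / ‖z θ‖) ^ 2) (ω := ‖w₀ + w c‖ ^ 2)
      (by positivity) (pow_le_one₀ (by positivity) ((div_le_one hpos).2 (hle θ))) (by positivity)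
    refine ht.not_ge ?_
    have hr := hray θ (t / ‖z θ‖)
    have h1 : (t / ‖z θ‖) ^ 2 * ‖z θ‖ ^ 2 = t ^ 2 := by field_simp
    have h2 : ‖w₀ + w c‖ ^ 2 + (t / ‖z θ‖) ^ 2 * ‖w θ‖ ^ 2 =
        (‖w θ‖ / ‖z θ‖) ^ 2 * t ^ 2 + ‖w₀ + w c‖ ^ 2 := by ring
    rwa [norm_add_smul_sq, hθ, mul_zero, add_zero, h1, h2] at hr

/-- The linear parts cannot be incomparable: otherwise along some null direction of the difference
of the two squared norms the Heron expression tends to `-∞`. -/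
lemma not_heron_nonneg_of_lt_of_lt (z : V →ₗ[ℝ] E) (w : V →ₗ[ℝ] F) (z₀ : E) (w₀ : F) {x y : V}
    (hx : ‖w x‖ < ‖z x‖) (hy : ‖z y‖ < ‖w y‖)
    (h : ∀ v, 4 * ‖w₀ + w v‖ ^ 2 ≤ (‖z₀ + z v‖ ^ 2 - ‖w₀ + w v‖ ^ 2 - 1) ^ 2) : False := by
  obtain ⟨n, hn, hb⟩ : ∃ n : V, ‖z n‖ ^ 2 = ‖w n‖ ^ 2 ∧
      inner ℝ (z n) (z y) - inner ℝ (w n) (w y) ≠ 0 := by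
    have hx' : 0 < ‖z x‖ ^ 2 - ‖w x‖ ^ 2 := sub_pos.2 (by gcongr)
    have hy' : 0 < ‖w y‖ ^ 2 - ‖z y‖ ^ 2 := sub_pos.2 (by gcongr)
    set b := inner ℝ (z x) (z y) - inner ℝ (w x) (w y) with hbdef
    set p := ‖z x‖ ^ 2 - ‖w x‖ ^ 2 with hp
    set m := ‖w y‖ ^ 2 - ‖z y‖ ^ 2 with hm
    have hdisc : 0 < b ^ 2 + p * m := by positivity
    obtain ⟨k, hk⟩ : ∃ k, m * k = b + √(b ^ 2 + p * m) :=
      ⟨(b + √(b ^ 2 + p * m)) / m, by field_simp⟩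
    have hsq := Real.sq_sqrt hdisc.le
    have hroot : p + 2 * k * b - k ^ 2 * m = 0 := by
      refine (mul_eq_zero.1 (?_ : m * _ = 0)).resolve_left hy'.ne'
      have : √(b ^ 2 + p * m) = m * k - b := by linarith
      rw [this] at hsq
      linarith
    refine ⟨x + k • y, ?_, ?_⟩
    · simp only [map_add, map_smul, norm_add_smul_sq]
      linear_combination hroot + hp + 2 * k * hbdef - k ^ 2 * hm
    · simp only [map_add, map_smul, inner_add_left, inner_smul_left, real_inner_self_eq_norm_sq]
      have hs := Real.sqrt_pos.2 hdisc
      simp only [conj_trivial]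
      intro h0
      nlinarith
  have hpos : 0 < ‖z n‖ ^ 2 := by
    by_contra! h0
    have hz : z n = 0 := by simpa using le_antisymm h0 (sq_nonneg _)
    have hw : w n = 0 := by simpa [hz] using hn.symm
    simp [hz, hw] at hb
  obtain ⟨c, hc⟩ : ∃ c : V, inner ℝ (z₀ + z c) (z n) = inner ℝ (w₀ + w c) (w n) := by
    refine ⟨(-(inner ℝ z₀ (z n) - inner ℝ w₀ (w n)) /
      (inner ℝ (z n) (z y) - inner ℝ (w n) (w y))) • y, ?_⟩
    simp only [map_smul, inner_add_left, inner_smul_left, conj_trivial]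
    rw [real_inner_comm (z n) (z y), real_inner_comm (w n) (w y)] at *
    field_simp
    ring
  have hray (t : ℝ) := h (c + t • n)
  simp only [map_add, map_smul, ← add_assoc, norm_add_smul_sq, hc, ← hn] at hray
  generalize ‖z₀ + z c‖ ^ 2 = S, ‖w₀ + w c‖ ^ 2 = W, inner ℝ (w₀ + w c) (w n) = β,
    ‖z n‖ ^ 2 = N at hray hpos
  obtain ⟨T, hT⟩ : ∃ T, T * N = (S - W - 1) ^ 2 - 4 * W + 1 :=
    ⟨((S - W - 1) ^ 2 - 4 * W + 1) / N, by field_simp⟩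
  have h1 := hray (|T| + 1)
  have h2 := hray (-(|T| + 1))
  have h3 : T ≤ (|T| + 1) ^ 2 := by nlinarith [le_abs_self T, abs_nonneg T]
  have h4 := mul_le_mul_of_nonneg_right h3 hpos.le
  have h5 : 0 ≤ (|T| + 1) ^ 2 * N := by positivity
  nlinarith

/-- If the Heron expression of `1`, `‖z‖`, `‖w‖` is nonnegative on a real plane in a product of two
Euclidean planes, then one of the two coordinates vanishes on it. -/
theorem eq_zero_or_eq_zero_of_heron_nonneg (hV : finrank ℝ V = 2) (hE : finrank ℝ E = 2)
    (hF : finrank ℝ F = 2) (z : V →ₗ[ℝ] E) (w : V →ₗ[ℝ] F) (z₀ : E) (w₀ : F)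
    (hinj : ∀ v, z v = 0 → w v = 0 → v = 0)
    (h : ∀ v, 4 * ‖w₀ + w v‖ ^ 2 ≤ (‖z₀ + z v‖ ^ 2 - ‖w₀ + w v‖ ^ 2 - 1) ^ 2) :
    (∀ v, z₀ + z v = 0) ∨ (∀ v, w₀ + w v = 0) := by
  by_cases h1 : ∀ v, ‖w v‖ ≤ ‖z v‖
  · exact .inr (eq_zero_of_heron_nonneg_of_norm_le hV hE z w z₀ w₀ hinj h1 h)
  by_cases h2 : ∀ v, ‖z v‖ ≤ ‖w v‖
  · exact .inl (eq_zero_of_heron_nonneg_of_norm_le hV hF w z w₀ z₀ (fun v hw hz => hinj v hz hw) h2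
      fun v => by linarith [h v])
  push Not at h1 h2
  obtain ⟨y, hy⟩ := h1
  obtain ⟨x, hx⟩ := h2
  exact (not_heron_nonneg_of_lt_of_lt z w z₀ w₀ hx hy h).elim

end AffineMaps

/-- The linear map to `ℂ` with given real and imaginary coefficient vectors. -/
noncomputable def complexForm (a b : Fin 4 → ℝ) : (Fin 4 → ℝ) →ₗ[ℝ] ℂ :=
  Complex.equivRealProdLm.symm.toLinearMap.comp
    ((dotProductBilin ℝ ℝ a).prod (dotProductBilin ℝ ℝ b))

lemma complexForm_apply (a b x : Fin 4 → ℝ) : complexForm a b x = ⟨a ⬝ᵥ x, b ⬝ᵥ x⟩ := rfl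

/-- Let `A, B, C : ℝ` with `A > 0` and `D = A·C − B²/4 > 0`, and let
`Q1 = x1·x4 − x2·x3 − D` and
`Q2 = (C·x1 − A·x4)² + (B·x1 − A·(x2+x3))·(B·x4 − C·(x2+x3))` on `ℝ⁴`.
If the restriction of `Q1² − Q2` to a real affine plane
`P = {u + s1·v1 + s2·v2}` is the square of a real polynomial in `(s1, s2)`, then `P` is
contained in `{x2 − x3 = 0, C·x1 + A·x4 − B·x2 = 0}` or in
`{C·x1 − A·x4 = 0, B·x4 − C·(x2+x3) = 0}`.
(Coordinates: `x1 = x 0`, `x2 = x 1`, `x3 = x 2`, `x4 = x 3`.) -/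
theorem square_restriction_forces_plane
    (A B C : ℝ) (hA : 0 < A) (hD : 0 < A * C - B ^ 2 / 4)
    (u v1 v2 : Fin 4 → ℝ) (hv : LinearIndependent ℝ ![v1, v2])
    (hsq : ∃ g : MvPolynomial (Fin 2) ℝ, ∀ s1 s2 : ℝ,
      (fun x : Fin 4 → ℝ =>
          (x 0 * x 3 - x 1 * x 2 - (A * C - B ^ 2 / 4)) ^ 2 -
            ((C * x 0 - A * x 3) ^ 2 +
              (B * x 0 - A * (x 1 + x 2)) * (B * x 3 - C * (x 1 + x 2))))
        (u + s1 • v1 + s2 • v2) = (MvPolynomial.eval ![s1, s2] g) ^ 2) :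
    (∀ s1 s2 : ℝ,
      (u + s1 • v1 + s2 • v2) 1 - (u + s1 • v1 + s2 • v2) 2 = 0 ∧
        C * (u + s1 • v1 + s2 • v2) 0 + A * (u + s1 • v1 + s2 • v2) 3 -
          B * (u + s1 • v1 + s2 • v2) 1 = 0) ∨
    (∀ s1 s2 : ℝ,
      C * (u + s1 • v1 + s2 • v2) 0 - A * (u + s1 • v1 + s2 • v2) 3 = 0 ∧
        B * (u + s1 • v1 + s2 • v2) 3 -
          C * ((u + s1 • v1 + s2 • v2) 1 + (u + s1 • v1 + s2 • v2) 2) = 0) := by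
  obtain ⟨g, hg⟩ := hsq
  have hC : 0 < C := by
    by_contra! hC
    nlinarith [mul_nonneg hA.le (neg_nonneg.2 hC), sq_nonneg B]
  set D := A * C - B ^ 2 / 4 with hDdef
  have hAC : 0 < A * C := mul_pos hA hC
  obtain ⟨δ, hδ, hδD⟩ : ∃ δ : ℝ, 0 < δ ∧ δ ^ 2 = D := ⟨√D, by positivity, Real.sq_sqrt hD.le⟩
  obtain ⟨ε, hε, hεAC⟩ : ∃ ε : ℝ, 0 < ε ∧ ε ^ 2 = A * C :=
    ⟨√(A * C), by positivity, Real.sq_sqrt hAC.le⟩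
  -- On the image, `‖z‖² - ‖w‖² - 1 = Q1 / D` and `4 ‖w‖² = Q2 / D²`.
  let z := complexForm ((4 * D)⁻¹ • ![2 * C, -B, -B, 2 * A])
    ((4 * D)⁻¹ • ![0, 2 * δ, -(2 * δ), 0])
  let w := complexForm ((4 * D * ε)⁻¹ • ![B * C, -(2 * A * C), -(2 * A * C), A * B])
    ((4 * D * ε)⁻¹ • ![2 * δ * C, 0, 0, -(2 * δ * A)])
  have hz (x : Fin 4 → ℝ) : ‖z x‖ ^ 2 = ((2 * C * x 0 - B * (x 1 + x 2) + 2 * A * x 3) ^ 2 +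
      4 * D * (x 1 - x 2) ^ 2) / (16 * D ^ 2) := by
    rw [Complex.sq_norm, Complex.normSq_apply, ← hδD]
    simp [z, complexForm_apply, dotProduct, Fin.sum_univ_four, ← hδD]
    field_simp
    ring
  have hw (x : Fin 4 → ℝ) : ‖w x‖ ^ 2 = ((C * x 0 - A * x 3) ^ 2 +
      (B * x 0 - A * (x 1 + x 2)) * (B * x 3 - C * (x 1 + x 2))) / (4 * D ^ 2) := by
    have h1 : ‖w x‖ ^ 2 = ((B * C * x 0 - 2 * A * C * (x 1 + x 2) + A * B * x 3) ^ 2 +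
        4 * D * (C * x 0 - A * x 3) ^ 2) / (16 * D ^ 2 * (A * C)) := by
      rw [Complex.sq_norm, Complex.normSq_apply, ← hδD, ← hεAC]
      simp only [w, complexForm_apply, dotProduct, Fin.sum_univ_four, ← hδD, Pi.smul_apply,
        smul_eq_mul, Matrix.cons_val]
      field_simp
      ring_nf
    rw [h1, div_eq_div_iff (by positivity) (by positivity), hDdef]
    ring
  have hz0 (x : Fin 4 → ℝ) (hx : z x = 0) :
      x 1 - x 2 = 0 ∧ C * x 0 + A * x 3 - B * x 1 = 0 := by
    have h0 := hz x
    rw [hx, norm_zero, eq_div_iff (by positivity)] at h0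
    have hd : x 1 - x 2 = 0 := by
      have : D * (x 1 - x 2) ^ 2 = 0 := by
        nlinarith [sq_nonneg (2 * C * x 0 - B * (x 1 + x 2) + 2 * A * x 3),
          mul_nonneg hD.le (sq_nonneg (x 1 - x 2))]
      simpa [hD.ne'] using this
    have hq : 2 * C * x 0 - B * (x 1 + x 2) + 2 * A * x 3 = 0 := by
      rw [hd] at h0
      exact pow_eq_zero_iff two_ne_zero |>.1 (by linarith)
    exact ⟨hd, by linear_combination hq / 2 - B / 2 * hd⟩
  have hw0 (x : Fin 4 → ℝ) (hx : w x = 0) :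
      C * x 0 - A * x 3 = 0 ∧ B * x 3 - C * (x 1 + x 2) = 0 := by
    have h0 := hw x
    rw [hx, norm_zero, eq_div_iff (by positivity)] at h0
    have h1 : D * (C * x 0 - A * x 3) ^ 2 * 4 +
        (B * C * x 0 - 2 * A * C * (x 1 + x 2) + A * B * x 3) ^ 2 = 0 := by
      rw [hDdef]
      linear_combination -4 * A * C * h0
    have hm : C * x 0 - A * x 3 = 0 := by
      have : D * (C * x 0 - A * x 3) ^ 2 = 0 := by
        nlinarith [sq_nonneg (B * C * x 0 - 2 * A * C * (x 1 + x 2) + A * B * x 3),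
          mul_nonneg hD.le (sq_nonneg (C * x 0 - A * x 3))]
      simpa [hD.ne'] using this
    rw [hm] at h1
    have hn : B * C * x 0 - 2 * A * C * (x 1 + x 2) + A * B * x 3 = 0 :=
      pow_eq_zero_iff two_ne_zero |>.1 (by linarith)
    refine ⟨hm, (mul_eq_zero.1 (?_ : A * _ = 0)).resolve_left hA.ne'⟩
    linear_combination hn / 2 - B / 2 * hm
  have hzw (x : Fin 4 → ℝ) (h1 : z x = 0) (h2 : w x = 0) : x = 0 := by
    obtain ⟨ha, hb⟩ := hz0 x h1
    obtain ⟨hc, hd⟩ := hw0 x h2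
    have h3 : x 3 = 0 := by
      refine (mul_eq_zero.1 (?_ : (4 * D) * _ = 0)).resolve_left (by positivity)
      rw [hDdef]
      linear_combination 2 * C * hb - B * hd - 2 * C * hc + B * C * ha
    have h0 : x 0 = 0 := by simpa [h3, hC.ne'] using hc
    have h12 : x 1 + x 2 = 0 := by simpa [h3, hC.ne'] using hd
    ext i
    fin_cases i <;> simp <;> linarith
  let L : ℝ × ℝ →ₗ[ℝ] (Fin 4 → ℝ) :=
    (LinearMap.fst ℝ ℝ ℝ).smulRight v1 + (LinearMap.snd ℝ ℝ ℝ).smulRight v2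
  have hL (s t : ℝ) : u + s • v1 + t • v2 = u + L (s, t) := by simp [L, add_assoc]
  have hLinj (v : ℝ × ℝ) (hv0 : L v = 0) : v = 0 := by
    have := LinearIndependent.pair_iff.1 hv v.1 v.2 (by simpa [L] using hv0)
    exact Prod.ext this.1 this.2
  have key := eq_zero_or_eq_zero_of_heron_nonneg (by simp) Complex.finrank_real_complex
    Complex.finrank_real_complex (z.comp L) (w.comp L) (z u) (w u)
    (fun v h1 h2 => hLinj v (hzw _ h1 h2)) (by
      rintro ⟨s, t⟩
      have := hg s t
      simp only [LinearMap.comp_apply, ← map_add, hL] at this ⊢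
      generalize u + L (s, t) = x at *
      have hQ : ‖z x‖ ^ 2 - ‖w x‖ ^ 2 - 1 = (x 0 * x 3 - x 1 * x 2 - D) / D := by
        rw [hz, hw]
        field_simp
        rw [hDdef]
        ring
      rw [hQ, hw, div_pow, ← sub_nonneg]
      have hsq := sq_nonneg (MvPolynomial.eval ![s, t] g)
      rw [← this] at hsq
      refine (div_nonneg hsq (sq_nonneg D)).trans_eq ?_
      field_simp)
  simp only [LinearMap.comp_apply, ← map_add] at key
  simp only [hL]
  exact key.imp (fun h s t => hz0 _ (h (s, t))) (fun h s t => hw0 _ (h (s, t)))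
end

section
/- Let a,b,c,d,e,f ∈ ℂ and consider the polynomial F(x) = (a·x² + b·x + c)² − d·x² − e·x − f ∈ ℂ[x]. If F is the square of a polynomial in ℂ[x], then either (a·e = b·d and 4·a²·f = (4·a·c − d)·d), or (a = 0 and (4·b·c − e)·e = 4·(b²·f + c²·d − d·f)). -/
open Polynomial

/-- If `F(x) = (a·x² + b·x + c)² − d·x² − e·x − f` is the square of a
polynomial in `ℂ[x]`, then the coefficients satisfy one of the two stated relations. -/
theorem square_poly_coeff_relations (a b c d e f : ℂ)
    (h : ∃ G : Polynomial ℂ,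
      (C a * X ^ 2 + C b * X + C c) ^ 2 - (C d * X ^ 2 + C e * X + C f) = G ^ 2) :
    (a * e = b * d ∧ 4 * a ^ 2 * f = (4 * a * c - d) * d) ∨
      (a = 0 ∧ (4 * b * c - e) * e = 4 * (b ^ 2 * f + c ^ 2 * d - d * f)) := by
  obtain ⟨G, hG⟩ := h
  have hdeg : G.natDegree ≤ 2 := by
    have h4 : (G ^ 2).natDegree ≤ 4 := by
      rw [← hG]
      compute_degree
    rw [natDegree_pow] at h4
    omega
  obtain ⟨p, q, r, rfl⟩ : ∃ p q r : ℂ, G = C p * X ^ 2 + C q * X + C r :=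
    ⟨_, _, _, eq_quadratic_of_degree_le_two (natDegree_le_iff_degree_le.mp hdeg)⟩
  have heval (x : ℂ) := congrArg (Polynomial.eval x) hG
  simp only [eval_sub, eval_add, eval_mul, eval_pow, eval_C, eval_X] at heval
  have e0 := heval 0
  have e1 := heval 1
  have e2 := heval (-1)
  have e3 := heval 2
  have e4 := heval (-2)
  have h4 : p ^ 2 = a ^ 2 := by
    linear_combination (-1 / 24 : ℂ) * (e3 + e4 - 4 * e1 - 4 * e2 + 6 * e0)
  have h3 : p * q = a * b := by
    linear_combination (-1 / 24 : ℂ) * (e3 - e4 - 2 * e1 + 2 * e2)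
  have h2 : q ^ 2 + 2 * p * r = b ^ 2 + 2 * a * c - d := by
    linear_combination (1 / 24 : ℂ) * (e3 + e4 - 16 * e1 - 16 * e2 + 30 * e0)
  have h1 : 2 * q * r = 2 * b * c - e := by
    linear_combination (1 / 12 : ℂ) * (e3 - e4 - 8 * e1 + 8 * e2)
  have h0 : r ^ 2 = c ^ 2 - f := by linear_combination -e0
  by_cases ha : a = 0
  · right
    refine ⟨ha, ?_⟩
    subst ha
    have hp : p = 0 := by simpa using h4
    subst hp
    linear_combination (2 * q * r + 2 * b * c - e) * h1 - 4 * r ^ 2 * h2 - 4 * (b ^ 2 - d) * h0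
  · left
    obtain ⟨s, hs, hp⟩ : ∃ s : ℂ, s ^ 2 = 1 ∧ p = s * a := by
      rcases sq_eq_sq_iff_eq_or_eq_neg.mp h4 with hp | hp
      · exact ⟨1, by norm_num, by simpa using hp⟩
      · exact ⟨-1, by norm_num, by simpa using hp⟩
    subst hp
    have hq : q = s * b := by
      apply mul_left_cancel₀ ha
      linear_combination s * h3 - a * q * hs
    subst hq
    have hr : 2 * a * (s * r) = 2 * a * c - d := by linear_combination h2 - b ^ 2 * hs
    constructor
    · linear_combination a * h1 - b * hr
    · linear_combination 4 * a ^ 2 * h0 + 4 * a ^ 2 * r ^ 2 * hs -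
        (2 * a * (s * r) + 2 * a * c - d) * hr
end

section
/- Let F ∈ ℤ[x1,x2] be a polynomial that remains irreducible over an algebraic closure of ℚ (i.e. F is irreducible as an element of ℚ̄[x1,x2]), and suppose d := deg_{x2}(F) ≥ 1. Let E > 1 and let B1, B2 ∈ (1,∞) with B2 ≤ B1^E and total degree deg(F) ≤ E. Then for every ε > 0 there exists a constant C = C(E,d,ε) such that the number of pairs (x1,x2) ∈ ℤ² with |x1| ≤ B1, |x2| ≤ B2 and F(x1,x2) = 0 is at most C·B1^{1/d + ε}. -/
section

open Polynomial Polynomial.Bivariate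

theorem Polynomial.Bivariate.coeff_coeff_equivMvPolynomial_symm {R : Type*} [CommSemiring R]
    (F : MvPolynomial (Fin 2) R) (a b : ℕ) :
    (((Polynomial.Bivariate.equivMvPolynomial R).symm F).coeff b).coeff a =
      F.coeff (Finsupp.single 0 a + Finsupp.single 1 b) := by
  induction F using MvPolynomial.induction_on' with
  | add p q hp hq => simp [hp, hq]
  | monomial u r =>
    have h1 : (Polynomial.Bivariate.equivMvPolynomial R).symm (MvPolynomial.monomial u r) =
        Polynomial.monomial (u 1) (Polynomial.monomial (u 0) r) := by
      rw [MvPolynomial.monomial_eq, Finsupp.prod_fintype _ _ (by simp)]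
      simp [← Polynomial.C_mul_X_pow_eq_monomial, mul_assoc]
    have h2 : u = Finsupp.single 0 a + Finsupp.single 1 b ↔ u 1 = b ∧ u 0 = a := by
      rw [Finsupp.ext_iff, Fin.forall_fin_two]
      simp [and_comm]
    rw [h1, MvPolynomial.coeff_monomial, Polynomial.coeff_monomial]
    simp only [h2]
    split_ifs <;> simp_all [Polynomial.coeff_monomial]

theorem Polynomial.Bivariate.natDegree_equivMvPolynomial_symm {R : Type*} [CommSemiring R]
    (F : MvPolynomial (Fin 2) R) :
    ((Polynomial.Bivariate.equivMvPolynomial R).symm F).natDegree = F.degreeOf 1 := by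
  apply le_antisymm
  · rw [Polynomial.natDegree_le_iff_coeff_eq_zero]
    intro b hb
    ext a
    rw [Polynomial.Bivariate.coeff_coeff_equivMvPolynomial_symm, Polynomial.coeff_zero]
    by_contra h
    have := MvPolynomial.monomial_le_degreeOf 1 (MvPolynomial.mem_support_iff.2 h)
    simp at this
    omega
  · rw [MvPolynomial.degreeOf_le_iff]
    intro u hu
    apply Polynomial.le_natDegree_of_ne_zero
    intro h
    have h3 := congrArg (fun q => q.coeff (u 0)) h
    simp only [Polynomial.Bivariate.coeff_coeff_equivMvPolynomial_symm,
      Polynomial.coeff_zero] at h3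
    rw [MvPolynomial.mem_support_iff] at hu
    apply hu
    convert h3
    ext i
    fin_cases i <;> simp

theorem Polynomial.Bivariate.natDegree_coeff_equivMvPolynomial_symm_le {R : Type*}
    [CommSemiring R] (F : MvPolynomial (Fin 2) R) (i : ℕ) :
    (((Polynomial.Bivariate.equivMvPolynomial R).symm F).coeff i).natDegree ≤ F.totalDegree := by
  rw [Polynomial.natDegree_le_iff_coeff_eq_zero]
  intro a ha
  rw [Polynomial.Bivariate.coeff_coeff_equivMvPolynomial_symm]
  by_contra h
  have := MvPolynomial.le_totalDegree (MvPolynomial.mem_support_iff.2 h)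
  rw [Finsupp.sum_fintype _ _ (by simp)] at this
  simp at this
  omega

theorem Polynomial.Bivariate.evalEval_equivMvPolynomial_symm {R : Type*} [CommRing R]
    (F : MvPolynomial (Fin 2) R) (x y : R) :
    ((Polynomial.Bivariate.equivMvPolynomial R).symm F).evalEval x y =
      MvPolynomial.eval ![x, y] F := by
  induction F using MvPolynomial.induction_on with
  | C a => simp
  | add p q hp hq => simp [hp, hq]
  | mul_X p i hp =>
    fin_cases i <;> simp [hp, Polynomial.evalEval_C]

theorem Polynomial.Bivariate.map_equivMvPolynomial_symm {R S : Type*} [CommSemiring R]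
    [CommSemiring S] (φ : R →+* S) (F : MvPolynomial (Fin 2) R) :
    ((Polynomial.Bivariate.equivMvPolynomial R).symm F).map (Polynomial.mapRingHom φ) =
      (Polynomial.Bivariate.equivMvPolynomial S).symm (MvPolynomial.map φ F) := by
  ext b a
  simp [Polynomial.Bivariate.coeff_coeff_equivMvPolynomial_symm, MvPolynomial.coeff_map]

theorem Matrix.natDegree_det_le_card_mul {n R : Type*} [Fintype n] [DecidableEq n] [CommRing R]
    (A : Matrix n n R[X]) (k : ℕ) (hA : ∀ i j, (A i j).natDegree ≤ k) :
    A.det.natDegree ≤ Fintype.card n * k := by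
  rw [Matrix.det_apply]
  apply Polynomial.natDegree_sum_le_of_forall_le
  intro σ _
  refine (Polynomial.natDegree_smul_le _ _).trans ((Polynomial.natDegree_prod_le _ _).trans ?_)
  refine (Finset.sum_le_sum fun i _ => hA _ _).trans ?_
  simp

theorem Polynomial.natDegree_resultant_le {R : Type*} [CommRing R] (f g : R[X][Y]) (m n k : ℕ)
    (hf : ∀ i, (f.coeff i).natDegree ≤ k) (hg : ∀ i, (g.coeff i).natDegree ≤ k) :
    (f.resultant g m n).natDegree ≤ (m + n) * k := by
  have := Matrix.natDegree_det_le_card_mul (Polynomial.sylvester f g m n) k ?_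
  · simpa [Polynomial.resultant] using this
  · intro i j
    rw [Polynomial.sylvester, Matrix.of_apply]
    induction j using Fin.addCases <;> simp only [Fin.addCases_left, Fin.addCases_right] <;>
      split_ifs <;> simp [hf, hg]

theorem Polynomial.resultant_ne_zero_of_irreducible {L : Type*} [Field L] {f h : L[X][Y]}
    (hf : Irreducible f) (hh : h ≠ 0) (hlt : h.natDegree < f.natDegree) :
    f.resultant h ≠ 0 := by
  have hinj := IsFractionRing.injective L[X] (FractionRing L[X])
  have hirr := ((hf.isPrimitive (by omega)).irreducible_iff_irreducible_map_fraction_map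
    (K := FractionRing L[X])).1 hf
  have hcop : IsCoprime (f.map (algebraMap L[X] (FractionRing L[X])))
      (h.map (algebraMap L[X] (FractionRing L[X]))) := by
    rw [hirr.coprime_iff_not_dvd]
    intro hdvd
    have := Polynomial.natDegree_le_of_dvd hdvd ((Polynomial.map_ne_zero_iff hinj).2 hh)
    rw [Polynomial.natDegree_map_eq_of_injective hinj,
      Polynomial.natDegree_map_eq_of_injective hinj] at this
    omega
  have h1 := Polynomial.resultant_ne_zero _ _ hcop
  rw [Polynomial.natDegree_map_eq_of_injective hinj,
    Polynomial.natDegree_map_eq_of_injective hinj, Polynomial.resultant_map_map] at h1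
  intro h0
  rw [h0, map_zero] at h1
  exact h1 rfl

theorem Irreducible.map_evalRingHom_ne_zero {L : Type*} [Field L] {f : L[X][Y]}
    (hf : Irreducible f) (hd : f.natDegree ≠ 0) (x : L) : f.map (evalRingHom x) ≠ 0 := by
  intro h0
  have hdvd : C (X - C x) ∣ f := by
    rw [Polynomial.C_dvd_iff_dvd_coeff]
    intro i
    rw [Polynomial.dvd_iff_isRoot]
    simpa using congrArg (fun q => q.coeff i) h0
  exact Polynomial.not_isUnit_X_sub_C x ((hf.isPrimitive hd) _ hdvd)

theorem Irreducible.card_common_zeros_le {L : Type*} [Field L] {f h : L[X][Y]} {d e : ℕ}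
    (hf : Irreducible f) (hd : f.natDegree = d)
    (hfe : ∀ i, (f.coeff i).natDegree ≤ e) (hh : h ≠ 0) (hhd : h.natDegree < d)
    (hhe : ∀ i, (h.coeff i).natDegree ≤ e) (S : Finset (L × L))
    (hS : ∀ z ∈ S, f.evalEval z.1 z.2 = 0 ∧ h.evalEval z.1 z.2 = 0) :
    S.card ≤ 2 * d * e * d := by
  classical
  have hR := Polynomial.resultant_ne_zero_of_irreducible hf hh (hd ▸ hhd)
  have hRd := Polynomial.natDegree_resultant_le f h f.natDegree h.natDegree e hfe hhe
  set R := f.resultant h with hRdef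
  have hsub : S ⊆ R.roots.toFinset.biUnion fun x =>
      (f.map (evalRingHom x)).roots.toFinset.image fun y => (x, y) := by
    rintro ⟨x, y⟩ hz
    obtain ⟨h1, h2⟩ := hS _ hz
    simp only [Finset.mem_biUnion, Finset.mem_image, Multiset.mem_toFinset]
    refine ⟨x, ?_, y, ?_, rfl⟩
    · obtain ⟨p, q, -, -, hpq⟩ := Polynomial.exists_mul_add_mul_eq_C_resultant f h le_rfl le_rfl
        (Or.inl (by omega))
      rw [Polynomial.mem_roots hR, Polynomial.IsRoot, hRdef, ← Polynomial.evalEval_C x y, ← hpq,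
        Polynomial.evalEval_add, Polynomial.evalEval_mul, Polynomial.evalEval_mul, h1, h2]
      simp
    · rw [Polynomial.mem_roots (hf.map_evalRingHom_ne_zero (by omega) x), Polynomial.IsRoot,
        Polynomial.map_evalRingHom_eval, h1]
  refine (Finset.card_le_card hsub).trans ((Finset.card_biUnion_le_card_mul _ _ d ?_).trans ?_)
  · intro x _
    refine Finset.card_image_le.trans ((Multiset.toFinset_card_le _).trans
      ((Polynomial.card_roots' _).trans ?_))
    exact Polynomial.natDegree_map_le.trans hd.le
  · apply Nat.mul_le_mul_right
    refine (Multiset.toFinset_card_le _).trans ((Polynomial.card_roots' _).trans (hRd.trans ?_))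
    apply Nat.mul_le_mul_right
    omega

theorem Polynomial.card_common_zeros_le_of_irreducible_map {L : Type*} [Field L] [CharZero L]
    {f h : ℤ[X][Y]} {d e : ℕ}
    (hf : Irreducible (f.map (mapRingHom (Int.castRingHom L)))) (hd : f.natDegree = d)
    (hfe : ∀ i, (f.coeff i).natDegree ≤ e) (hh : h ≠ 0) (hhd : h.natDegree < d)
    (hhe : ∀ i, (h.coeff i).natDegree ≤ e) (S : Finset (ℤ × ℤ))
    (hS : ∀ z ∈ S, f.evalEval z.1 z.2 = 0 ∧ h.evalEval z.1 z.2 = 0) :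
    S.card ≤ 2 * d * e * d := by
  classical
  have hinj : Function.Injective (mapRingHom (Int.castRingHom L)) :=
    Polynomial.map_injective _ (RingHom.injective_int _)
  have hcast : Function.Injective fun z : ℤ × ℤ => ((z.1 : L), (z.2 : L)) := by
    rintro ⟨a, b⟩ ⟨a', b'⟩ h
    simpa using h
  rw [← Finset.card_image_of_injective S hcast]
  refine hf.card_common_zeros_le (h := h.map (mapRingHom (Int.castRingHom L))) ?_ ?_ ?_ ?_ ?_ _ ?_
  · rw [Polynomial.natDegree_map_eq_of_injective hinj, hd]
  · intro i
    rw [Polynomial.coeff_map]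
    exact Polynomial.natDegree_map_le.trans (hfe i)
  · exact (Polynomial.map_ne_zero_iff hinj).2 hh
  · rwa [Polynomial.natDegree_map_eq_of_injective hinj]
  · intro i
    rw [Polynomial.coeff_map]
    exact Polynomial.natDegree_map_le.trans (hhe i)
  · intro w hw
    obtain ⟨z, hz, rfl⟩ := Finset.mem_image.1 hw
    obtain ⟨h1, h2⟩ := hS z hz
    have key := fun q : ℤ[X][Y] =>
      Polynomial.map_mapRingHom_evalEval (Int.castRingHom L) q z.1 z.2
    simp only [eq_intCast] at key
    simp [key, h1, h2]

theorem Polynomial.dvd_evalEval_sub_evalEval {R : Type*} [CommRing R] (f : R[X][Y])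
    {p x y x' y' : R} (hx : p ∣ x - x') (hy : p ∣ y - y') :
    p ∣ f.evalEval x y - f.evalEval x' y' := by
  have h1 : y - y' ∣ f.evalEval x y - f.evalEval x y' := by
    simp only [← Polynomial.map_evalRingHom_eval]
    exact Polynomial.sub_dvd_eval_sub _ _ _
  have h2 : x - x' ∣ f.evalEval x y' - f.evalEval x' y' := Polynomial.sub_dvd_eval_sub _ _ _
  have := dvd_add (hy.trans h1) (hx.trans h2)
  rwa [sub_add_sub_cancel] at this

theorem Polynomial.exists_polynomial_approx_root (f : ℤ[X][Y]) {p x₀ y₀ : ℤ}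
    (hp : IsCoprime (f.derivative.evalEval x₀ y₀) p) (K : ℕ) :
    ∃ g : ℤ[X], ∀ x y : ℤ, f.evalEval x y = 0 → p ∣ x - x₀ → p ∣ y - y₀ →
      p ^ (K + 1) ∣ y - g.eval x := by
  induction K with
  | zero => exact ⟨C y₀, fun x y _ _ hy => by simpa using hy⟩
  | succ K ih =>
    obtain ⟨g, hg⟩ := ih
    obtain ⟨a, b, hab⟩ := hp
    refine ⟨g - C a * f.eval g, fun x y hxy hx hy => ?_⟩
    obtain ⟨w, hw⟩ := hg x y hxy hx hy
    obtain ⟨k, hk⟩ := (f.map (evalRingHom x)).binomExpansion (g.eval x) (p ^ (K + 1) * w)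
    have h1 : (f.eval g).eval x = f.evalEval x (g.eval x) := by
      rw [← Polynomial.map_evalRingHom_eval, Polynomial.eval_map]
      exact (Polynomial.eval₂_hom (evalRingHom x) g).symm
    have hgx : p ∣ g.eval x - y₀ := by
      have : p ∣ y - g.eval x := (dvd_pow_self p (Nat.succ_ne_zero K)).trans (hg x y hxy hx hy)
      have := dvd_sub hy this
      rwa [show y - y₀ - (y - g.eval x) = g.eval x - y₀ by ring] at this
    obtain ⟨t, ht⟩ := f.derivative.dvd_evalEval_sub_evalEval hx hgx
    rw [← hw, add_sub_cancel, Polynomial.map_evalRingHom_eval, hxy, Polynomial.derivative_map,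
      Polynomial.map_evalRingHom_eval, Polynomial.map_evalRingHom_eval, hw] at hk
    have h2 : y - (g - C a * f.eval g).eval x =
        y - g.eval x + a * f.evalEval x (g.eval x) := by
      simp [h1]; ring
    rw [h2, hw]
    refine ⟨(b - a * t) * w - a * k * p ^ K * w ^ 2, ?_⟩
    have h3 : f.derivative.evalEval x (g.eval x) = f.derivative.evalEval x₀ y₀ + p * t := by
      linarith
    rw [h3] at hk
    linear_combination (-a) * hk - p ^ (K + 1) * w * hab

theorem Polynomial.exists_small_combination_dvd {J : Type*} [Fintype J] (h : J → Polynomial ℤ)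
    (x₀ : ℤ) (p : ℕ) (hp : 0 < p) (K : ℕ) (H : J → ℕ)
    (hcard : ∏ k : Fin K, p ^ (K - k : ℕ) < ∏ j, (H j + 1)) :
    ∃ c : J → ℤ, c ≠ 0 ∧ (∀ j, |c j| ≤ H j) ∧
      ∀ x : ℤ, (p : ℤ) ∣ x - x₀ → (p : ℤ) ^ K ∣ ∑ j, c j * (h j).eval x := by
  classical
  have hne : ∀ k : Fin K, NeZero (p ^ (K - k : ℕ)) := fun k => ⟨by positivity⟩
  let Φ : (J → ℕ) → (k : Fin K) → ZMod (p ^ (K - k : ℕ)) := fun c k =>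
    ∑ j, (c j : ZMod (p ^ (K - k : ℕ))) *
      ((((h j).taylor x₀).coeff k : ℤ) : ZMod (p ^ (K - k : ℕ)))
  obtain ⟨c, hc, c', hc', hcc, heq⟩ :=
    Finset.exists_ne_map_eq_of_card_lt_of_maps_to
      (s := Fintype.piFinset fun j => Finset.range (H j + 1)) (t := Finset.univ) (f := Φ)
      (by simpa [Fintype.card_pi, ZMod.card] using hcard) (by simp)
  simp only [Fintype.mem_piFinset, Finset.mem_range] at hc hc'
  refine ⟨fun j => (c j : ℤ) - c' j, ?_, ?_, ?_⟩
  · intro h0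
    apply hcc
    ext j
    have := congrFun h0 j
    simp only [Pi.zero_apply] at this
    omega
  · intro j
    have := hc j
    have := hc' j
    simp only [abs_le]
    constructor <;> omega
  · rintro x ⟨u, hu⟩
    set q : Polynomial ℤ := ∑ j, ((c j : ℤ) - c' j) • h j with hq
    have hx : ∑ j, ((c j : ℤ) - c' j) * (h j).eval x = ((q.taylor x₀).eval (p * u)) := by
      rw [Polynomial.taylor_eval, ← hu, sub_add_cancel, hq, Polynomial.eval_finsetSum]
      simp
    rw [hx, Polynomial.eval_eq_sum_range]
    apply Finset.dvd_sum
    intro k _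
    rw [mul_pow]
    by_cases hk : k < K
    · have h1 : ((p ^ (K - k) : ℕ) : ℤ) ∣ (q.taylor x₀).coeff k := by
        rw [← ZMod.intCast_zmod_eq_zero_iff_dvd]
        have := congrFun heq ⟨k, hk⟩
        simp only [Φ] at this
        simp only [hq, map_sum, map_zsmul, Polynomial.finsetSum_coeff, Polynomial.coeff_smul]
        push_cast [smul_eq_mul]
        rw [← sub_eq_zero, ← Finset.sum_sub_distrib] at this
        simpa [sub_mul] using this
      have h2 : (p : ℤ) ^ K = (p ^ (K - k) : ℕ) * (p : ℤ) ^ k := by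
        push_cast
        rw [← pow_add, Nat.sub_add_cancel hk.le]
      rw [h2, ← mul_assoc]
      exact (mul_dvd_mul_right h1 _).trans (by simp [mul_assoc, mul_dvd_mul_left])
    · exact ((pow_dvd_pow _ (not_lt.1 hk)).trans (dvd_mul_right _ _)).trans (dvd_mul_left _ _)

/-- The bivariate polynomial `∑ c (i, j) X ^ j Y ^ i`. -/
noncomputable def Polynomial.bivariateOfCoeffs {R : Type*} [Semiring R] {m n : ℕ}
    (c : Fin m × Fin n → R) : R[X][Y] :=
  ∑ j, monomial (j.1 : ℕ) (monomial (j.2 : ℕ) (c j))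

theorem Polynomial.coeff_coeff_bivariateOfCoeffs {R : Type*} [Semiring R] {m n : ℕ}
    (c : Fin m × Fin n → R) (i j : ℕ) :
    ((bivariateOfCoeffs c).coeff i).coeff j =
      if h : i < m ∧ j < n then c (⟨i, h.1⟩, ⟨j, h.2⟩) else 0 := by
  simp only [bivariateOfCoeffs, finsetSum_coeff, coeff_monomial]
  split_ifs with h
  · rw [Finset.sum_eq_single (⟨i, h.1⟩, ⟨j, h.2⟩)]
    · simp
    · rintro ⟨a, b⟩ - hab
      split_ifs with h1
      · rw [coeff_monomial, if_neg]
        rintro h2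
        apply hab
        ext <;> simp_all
      · simp
    · simp
  · apply Finset.sum_eq_zero
    rintro ⟨a, b⟩ -
    split_ifs with h1
    · rw [coeff_monomial, if_neg]
      rintro h2
      exact h ⟨h1 ▸ a.2, h2 ▸ b.2⟩
    · simp

theorem Polynomial.natDegree_bivariateOfCoeffs_le {R : Type*} [Semiring R] {m n : ℕ}
    (c : Fin (m + 1) × Fin n → R) : (bivariateOfCoeffs c).natDegree ≤ m := by
  rw [natDegree_le_iff_coeff_eq_zero]
  intro i hi
  ext j
  rw [coeff_coeff_bivariateOfCoeffs, dif_neg (by omega), coeff_zero]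

theorem Polynomial.natDegree_coeff_bivariateOfCoeffs_le {R : Type*} [Semiring R] {m n : ℕ}
    (c : Fin m × Fin (n + 1) → R) (i : ℕ) : ((bivariateOfCoeffs c).coeff i).natDegree ≤ n := by
  rw [natDegree_le_iff_coeff_eq_zero]
  intro j hj
  rw [coeff_coeff_bivariateOfCoeffs, dif_neg (by omega)]

theorem Polynomial.bivariateOfCoeffs_ne_zero {R : Type*} [Semiring R] {m n : ℕ}
    {c : Fin m × Fin n → R} (hc : c ≠ 0) : bivariateOfCoeffs c ≠ 0 := by
  intro h
  apply hc
  ext ⟨i, j⟩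
  have := coeff_coeff_bivariateOfCoeffs c i j
  rw [dif_pos ⟨i.2, j.2⟩, h] at this
  simpa using this.symm

theorem Polynomial.evalEval_bivariateOfCoeffs {R : Type*} [CommSemiring R] {m n : ℕ}
    (c : Fin m × Fin n → R) (x y : R) :
    (bivariateOfCoeffs c).evalEval x y = ∑ j, c j * (x ^ (j.2 : ℕ) * y ^ (j.1 : ℕ)) := by
  rw [bivariateOfCoeffs, evalEval_finsetSum]
  simp [evalEval, mul_assoc]

theorem Polynomial.eq_bivariateOfCoeffs {R : Type*} [Semiring R] {f : R[X][Y]} {m n : ℕ}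
    (hm : f.natDegree ≤ m) (hn : ∀ i, (f.coeff i).natDegree ≤ n) :
    f = bivariateOfCoeffs fun j : Fin (m + 1) × Fin (n + 1) =>
      (f.coeff (j.1 : ℕ)).coeff (j.2 : ℕ) := by
  ext i j
  rw [coeff_coeff_bivariateOfCoeffs]
  split_ifs with h
  · rfl
  · rcases lt_or_ge m i with hi | hi
    · rw [coeff_eq_zero_of_natDegree_lt (hm.trans_lt hi), coeff_zero]
    · exact coeff_eq_zero_of_natDegree_lt ((hn i).trans_lt (by omega))

theorem Finset.prod_sq_eq_pow_card_of_mul_equiv_eq {ι M : Type*} [Fintype ι] [CommMonoid M]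
    (w : ι → M) (e : ι ≃ ι) (c : M) (h : ∀ i, w i * w (e i) = c) :
    (∏ i, w i) ^ 2 = c ^ Fintype.card ι := by
  rw [sq]
  nth_rw 2 [← e.prod_comp]
  rw [← Finset.prod_mul_distrib, Finset.prod_congr rfl fun i _ => h i]
  simp

theorem Polynomial.exists_auxiliary_polynomial (f : ℤ[X][Y]) {p : ℕ} (hp : 0 < p) {x₀ y₀ : ℤ}
    (hcop : IsCoprime (f.derivative.evalEval x₀ y₀) (p : ℤ)) (d M : ℕ) {B₁ B₂ : ℝ}
    (hB₁ : 1 ≤ B₁) (hB₂ : 1 ≤ B₂)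
    (hsize : (((d + 1) * (M + 1) : ℕ) + 1 : ℝ) ^ 2 * (B₁ ^ M * B₂ ^ d) ≤
      (p : ℝ) ^ ((d + 1) * (M + 1) - 1)) :
    ∃ G : ℤ[X][Y], G ≠ 0 ∧ G.natDegree ≤ d ∧ (∀ i, (G.coeff i).natDegree ≤ M) ∧
      ∀ x y : ℤ, f.evalEval x y = 0 → (p : ℤ) ∣ x - x₀ → (p : ℤ) ∣ y - y₀ →
        |(x : ℝ)| ≤ B₁ → |(y : ℝ)| ≤ B₂ → G.evalEval x y = 0 := by
  set D : ℕ := (d + 1) * (M + 1) with hD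
  have hD1 : 1 ≤ D := Nat.mul_pos (by omega) (by omega)
  obtain ⟨g, hg⟩ := f.exists_polynomial_approx_root hcop (D - 1)
  rw [Nat.sub_add_cancel hD1] at hg
  have hp0 : (0 : ℝ) < p := by exact_mod_cast hp
  set T : ℝ := (p : ℝ) ^ D / (D + 1) with hT
  have hT0 : 0 < T := by positivity
  let w : Fin (d + 1) × Fin (M + 1) → ℝ := fun j => T / (B₁ ^ (j.2 : ℕ) * B₂ ^ (j.1 : ℕ))
  have hw0 : ∀ j, 0 < w j := fun j => by positivity
  have hw2 : (∏ j, w j) ^ 2 = (T ^ 2 / (B₁ ^ M * B₂ ^ d)) ^ D := by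
    rw [Finset.prod_sq_eq_pow_card_of_mul_equiv_eq w (Fin.revPerm.prodCongr Fin.revPerm)
      (T ^ 2 / (B₁ ^ M * B₂ ^ d))]
    · simp [hD]
    · rintro ⟨i, j⟩
      have h1 : B₁ ^ M = B₁ ^ (j : ℕ) * B₁ ^ (Fin.rev j : ℕ) := by
        rw [← pow_add, Fin.val_rev]; congr 1; omega
      have h2 : B₂ ^ d = B₂ ^ (i : ℕ) * B₂ ^ (Fin.rev i : ℕ) := by
        rw [← pow_add, Fin.val_rev]; congr 1; omega
      simp only [w, Equiv.prodCongr_apply, Prod.map, Fin.revPerm_apply]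
      rw [h1, h2, div_mul_div_comm]
      congr 1 <;> ring
  have hp2 : (∏ k : Fin D, (p : ℝ) ^ (D - k : ℕ)) ^ 2 = ((p : ℝ) ^ (D + 1)) ^ D := by
    rw [Finset.prod_sq_eq_pow_card_of_mul_equiv_eq _ Fin.revPerm ((p : ℝ) ^ (D + 1))]
    · simp
    · intro k
      rw [← pow_add, Fin.revPerm_apply, Fin.val_rev]
      congr 1
      omega
  have hcard : ∏ k : Fin D, p ^ (D - k : ℕ) < ∏ j, (⌊w j⌋₊ + 1) := by
    rw [← Nat.cast_lt (α := ℝ)]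
    push_cast
    have h1 : ∏ k : Fin D, (p : ℝ) ^ (D - k : ℕ) ≤ ∏ j, w j := by
      refine le_of_sq_le_sq ?_ (Finset.prod_nonneg fun j _ => (hw0 j).le)
      rw [hp2, hw2]
      refine pow_le_pow_left₀ (by positivity) ?_ _
      rw [le_div_iff₀ (by positivity), hT, div_pow, le_div_iff₀ (by positivity)]
      calc (p : ℝ) ^ (D + 1) * (B₁ ^ M * B₂ ^ d) * (D + 1) ^ 2
          = (p : ℝ) ^ (D + 1) * (((D : ℝ) + 1) ^ 2 * (B₁ ^ M * B₂ ^ d)) := by ring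
        _ ≤ (p : ℝ) ^ (D + 1) * (p : ℝ) ^ (D - 1) := by gcongr
        _ = ((p : ℝ) ^ D) ^ 2 := by rw [← pow_add, ← pow_mul]; congr 1; omega
    refine h1.trans_lt (Finset.prod_lt_prod_of_nonempty (fun j _ => hw0 j)
      (fun j _ => Nat.lt_floor_add_one _) Finset.univ_nonempty)
  obtain ⟨c, hc0, hcH, hc⟩ := Polynomial.exists_small_combination_dvd
    (fun j : Fin (d + 1) × Fin (M + 1) => X ^ (j.2 : ℕ) * g ^ (j.1 : ℕ)) x₀ p hp D _ hcard
  refine ⟨bivariateOfCoeffs c, bivariateOfCoeffs_ne_zero hc0, natDegree_bivariateOfCoeffs_le c,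
    natDegree_coeff_bivariateOfCoeffs_le c, fun x y hf hx hy hxB hyB => ?_⟩
  have hdvd : (p : ℤ) ^ D ∣ (bivariateOfCoeffs c).evalEval x y := by
    have h1 := hc x hx
    have h2 : (p : ℤ) ^ D ∣ (bivariateOfCoeffs c).evalEval x y -
        (bivariateOfCoeffs c).evalEval x (g.eval x) := by
      refine ((bivariateOfCoeffs c).dvd_evalEval_sub_evalEval (p := (p : ℤ) ^ D) (by simp) ?_)
      exact hg x y hf hx hy
    rw [evalEval_bivariateOfCoeffs c x (g.eval x)] at h2
    simp only [eval_mul, eval_pow, eval_X] at h1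
    simpa using dvd_add h2 h1
  refine Int.eq_zero_of_abs_lt_dvd hdvd ?_
  rw [← Int.cast_lt (R := ℝ), evalEval_bivariateOfCoeffs]
  push_cast
  calc |∑ j, (c j : ℝ) * ((x : ℝ) ^ (j.2 : ℕ) * (y : ℝ) ^ (j.1 : ℕ))|
      ≤ ∑ j, |(c j : ℝ) * ((x : ℝ) ^ (j.2 : ℕ) * (y : ℝ) ^ (j.1 : ℕ))| :=
        Finset.abs_sum_le_sum_abs _ _
    _ ≤ ∑ j : Fin (d + 1) × Fin (M + 1), T := by
        apply Finset.sum_le_sum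
        intro j _
        rw [abs_mul, abs_mul, abs_pow, abs_pow]
        have h3 : |(c j : ℝ)| ≤ w j := by
          have : |(c j : ℝ)| ≤ (⌊w j⌋₊ : ℝ) := by exact_mod_cast hcH j
          exact this.trans (Nat.floor_le (hw0 j).le)
        calc |(c j : ℝ)| * (|(x : ℝ)| ^ (j.2 : ℕ) * |(y : ℝ)| ^ (j.1 : ℕ))
            ≤ w j * (B₁ ^ (j.2 : ℕ) * B₂ ^ (j.1 : ℕ)) := by gcongr
          _ = T := div_mul_cancel₀ _ (by positivity)
    _ = D * T := by simp [hD]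
    _ < (p : ℝ) ^ D := by
        rw [hT, mul_div_assoc', div_lt_iff₀ (by positivity)]
        nlinarith [show (0 : ℝ) < (p : ℝ) ^ D by positivity]

theorem Int.Matrix.exists_ne_zero_int_vec_abs_le {ι β : Type*} [Finite ι] [Fintype β]
    (A : Matrix ι β ℤ) {Q : ℝ} (hQ : 1 ≤ Q) (hA : ∀ i j, |(A i j : ℝ)| ≤ Q) {t : β → ℤ}
    (ht : t ≠ 0) (hAt : ∀ i, ∑ j, A i j * t j = 0) :
    ∃ c : β → ℤ, c ≠ 0 ∧ (∀ i, ∑ j, A i j * c j = 0) ∧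
      ∀ j, |(c j : ℝ)| ≤ (Fintype.card β * Q) ^ Fintype.card β := by
  classical
  set r : ι → β → ℚ := fun i j => A i j with hr
  obtain ⟨κ, a, ha, hspan, hLI⟩ := exists_linearIndependent' ℚ r
  have : Finite κ := Finite.of_injective a ha
  have := Fintype.ofFinite κ
  obtain ⟨j₀, hj₀⟩ := Function.ne_iff.1 ht
  have hβ : 1 ≤ Fintype.card β := Fintype.card_pos_iff.2 ⟨j₀⟩
  have hβ' : (1 : ℝ) ≤ Fintype.card β := by exact_mod_cast hβ
  have hNQ : 1 ≤ Fintype.card β * Q := one_le_mul_of_one_le_of_one_le hβ' hQ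
  have hcard : Fintype.card κ < Fintype.card β := by
    let φ : (β → ℚ) →ₗ[ℚ] ℚ := Fintype.linearCombination ℚ fun j => (t j : ℚ)
    have hφ : φ ≠ 0 := by
      intro h0
      have := LinearMap.congr_fun h0 (Pi.single j₀ 1)
      simp [φ, Fintype.linearCombination_apply_single] at this
      exact hj₀ this
    have hmem : ∀ k, (r ∘ a) k ∈ LinearMap.ker φ := by
      intro k
      rw [LinearMap.mem_ker, Fintype.linearCombination_apply]
      simp only [hr, Function.comp_apply, smul_eq_mul]
      exact_mod_cast hAt (a k)
    have hLI' : LinearIndependent ℚ fun k => (⟨(r ∘ a) k, hmem k⟩ : LinearMap.ker φ) :=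
      LinearIndependent.of_comp (LinearMap.ker φ).subtype (by exact hLI)
    refine hLI'.fintype_card_le_finrank.trans_lt ?_
    have := Submodule.finrank_lt (s := LinearMap.ker φ) (by rwa [Ne, LinearMap.ker_eq_top])
    simpa using this
  have hker : ∀ c : β → ℤ, (∀ k, ∑ j, A (a k) j * c j = 0) → ∀ i, ∑ j, A i j * c j = 0 := by
    intro c hc i
    let φ : (β → ℚ) →ₗ[ℚ] ℚ := Fintype.linearCombination ℚ fun j => (c j : ℚ)
    have h1 : Submodule.span ℚ (Set.range r) ≤ LinearMap.ker φ := by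
      rw [← hspan, Submodule.span_le]
      rintro _ ⟨k, rfl⟩
      rw [SetLike.mem_coe, LinearMap.mem_ker, Fintype.linearCombination_apply]
      simp only [hr, Function.comp_apply, smul_eq_mul]
      exact_mod_cast hc k
    have h2 := h1 (Submodule.subset_span ⟨i, rfl⟩)
    rw [LinearMap.mem_ker, Fintype.linearCombination_apply] at h2
    simp only [hr, smul_eq_mul] at h2
    exact_mod_cast h2
  rcases isEmpty_or_nonempty κ with hκ | hκ
  · refine ⟨fun _ => 1, fun h => one_ne_zero (congrFun h j₀), hker _ fun k => hκ.elim k, ?_⟩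
    intro j
    simpa using one_le_pow₀ hNQ
  · let := Matrix.seminormedAddCommGroup (m := κ) (n := β) (α := ℤ)
    obtain ⟨c, hc0, hc, hcn⟩ := Int.Matrix.exists_ne_zero_int_vec_norm_le (A.submatrix a id)
      hcard Fintype.card_pos
    refine ⟨c, hc0, hker c fun k => congrFun hc k, fun j => ?_⟩
    have hnorm : ‖A.submatrix a id‖ ≤ Q := by
      rw [Matrix.norm_le_iff (by linarith)]
      intro i j
      exact hA _ _
    have h1 : |(c j : ℝ)| ≤ ‖c‖ := norm_le_pi_norm c j
    have hm : (1 : ℝ) ≤ (Fintype.card β : ℝ) - Fintype.card κ := by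
      have : (Fintype.card κ : ℝ) + 1 ≤ Fintype.card β := by exact_mod_cast hcard
      linarith
    calc |(c j : ℝ)| ≤ ‖c‖ := h1
      _ ≤ _ := hcn
      _ ≤ (Fintype.card β * Q) ^
            ((Fintype.card κ : ℝ) / (Fintype.card β - Fintype.card κ)) := by
          refine Real.rpow_le_rpow (by positivity) ?_ (by positivity)
          gcongr
          exact max_le hQ hnorm
      _ ≤ (Fintype.card β * Q) ^ (Fintype.card β : ℝ) := by
          refine Real.rpow_le_rpow_of_exponent_le hNQ ((div_le_self (by positivity) hm).trans ?_)
          exact_mod_cast hcard.le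
      _ = _ := Real.rpow_natCast _ _

theorem Polynomial.exists_small_coeffs_vanishing {f : ℤ[X][Y]} (hf : f ≠ 0) {d e : ℕ}
    (hd : f.natDegree ≤ d) (he : ∀ i, (f.coeff i).natDegree ≤ e) (S : Finset (ℤ × ℤ))
    (hS : ∀ z ∈ S, f.evalEval z.1 z.2 = 0) {B₁ B₂ : ℝ} (hB₁ : 1 ≤ B₁) (hB₂ : 1 ≤ B₂)
    (hSB : ∀ z ∈ S, |(z.1 : ℝ)| ≤ B₁ ∧ |(z.2 : ℝ)| ≤ B₂) :
    ∃ c : Fin (d + 1) × Fin (e + 1) → ℤ, c ≠ 0 ∧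
      (∀ z ∈ S, (bivariateOfCoeffs c).evalEval z.1 z.2 = 0) ∧
      ∀ j, |(c j : ℝ)| ≤
        (((d + 1) * (e + 1) : ℕ) * (B₁ ^ e * B₂ ^ d)) ^ ((d + 1) * (e + 1)) := by
  have hfc := eq_bivariateOfCoeffs hd he
  let A : Matrix S (Fin (d + 1) × Fin (e + 1)) ℤ :=
    fun z j => z.1.1 ^ (j.2 : ℕ) * z.1.2 ^ (j.1 : ℕ)
  obtain ⟨c, hc0, hc, hcb⟩ := Int.Matrix.exists_ne_zero_int_vec_abs_le A
    (Q := B₁ ^ e * B₂ ^ d) (one_le_mul_of_one_le_of_one_le (one_le_pow₀ hB₁) (one_le_pow₀ hB₂))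
    (by
      rintro ⟨z, hz⟩ ⟨i, j⟩
      simp only [A]
      push_cast
      rw [abs_mul, abs_pow, abs_pow]
      obtain ⟨h1, h2⟩ := hSB z hz
      have h3 : |(z.1 : ℝ)| ^ (j : ℕ) ≤ B₁ ^ e :=
        (pow_le_pow_left₀ (abs_nonneg _) h1 _).trans (pow_le_pow_right₀ hB₁ (by omega))
      have h4 : |(z.2 : ℝ)| ^ (i : ℕ) ≤ B₂ ^ d :=
        (pow_le_pow_left₀ (abs_nonneg _) h2 _).trans (pow_le_pow_right₀ hB₂ (by omega))
      gcongr)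
    (t := fun j => (f.coeff (j.1 : ℕ)).coeff (j.2 : ℕ))
    (by
      intro h
      apply hf
      rw [hfc, h]
      simp [bivariateOfCoeffs])
    (by
      rintro ⟨z, hz⟩
      have h := congrArg (evalEval z.1 z.2) hfc
      rw [evalEval_bivariateOfCoeffs, hS z hz] at h
      rw [h]
      exact Finset.sum_congr rfl fun j _ => mul_comm _ _)
  refine ⟨c, hc0, fun z hz => ?_, fun j => by simpa using hcb j⟩
  rw [evalEval_bivariateOfCoeffs, ← hc ⟨z, hz⟩]
  exact Finset.sum_congr rfl fun j _ => mul_comm _ _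

theorem Polynomial.card_smooth_zeros_le {L : Type*} [Field L] [Fintype L] [DecidableEq L]
    (G : L[X][Y]) :
    (Finset.univ.filter fun z : L × L =>
      G.evalEval z.1 z.2 = 0 ∧ G.derivative.evalEval z.1 z.2 ≠ 0).card ≤
      Fintype.card L * G.natDegree := by
  have hsub : (Finset.univ.filter fun z : L × L =>
      G.evalEval z.1 z.2 = 0 ∧ G.derivative.evalEval z.1 z.2 ≠ 0) ⊆
      Finset.univ.biUnion fun x =>
        (G.map (evalRingHom x)).roots.toFinset.image fun y => (x, y) := by
    rintro ⟨x, y⟩ hz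
    obtain ⟨-, h1, h2⟩ := Finset.mem_filter.1 hz
    simp only [Finset.mem_biUnion, Finset.mem_image, Multiset.mem_toFinset]
    refine ⟨x, Finset.mem_univ _, y, ?_, rfl⟩
    rw [mem_roots, IsRoot, map_evalRingHom_eval, h1]
    intro h0
    apply h2
    rw [← map_evalRingHom_eval, ← derivative_map, h0]
    simp
  refine (Finset.card_le_card hsub).trans ((Finset.card_biUnion_le_card_mul _ _ G.natDegree
    fun x _ => ?_).trans_eq (by simp))
  exact Finset.card_image_le.trans ((Multiset.toFinset_card_le _).trans
    ((card_roots' _).trans natDegree_map_le))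

theorem Polynomial.card_le_of_smooth_mod_prime {G : ℤ[X][Y]} {d M N q : ℕ} (hq : q.Prime)
    (hGd : G.natDegree ≤ d + 1) {B₁ B₂ : ℝ} (hB₁ : 1 ≤ B₁) (hB₂ : 1 ≤ B₂)
    (hsize : (((d + 1) * (M + 1) : ℕ) + 1 : ℝ) ^ 2 * (B₁ ^ M * B₂ ^ d) ≤
      (q : ℝ) ^ ((d + 1) * (M + 1) - 1))
    (S : Finset (ℤ × ℤ)) (hS : ∀ z ∈ S, G.evalEval z.1 z.2 = 0)
    (hSq : ∀ z ∈ S, ¬ (q : ℤ) ∣ G.derivative.evalEval z.1 z.2)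
    (hSB : ∀ z ∈ S, |(z.1 : ℝ)| ≤ B₁ ∧ |(z.2 : ℝ)| ≤ B₂)
    (hN : ∀ H : ℤ[X][Y], H ≠ 0 → H.natDegree ≤ d → (∀ i, (H.coeff i).natDegree ≤ M) →
      ∀ S' ⊆ S, (∀ z ∈ S', H.evalEval z.1 z.2 = 0) → S'.card ≤ N) :
    S.card ≤ N * (q * (d + 1)) := by
  classical
  have := Fact.mk hq
  let π : ℤ × ℤ → ZMod q × ZMod q := fun z => (z.1, z.2)
  have key : ∀ (g : ℤ[X][Y]) (z : ℤ × ℤ),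
      (g.map (mapRingHom (Int.castRingHom (ZMod q)))).evalEval (π z).1 (π z).2 =
        ((g.evalEval z.1 z.2 : ℤ) : ZMod q) := fun g z =>
    map_mapRingHom_evalEval (Int.castRingHom (ZMod q)) g z.1 z.2
  have himage : (S.image π).card ≤ q * (d + 1) := by
    refine (Finset.card_le_card (t := Finset.univ.filter fun w : ZMod q × ZMod q =>
      (G.map (mapRingHom (Int.castRingHom (ZMod q)))).evalEval w.1 w.2 = 0 ∧
      (G.map (mapRingHom (Int.castRingHom (ZMod q)))).derivative.evalEval w.1 w.2 ≠ 0) ?_).trans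
      ((card_smooth_zeros_le _).trans ?_)
    · intro w hw
      obtain ⟨z, hz, rfl⟩ := Finset.mem_image.1 hw
      rw [Finset.mem_filter, derivative_map, key, key, hS z hz]
      exact ⟨Finset.mem_univ _, by simp,
        fun h => hSq z hz ((ZMod.intCast_zmod_eq_zero_iff_dvd _ q).1 h)⟩
    · rw [ZMod.card]
      exact Nat.mul_le_mul_left _ (natDegree_map_le.trans hGd)
  refine (Finset.card_le_mul_card_image (f := π) S N ?_).trans (Nat.mul_le_mul_left _ himage)
  intro w hw
  obtain ⟨z₀, hz₀, rfl⟩ := Finset.mem_image.1 hw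
  have hcop : IsCoprime (G.derivative.evalEval z₀.1 z₀.2) (q : ℤ) :=
    ((Nat.prime_iff_prime_int.1 hq).coprime_iff_not_dvd.2 (hSq z₀ hz₀)).symm
  obtain ⟨H, hH0, hHd, hHM, hH⟩ :=
    G.exists_auxiliary_polynomial hq.pos hcop d M hB₁ hB₂ hsize
  refine hN H hH0 hHd hHM _ (Finset.filter_subset _ _) fun z hz => ?_
  obtain ⟨hzS, hzπ⟩ := Finset.mem_filter.1 hz
  rw [Prod.ext_iff] at hzπ
  refine hH z.1 z.2 (hS z hzS) ?_ ?_ (hSB z hzS).1 (hSB z hzS).2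
  · rw [← Int.modEq_iff_dvd, ← ZMod.intCast_eq_intCast_iff]
    exact hzπ.1.symm
  · rw [← Int.modEq_iff_dvd, ← ZMod.intCast_eq_intCast_iff]
    exact hzπ.2.symm

theorem Nat.exists_finset_primes_card_eq (n : ℕ) (hn : n ≠ 0) (k : ℕ) :
    ∃ P : Finset ℕ, P.card = k ∧ ∀ q ∈ P, q.Prime ∧ n < q ∧ q ≤ 2 ^ k * n := by
  induction k with
  | zero => exact ⟨∅, by simp⟩
  | succ k ih =>
    obtain ⟨P, hPk, hP⟩ := ih
    obtain ⟨q, hq, hlt, hle⟩ := Nat.exists_prime_lt_and_le_two_mul (2 ^ k * n) (by positivity)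
    have hqP : q ∉ P := fun h => absurd (hP q h).2.2 (by omega)
    refine ⟨insert q P, by rw [Finset.card_insert_of_notMem hqP, hPk], ?_⟩
    intro r hr
    have h2 : 2 ^ (k + 1) * n = 2 * (2 ^ k * n) := by ring
    rcases Finset.mem_insert.1 hr with rfl | hr
    · exact ⟨hq, (Nat.le_mul_of_pos_left n (by positivity)).trans_lt hlt, by omega⟩
    · obtain ⟨h3, h4, h5⟩ := hP r hr
      exact ⟨h3, h4, by omega⟩

theorem Int.exists_prime_not_dvd_of_natAbs_lt {m : ℤ} (hm : m ≠ 0) {n : ℕ} {P : Finset ℕ}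
    (hP : ∀ q ∈ P, q.Prime ∧ n < q) (hlt : m.natAbs < n ^ P.card) :
    ∃ q ∈ P, ¬ (q : ℤ) ∣ m := by
  by_contra! h
  have hdvd : ∏ q ∈ P, q ∣ m.natAbs :=
    Finset.prod_primes_dvd _ (fun q hq => (hP q hq).1.prime)
      fun q hq => Int.natCast_dvd.1 (h q hq)
  have h1 := Nat.le_of_dvd (Int.natAbs_pos.2 hm) hdvd
  have h2 : n ^ P.card ≤ ∏ q ∈ P, q := Finset.pow_card_le_prod _ _ _ fun q hq => (hP q hq).2.le
  omega

theorem Polynomial.card_le_of_derivative_ne_zero {G : ℤ[X][Y]} {d M N n k : ℕ} (hn : n ≠ 0)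
    (hGd : G.natDegree ≤ d + 1) {B₁ B₂ : ℝ} (hB₁ : 1 ≤ B₁) (hB₂ : 1 ≤ B₂)
    (hsize : (((d + 1) * (M + 1) : ℕ) + 1 : ℝ) ^ 2 * (B₁ ^ M * B₂ ^ d) ≤
      (n : ℝ) ^ ((d + 1) * (M + 1) - 1))
    (S : Finset (ℤ × ℤ)) (hS : ∀ z ∈ S, G.evalEval z.1 z.2 = 0)
    (hS0 : ∀ z ∈ S, G.derivative.evalEval z.1 z.2 ≠ 0)
    (hSk : ∀ z ∈ S, (G.derivative.evalEval z.1 z.2).natAbs < n ^ k)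
    (hSB : ∀ z ∈ S, |(z.1 : ℝ)| ≤ B₁ ∧ |(z.2 : ℝ)| ≤ B₂)
    (hN : ∀ H : ℤ[X][Y], H ≠ 0 → H.natDegree ≤ d → (∀ i, (H.coeff i).natDegree ≤ M) →
      ∀ S' ⊆ S, (∀ z ∈ S', H.evalEval z.1 z.2 = 0) → S'.card ≤ N) :
    S.card ≤ k * (N * (2 ^ k * n * (d + 1))) := by
  classical
  obtain ⟨P, rfl, hP⟩ := Nat.exists_finset_primes_card_eq n hn k
  have hsub : S ⊆ P.biUnion fun q =>
      S.filter fun z => ¬ (q : ℤ) ∣ G.derivative.evalEval z.1 z.2 := by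
    intro z hz
    obtain ⟨q, hq, hqz⟩ := Int.exists_prime_not_dvd_of_natAbs_lt (hS0 z hz)
      (fun q hq => ⟨(hP q hq).1, (hP q hq).2.1⟩) (hSk z hz)
    exact Finset.mem_biUnion.2 ⟨q, hq, Finset.mem_filter.2 ⟨hz, hqz⟩⟩
  refine (Finset.card_le_card hsub).trans (Finset.card_biUnion_le_card_mul _ _ _ fun q hq => ?_)
  obtain ⟨h1, h2, h3⟩ := hP q hq
  refine (card_le_of_smooth_mod_prime (N := N) h1 hGd hB₁ hB₂ (hsize.trans ?_) _
    ?_ ?_ ?_ ?_).trans ?_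
  · gcongr
  · exact fun z hz => hS z (Finset.mem_filter.1 hz).1
  · exact fun z hz => (Finset.mem_filter.1 hz).2
  · exact fun z hz => hSB z (Finset.mem_filter.1 hz).1
  · exact fun H h0 hd hM S' hS' => hN H h0 hd hM S' (hS'.trans (Finset.filter_subset _ _))
  · gcongr

theorem Polynomial.abs_derivative_evalEval_bivariateOfCoeffs_le {d e : ℕ}
    (c : Fin (d + 1) × Fin (e + 1) → ℤ) {h B₁ B₂ : ℝ} (hB₁ : 1 ≤ B₁) (hB₂ : 1 ≤ B₂)
    (hc : ∀ j, |(c j : ℝ)| ≤ h) {x y : ℤ} (hx : |(x : ℝ)| ≤ B₁) (hy : |(y : ℝ)| ≤ B₂) :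
    |(((bivariateOfCoeffs c).derivative.evalEval x y : ℤ) : ℝ)| ≤
      ((d + 1) * (e + 1) : ℕ) * (h * (d * (B₁ ^ e * B₂ ^ d))) := by
  have h1 : (bivariateOfCoeffs c).derivative.evalEval x y =
      ∑ j, c j * (((j.1 : ℕ) : ℤ) * (x ^ (j.2 : ℕ) * y ^ ((j.1 : ℕ) - 1))) := by
    rw [bivariateOfCoeffs, derivative_sum, evalEval_finsetSum]
    refine Finset.sum_congr rfl fun j _ => ?_
    simp [evalEval, derivative_monomial]
    ring
  have h0 : 0 ≤ h := (abs_nonneg _).trans (hc 0)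
  rw [h1]
  push_cast
  refine (Finset.abs_sum_le_sum_abs _ _).trans ((Finset.sum_le_card_nsmul _ _
    (h * (d * (B₁ ^ e * B₂ ^ d))) fun j _ => ?_).trans_eq (by simp))
  rw [abs_mul, abs_mul, abs_mul, abs_pow, abs_pow, Nat.abs_cast]
  have h3 : |(x : ℝ)| ^ (j.2 : ℕ) ≤ B₁ ^ e :=
    (pow_le_pow_left₀ (abs_nonneg _) hx _).trans (pow_le_pow_right₀ hB₁ (by omega))
  have h4 : |(y : ℝ)| ^ ((j.1 : ℕ) - 1) ≤ B₂ ^ d :=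
    (pow_le_pow_left₀ (abs_nonneg _) hy _).trans (pow_le_pow_right₀ hB₂ (by omega))
  have h5 : ((j.1 : ℕ) : ℝ) ≤ d := by exact_mod_cast (by omega : (j.1 : ℕ) ≤ d)
  have h6 := hc j
  gcongr

theorem Polynomial.card_zeros_le_of_irreducible_map {L : Type*} [Field L] [CharZero L]
    {f : ℤ[X][Y]} {d e M n k : ℕ}
    (hf : Irreducible (f.map (mapRingHom (Int.castRingHom L)))) (hd : f.natDegree = d + 1)
    (hfe : ∀ i, (f.coeff i).natDegree ≤ e) {B₁ B₂ : ℝ} (hB₁ : 1 ≤ B₁) (hB₂ : 1 ≤ B₂)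
    (hn : n ≠ 0)
    (hsize : (((d + 1) * (M + 1) : ℕ) + 1 : ℝ) ^ 2 * (B₁ ^ M * B₂ ^ d) ≤
      (n : ℝ) ^ ((d + 1) * (M + 1) - 1))
    (hk : ((d + 1 + 1) * (e + 1) : ℕ) *
      ((((d + 1 + 1) * (e + 1) : ℕ) * (B₁ ^ e * B₂ ^ (d + 1))) ^ ((d + 1 + 1) * (e + 1)) *
        ((d + 1 : ℕ) * (B₁ ^ e * B₂ ^ (d + 1)))) < (n : ℝ) ^ k)
    (S : Finset (ℤ × ℤ)) (hS : ∀ z ∈ S, f.evalEval z.1 z.2 = 0)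
    (hSB : ∀ z ∈ S, |(z.1 : ℝ)| ≤ B₁ ∧ |(z.2 : ℝ)| ≤ B₂) :
    S.card ≤ 2 * (d + 1) * (e + M) * (d + 1) +
      k * (2 * (d + 1) * (e + M) * (d + 1) * (2 ^ k * n * (d + 1))) := by
  classical
  have hf0 : f ≠ 0 := by
    rintro rfl
    simp at hd
  have hbez : ∀ H : ℤ[X][Y], H ≠ 0 → H.natDegree ≤ d →
      (∀ i, (H.coeff i).natDegree ≤ e + M) → ∀ S' ⊆ S, (∀ z ∈ S', H.evalEval z.1 z.2 = 0) →
      S'.card ≤ 2 * (d + 1) * (e + M) * (d + 1) := fun H h0 hHd hHe S' hS' hH =>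
    card_common_zeros_le_of_irreducible_map hf hd (fun i => (hfe i).trans (by omega)) h0
      (by omega) hHe S' fun z hz => ⟨hS z (hS' hz), hH z hz⟩
  obtain ⟨c, hc0, hcS, hcb⟩ := exists_small_coeffs_vanishing hf0 hd.le hfe S hS hB₁ hB₂ hSB
  have hG0 := bivariateOfCoeffs_ne_zero hc0
  have hGd := natDegree_bivariateOfCoeffs_le c
  have hGe := natDegree_coeff_bivariateOfCoeffs_le c
  have hGb := fun z hz => abs_derivative_evalEval_bivariateOfCoeffs_le c hB₁ hB₂ hcb
    (hSB z hz).1 (hSB z hz).2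
  set G := bivariateOfCoeffs c
  rcases hGd.lt_or_eq with hlt | heq
  · exact (hbez G hG0 (by omega) (fun i => (hGe i).trans (by omega)) S subset_rfl hcS).trans
      (Nat.le_add_right _ _)
  have hG' : G.derivative ≠ 0 := fun h => by
    have := derivative_eq_zero.1 h
    omega
  rw [← Finset.card_filter_add_card_filter_not (s := S)
    fun z => G.derivative.evalEval z.1 z.2 = 0]
  refine add_le_add ?_ ?_
  · refine hbez G.derivative hG' ?_ (fun i => ?_) _ (Finset.filter_subset _ _)
      fun z hz => (Finset.mem_filter.1 hz).2
    · exact (natDegree_derivative_le G).trans (by omega)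
    · rw [coeff_derivative, ← Nat.cast_succ]
      refine (natDegree_mul_le).trans ?_
      rw [natDegree_natCast, add_zero]
      exact (hGe _).trans (by omega)
  · refine card_le_of_derivative_ne_zero hn hGd hB₁ hB₂ hsize _ ?_ ?_ ?_ ?_ ?_
    · exact fun z hz => hcS z (Finset.mem_filter.1 hz).1
    · exact fun z hz => (Finset.mem_filter.1 hz).2
    · intro z hz
      rw [← Nat.cast_lt (α := ℝ), Nat.cast_natAbs]
      push_cast
      exact (hGb z (Finset.mem_filter.1 hz).1).trans_lt hk
    · exact fun z hz => hSB z (Finset.mem_filter.1 hz).1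
    · exact fun H h0 hHd hHM S' hS' => hbez H h0 hHd (fun i => (hHM i).trans (by omega)) S'
        (hS'.trans (Finset.filter_subset _ _))

theorem Set.finite_int_prod_of_abs_le (B₁ B₂ : ℝ) :
    {z : ℤ × ℤ | |(z.1 : ℝ)| ≤ B₁ ∧ |(z.2 : ℝ)| ≤ B₂}.Finite := by
  refine ((Set.finite_Icc (-⌊B₁⌋) ⌊B₁⌋).prod (Set.finite_Icc (-⌊B₂⌋) ⌊B₂⌋)).subset ?_
  have key : ∀ (B : ℝ) (x : ℤ), |(x : ℝ)| ≤ B → x ∈ Set.Icc (-⌊B⌋) ⌊B⌋ := fun B x hx =>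
    abs_le.1 (Int.le_floor.2 (by rwa [Int.cast_abs]))
  exact fun z hz => ⟨key _ _ hz.1, key _ _ hz.2⟩

/-- The prime range `n ≈ D ^ 2 * B₁ ^ (1 / (d + 1) + ε)` is large enough for an auxiliary
polynomial of bidegree `(M, d)` to exist, where `D = (d + 1) * (M + 1) + 1`. -/
theorem auxiliary_size_le_pow {E ε B₁ B₂ : ℝ} {d M n : ℕ} (hB₁ : 1 < B₁) (hB₂ : 1 < B₂)
    (hB : B₂ ≤ B₁ ^ E) (hε : 0 < ε) (hM : 1 ≤ M) (hEM : E ≤ ε * M)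
    (hn : (((d + 1) * (M + 1) : ℕ) + 1 : ℝ) ^ 2 * B₁ ^ ((1 : ℝ) / (d + 1 : ℕ) + ε) ≤ n) :
    (((d + 1) * (M + 1) : ℕ) + 1 : ℝ) ^ 2 * (B₁ ^ M * B₂ ^ d) ≤
      (n : ℝ) ^ ((d + 1) * (M + 1) - 1) := by
  set D : ℝ := (((d + 1) * (M + 1) : ℕ) + 1 : ℝ) ^ 2 with hD
  have hD1 : 1 ≤ D := one_le_pow₀ (le_add_of_nonneg_left (Nat.cast_nonneg _))
  have hB₁0 : 0 < B₁ := by linarith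
  set A := B₁ ^ ((1 : ℝ) / (d + 1 : ℕ) + ε) with hA
  have hA1 : 1 ≤ A := Real.one_le_rpow hB₁.le (by positivity)
  have hn1 : (1 : ℝ) ≤ n := (one_le_mul_of_one_le_of_one_le hD1 hA1).trans hn
  have hexp : (d + 1) * M ≤ (d + 1) * (M + 1) - 1 := by
    rw [mul_add]; omega
  have hdM : (d + 1) * M ≠ 0 := by positivity
  calc D * (B₁ ^ M * B₂ ^ d) ≤ D * (B₁ ^ M * (B₁ ^ E) ^ d) := by gcongr
    _ = D * B₁ ^ ((M : ℝ) + E * d) := by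
        rw [Real.rpow_add hB₁0, Real.rpow_natCast, Real.rpow_mul hB₁0.le, Real.rpow_natCast]
    _ ≤ D * B₁ ^ (((1 : ℝ) / (d + 1 : ℕ) + ε) * ((d + 1) * M : ℕ)) := by
        gcongr 2
        · exact hB₁.le
        · have : ((1 : ℝ) / (d + 1 : ℕ) + ε) * ((d + 1) * M : ℕ) = M + (ε * M) * (d + 1) := by
            push_cast
            field_simp
          rw [this]
          have : E * d ≤ (ε * M) * (d + 1) := by gcongr; linarith
          linarith
    _ = D * A ^ ((d + 1) * M) := by rw [Real.rpow_mul hB₁0.le, Real.rpow_natCast]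
    _ ≤ D ^ ((d + 1) * M) * A ^ ((d + 1) * M) := by
        gcongr
        exact le_self_pow₀ hD1 hdM
    _ = (D * A) ^ ((d + 1) * M) := (mul_pow _ _ _).symm
    _ ≤ (n : ℝ) ^ ((d + 1) * M) := by gcongr
    _ ≤ _ := pow_le_pow_right₀ hn1 hexp

theorem exists_coeff_bound_lt_pow (E : ℝ) (d e : ℕ) :
    ∃ k : ℕ, ∀ B₁ B₂ : ℝ, 1 < B₁ → 1 < B₂ → B₂ ≤ B₁ ^ E → ∀ n : ℕ, 2 ≤ n →
      B₁ ^ ((1 : ℝ) / (d + 1 : ℕ)) ≤ n →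
      ((d + 1 + 1) * (e + 1) : ℕ) *
        ((((d + 1 + 1) * (e + 1) : ℕ) * (B₁ ^ e * B₂ ^ (d + 1))) ^ ((d + 1 + 1) * (e + 1)) *
          ((d + 1 : ℕ) * (B₁ ^ e * B₂ ^ (d + 1)))) < (n : ℝ) ^ k := by
  set N := (d + 1 + 1) * (e + 1)
  set K := N * (N ^ N * (d + 1))
  set a : ℕ := ⌈E⌉₊
  set l := (d + 1) * ((e + a * (d + 1)) * (N + 1))
  refine ⟨K + l, fun B₁ B₂ hB₁ hB₂ hB n hn hBn => ?_⟩
  have hn2 : (2 : ℝ) ≤ n := by exact_mod_cast hn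
  have h1 : B₁ ≤ (n : ℝ) ^ (d + 1) := by
    calc B₁ = (B₁ ^ ((1 : ℝ) / (d + 1 : ℕ))) ^ (d + 1) := by
          rw [one_div, Real.rpow_inv_natCast_pow (by linarith) (by omega)]
      _ ≤ _ := pow_le_pow_left₀ (by positivity) hBn _
  have h2 : B₂ ≤ B₁ ^ a := by
    rw [← Real.rpow_natCast]
    exact hB.trans (Real.rpow_le_rpow_of_exponent_le hB₁.le (Nat.le_ceil E))
  have hQ : B₁ ^ e * B₂ ^ (d + 1) ≤ B₁ ^ (e + a * (d + 1)) := by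
    rw [pow_add B₁ e, pow_mul B₁ a]
    gcongr
  have hK : (K : ℝ) < (n : ℝ) ^ K := by
    have : (K : ℝ) < 2 ^ K := by exact_mod_cast Nat.lt_two_pow_self
    exact this.trans_le (pow_le_pow_left₀ (by norm_num) hn2 _)
  set Q := B₁ ^ e * B₂ ^ (d + 1)
  have hQ0 : 0 < Q := by positivity
  calc (N : ℝ) * ((N * Q) ^ N * ((d + 1 : ℕ) * Q)) = K * Q ^ (N + 1) := by
        simp only [K]
        push_cast
        ring
    _ ≤ K * (B₁ ^ (e + a * (d + 1))) ^ (N + 1) := by gcongr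
    _ ≤ K * (((n : ℝ) ^ (d + 1)) ^ (e + a * (d + 1))) ^ (N + 1) := by gcongr
    _ = K * (n : ℝ) ^ l := by rw [← pow_mul, ← pow_mul]
    _ < (n : ℝ) ^ K * (n : ℝ) ^ l := by gcongr
    _ = _ := (pow_add _ _ _).symm

theorem MvPolynomial.ncard_zeros_le (E : ℝ) (hE : 0 < E) (d : ℕ) (ε : ℝ) (hε : 0 < ε)
    {L : Type*} [Field L] [CharZero L] :
    ∃ Cst : ℝ, ∀ F : MvPolynomial (Fin 2) ℤ,
      Irreducible (MvPolynomial.map (Int.castRingHom L) F) →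
      F.degreeOf 1 = d + 1 → (F.totalDegree : ℝ) ≤ E →
      ∀ B₁ B₂ : ℝ, 1 < B₁ → 1 < B₂ → B₂ ≤ B₁ ^ E →
        (({z : ℤ × ℤ | |(z.1 : ℝ)| ≤ B₁ ∧ |(z.2 : ℝ)| ≤ B₂ ∧
            MvPolynomial.eval ![z.1, z.2] F = 0}).ncard : ℝ) ≤
          Cst * B₁ ^ ((1 : ℝ) / (d + 1 : ℕ) + ε) := by
  set e := ⌊E⌋₊
  set M := ⌈E / ε⌉₊
  have hM : 1 ≤ M := Nat.one_le_ceil_iff.2 (by positivity)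
  have hEM : E ≤ ε * M := by
    rw [← div_le_iff₀' hε]
    exact Nat.le_ceil _
  obtain ⟨k, hk⟩ := exists_coeff_bound_lt_pow E d e
  set N := 2 * (d + 1) * (e + M) * (d + 1)
  set D : ℝ := (((d + 1) * (M + 1) : ℕ) + 1 : ℝ) ^ 2
  have hD : 2 ≤ D := by
    have h : (1 : ℝ) ≤ ((d + 1) * (M + 1) : ℕ) := by
      exact_mod_cast Nat.one_le_iff_ne_zero.2 (by positivity)
    simp only [D]
    nlinarith
  refine ⟨N + k * (N * (2 ^ k * (2 * D) * (d + 1 : ℕ))), fun F hF hFd hFE B₁ B₂ hB₁ hB₂ hB => ?_⟩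
  have hB₁0 : 0 < B₁ := by linarith
  set A := B₁ ^ ((1 : ℝ) / (d + 1 : ℕ) + ε) with hA
  have hA1 : 1 ≤ A := Real.one_le_rpow hB₁.le (by positivity)
  have hDA : 2 ≤ D * A := hD.trans (le_mul_of_one_le_right (by linarith) hA1)
  set n := ⌈D * A⌉₊
  have hDn : D * A ≤ n := Nat.le_ceil _
  have hnD : (n : ℝ) ≤ 2 * D * A := by
    have := (Nat.ceil_lt_add_one (by linarith : 0 ≤ D * A)).le
    linarith
  have hn2 : 2 ≤ n := by exact_mod_cast hDA.trans hDn
  have hBn : B₁ ^ ((1 : ℝ) / (d + 1 : ℕ)) ≤ n :=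
    calc B₁ ^ ((1 : ℝ) / (d + 1 : ℕ)) ≤ A :=
          Real.rpow_le_rpow_of_exponent_le hB₁.le (by linarith)
      _ ≤ D * A := le_mul_of_one_le_left (by linarith) (by linarith)
      _ ≤ n := hDn
  have hfin : {z : ℤ × ℤ | |(z.1 : ℝ)| ≤ B₁ ∧ |(z.2 : ℝ)| ≤ B₂ ∧
      MvPolynomial.eval ![z.1, z.2] F = 0}.Finite :=
    (Set.finite_int_prod_of_abs_le B₁ B₂).subset fun z hz => ⟨hz.1, hz.2.1⟩
  have hirr : Irreducible (((equivMvPolynomial ℤ).symm F).map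
      (mapRingHom (Int.castRingHom L))) := by
    rw [map_equivMvPolynomial_symm]
    exact (MulEquiv.irreducible_iff (equivMvPolynomial L).symm).2 hF
  have hcard := Polynomial.card_zeros_le_of_irreducible_map (M := M) (e := e) hirr
    (by rw [natDegree_equivMvPolynomial_symm, hFd])
    (fun i => (natDegree_coeff_equivMvPolynomial_symm_le F i).trans (Nat.le_floor hFE))
    hB₁.le hB₂.le (by omega) (auxiliary_size_le_pow hB₁ hB₂ hB hε hM hEM hDn)
    (hk B₁ B₂ hB₁ hB₂ hB n hn2 hBn) hfin.toFinset
    (fun z hz => by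
      rw [evalEval_equivMvPolynomial_symm]
      exact (hfin.mem_toFinset.1 hz).2.2)
    (fun z hz => ⟨(hfin.mem_toFinset.1 hz).1, (hfin.mem_toFinset.1 hz).2.1⟩)
  rw [Set.ncard_eq_toFinset_card _ hfin]
  calc (hfin.toFinset.card : ℝ) ≤ (N + k * (N * (2 ^ k * n * (d + 1))) : ℕ) := by
        exact_mod_cast hcard
    _ = N + k * (N * (2 ^ k * n * (d + 1 : ℕ))) := by push_cast; ring
    _ ≤ N * A + k * (N * (2 ^ k * (2 * D * A) * (d + 1 : ℕ))) := by
        gcongr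
        exact le_mul_of_one_le_right (Nat.cast_nonneg _) hA1
    _ = _ := by ring

end

open MvPolynomial

/-- Bombieri–Pila, rectangular version.  For all `E > 1`, `d ≥ 1`
and `ε > 0` there is a constant `C = C(E, d, ε)` such that: for every `F ∈ ℤ[x₁,x₂]`
which is irreducible over an algebraic closure of `ℚ`, with `deg_{x₂}(F) = d` and total
degree at most `E`, and all reals `B₁, B₂ > 1` with `B₂ ≤ B₁^E`, the number of integer
points `(x₁, x₂)` with `|x₁| ≤ B₁`, `|x₂| ≤ B₂` and `F(x₁,x₂) = 0` is at most
`C·B₁^(1/d + ε)`. -/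
theorem bombieri_pila_rectangles (E : ℝ) (hE : 1 < E) (d : ℕ) (hd : 1 ≤ d)
    (ε : ℝ) (hε : 0 < ε) :
    ∃ Cst : ℝ, ∀ F : MvPolynomial (Fin 2) ℤ,
      Irreducible (MvPolynomial.map (Int.castRingHom (AlgebraicClosure ℚ)) F) →
      F.degreeOf 1 = d →
      (F.totalDegree : ℝ) ≤ E →
      ∀ B1 B2 : ℝ, 1 < B1 → 1 < B2 → B2 ≤ B1 ^ E →
        (({z : ℤ × ℤ | |(z.1 : ℝ)| ≤ B1 ∧ |(z.2 : ℝ)| ≤ B2 ∧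
            MvPolynomial.eval ![z.1, z.2] F = 0}).ncard : ℝ) ≤
          Cst * B1 ^ ((1 : ℝ) / d + ε) := by
  obtain ⟨d, rfl⟩ := Nat.exists_eq_add_of_le' hd
  exact MvPolynomial.ncard_zeros_le E (by linarith) d ε hε
end

section
/- Let p > 2 be a prime, let r ≥ 1, let F ∈ ℤ_p[x1,…,xr] be a polynomial, and let u ∈ ℤ_p^r satisfy F(u) = 0 and ∂F/∂x_r(u) ∈ ℤ_p^× (i.e. the partial derivative at u is not divisible by p). Then for every N ≥ 1 there exists a polynomial f_N ∈ ℤ_p[x1,…,x_{r−1}] such that every v ∈ ℤ_p^r with F(v) = 0 and v ≡ u (mod p) satisfies v_r ≡ f_N(v1,…,v_{r−1}) (mod p^N). -/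
namespace MvPolynomial

variable {σ R : Type*} [CommRing R]

/-- Coordinatewise congruent points have congruent values under a polynomial. -/
theorem dvd_eval_sub_eval (G : MvPolynomial σ R) {a : R} {v u : σ → R}
    (h : ∀ i, a ∣ v i - u i) : a ∣ eval v G - eval u G := by
  induction G using MvPolynomial.induction_on with
  | C c => simp
  | add P Q hP hQ =>
    simp only [map_add]
    convert dvd_add hP hQ using 1
    ring
  | mul_X P i hP =>
    simp only [map_mul, eval_X]
    convert dvd_add (hP.mul_right (v i)) ((h i).mul_left (eval u P)) using 1
    ring

/-- First-order Taylor expansion of a polynomial in one of its variables. -/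
theorem sq_dvd_eval_update_sub [DecidableEq σ] (G : MvPolynomial σ R) (v : σ → R) (j : σ) (t : R) :
    (t - v j) ^ 2 ∣ eval (Function.update v j t) G - eval v G
      - (t - v j) * eval v (pderiv j G) := by
  induction G using MvPolynomial.induction_on with
  | C c => simp
  | add P Q hP hQ =>
    simp only [map_add]
    convert dvd_add hP hQ using 1
    ring
  | mul_X P i hP =>
    obtain ⟨q, hq⟩ := hP
    simp only [Derivation.leibniz, map_mul, map_add, eval_X, smul_eq_mul]
    rcases eq_or_ne i j with rfl | hij
    · simp only [Function.update_self, pderiv_X_self, map_one]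
      exact ⟨q * t + eval v (pderiv i P), by linear_combination t * hq⟩
    · simp only [Function.update_of_ne hij, pderiv_X_of_ne hij, map_zero]
      exact ⟨q * v i, by linear_combination v i * hq⟩

end MvPolynomial

/-- non-archimedean implicit function theorem.  Let `p > 2` be prime,
`F ∈ ℤ_p[x₁,…,x_r]` (here `r = n + 1 ≥ 1`, the variables are indexed by `Fin (n+1)` and
the last variable plays the role of `x_r`), and let `u ∈ ℤ_p^r` satisfy `F(u) = 0` and
`p ∤ ∂F/∂x_r(u)`.  Then for every `N ≥ 1` there is a polynomial
`f_N ∈ ℤ_p[x₁,…,x_{r−1}]` such that every `v ∈ ℤ_p^r` with `F(v) = 0` and `v ≡ u (mod p)`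
satisfies `v_r ≡ f_N(v₁,…,v_{r−1}) (mod p^N)`. -/
theorem padic_implicit_function (p : ℕ) [hp : Fact p.Prime] (hp2 : 2 < p)
    (n : ℕ) (F : MvPolynomial (Fin (n + 1)) ℤ_[p]) (u : Fin (n + 1) → ℤ_[p])
    (hFu : MvPolynomial.eval u F = 0)
    (hder : ¬ (p : ℤ_[p]) ∣ MvPolynomial.eval u (MvPolynomial.pderiv (Fin.last n) F)) :
    ∀ N : ℕ, 1 ≤ N → ∃ fN : MvPolynomial (Fin n) ℤ_[p],
      ∀ v : Fin (n + 1) → ℤ_[p], MvPolynomial.eval v F = 0 →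
        (∀ i, (p : ℤ_[p]) ∣ (v i - u i)) →
        (p : ℤ_[p]) ^ N ∣
          (v (Fin.last n) - MvPolynomial.eval (fun i => v (Fin.castSucc i)) fN) := by
  have hunit : IsUnit (MvPolynomial.eval u (MvPolynomial.pderiv (Fin.last n) F)) := by
    by_contra h
    exact hder (PadicInt.norm_lt_one_iff_dvd _ |>.1 (PadicInt.mem_nonunits.1 h))
  obtain ⟨c, hc⟩ := hunit.exists_right_inv
  intro N hN
  induction N, hN using Nat.le_induction with
  | base =>
    exact ⟨MvPolynomial.C (u (Fin.last n)), fun v _ hvu => by simpa using hvu (Fin.last n)⟩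
  | succ N hN ih =>
    obtain ⟨f, hf⟩ := ih
    let g : Fin (n + 1) → MvPolynomial (Fin n) ℤ_[p] := Fin.snoc MvPolynomial.X f
    refine ⟨f - MvPolynomial.C c * MvPolynomial.bind₁ g F, fun v hv hvu => ?_⟩
    have hfv := hf v hv hvu
    set t := MvPolynomial.eval (fun i => v (Fin.castSucc i)) f with ht
    have hg : MvPolynomial.eval (fun i => v (Fin.castSucc i)) (MvPolynomial.bind₁ g F) =
        MvPolynomial.eval (Function.update v (Fin.last n) t) F := by
      have hpt : (fun j => MvPolynomial.eval (fun i => v (Fin.castSucc i)) (g j)) =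
          Function.update v (Fin.last n) t := by
        funext j
        refine Fin.lastCases ?_ (fun i => ?_) j
        · simp [g, ht]
        · simp [g, (Fin.castSucc_lt_last i).ne]
      rw [← hpt]
      exact MvPolynomial.eval₂Hom_bind₁ _ _ _ _
    obtain ⟨q, hq⟩ := F.sq_dvd_eval_update_sub v (Fin.last n) t
    obtain ⟨a, ha⟩ := hfv
    obtain ⟨b, hb⟩ := (MvPolynomial.pderiv (Fin.last n) F).dvd_eval_sub_eval hvu
    obtain ⟨e, he⟩ : (p : ℤ_[p]) ∣ t - v (Fin.last n) := by
      rw [dvd_sub_comm]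
      exact (dvd_pow_self _ (by lia)).trans ⟨a, ha⟩
    simp only [map_sub, map_mul, MvPolynomial.eval_C, hg, ← ht]
    rw [hv] at hq
    set d := MvPolynomial.eval v (MvPolynomial.pderiv (Fin.last n) F)
    set s := MvPolynomial.eval u (MvPolynomial.pderiv (Fin.last n) F)
    set y := v (Fin.last n)
    refine ⟨a * (-(c * b) - c * e * q), ?_⟩
    have key : y - (t - c * MvPolynomial.eval (Function.update v (Fin.last n) t) F) =
        (y - t) * (-(c * (d - s)) - c * (t - y) * q) := by
      linear_combination c * hq - (y - t) * hc
    rw [key, ha, hb, he]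
    ring
end

section
/- Let Q and q be positive definite integral quadratic forms in 4 variables with Gram matrices M_Q and M_q. For every ε > 0 there is a constant C, depending only on Q and ε, such that the number of representations of q by Q, namely #{ X ∈ Mat₄(ℤ) : Xᵀ·M_Q·X = M_q }, is at most C · m_1(q) · m_2'(q) · disc(q)^ε. -/
open Matrix

noncomputable section

/-- `M` is the Gram matrix of a positive definite integral quadratic form in `n` variables. -/
def IsIntegralPosDefForm {n : ℕ} (M : Matrix (Fin n) (Fin n) ℚ) : Prop :=
  M.IsSymm ∧ (∀ i, ∃ z : ℤ, M i i = z) ∧ (∀ i j, ∃ z : ℤ, 2 * M i j = z) ∧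
    ∀ v : Fin n → ℚ, v ≠ 0 → 0 < v ⬝ᵥ M.mulVec v

/-- Gram determinant of the family `u` of integer vectors with respect to `M`. -/
def gramDet {nvar j : ℕ} (M : Matrix (Fin nvar) (Fin nvar) ℚ)
    (u : Fin j → Fin nvar → ℤ) : ℚ :=
  (Matrix.of fun a b =>
    (fun i => ((u a i : ℚ))) ⬝ᵥ M.mulVec fun i => ((u b i : ℚ))).det

/-- `k_1(p,q') + ⋯ + k_j(p,q')`: the minimum over all rank-`j` primitive sublattices `Λ`
(of nonzero discriminant) of `ord_p(2^j·disc(q'|_Λ))`. -/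
def kSum {nvar : ℕ} (M : Matrix (Fin nvar) (Fin nvar) ℚ) (j p0 : ℕ) : ℕ :=
  sInf {v : ℕ | ∃ u : Fin j → Fin nvar → ℤ,
    LinearIndependent ℤ u ∧
    (∀ w : Fin nvar → ℤ,
      (fun i => ((w i : ℚ))) ∈
          Submodule.span ℚ (Set.range fun a => fun i => ((u a i : ℚ))) →
        w ∈ Submodule.span ℤ (Set.range u)) ∧
    2 ^ j * gramDet M u ≠ 0 ∧
    (v : ℤ) = padicValRat p0 (2 ^ j * gramDet M u)}

/-- `m1`, `m2` and `m2'` are the quantities `m_1(q)`, `m_2(q)` and `m_2'(q)`: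
`m_j(q) = ∏_p p^(k_j(p,q))` is the positive rational determined by
`v_p(m_j) = k_j(p,q)` for all primes `p`, and `m_2'(q)` is the largest positive integer
whose square divides `m_2(q)`. -/
def IsM1M2M2' {nvar : ℕ} (Mq : Matrix (Fin nvar) (Fin nvar) ℚ)
    (m1 m2 : ℚ) (m2' : ℕ) : Prop :=
  0 < m1 ∧ (∀ p : ℕ, p.Prime → padicValRat p m1 = kSum Mq 1 p) ∧
    0 < m2 ∧
    (∀ p : ℕ, p.Prime → padicValRat p m2 = (kSum Mq 2 p : ℤ) - (kSum Mq 1 p : ℤ)) ∧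
    0 < m2' ∧ (∃ z : ℤ, m2 = (m2' : ℚ) ^ 2 * z) ∧
    ∀ k : ℕ, 0 < k → (∃ z : ℤ, m2 = (k : ℚ) ^ 2 * z) → k ≤ m2' 


section LocalLattices

variable {p : ℕ} [Fact p.Prime]

theorem padic_norm_add_le {x y : ℚ_[p]} {r : ℝ} (hx : ‖x‖ ≤ r) (hy : ‖y‖ ≤ r) : ‖x + y‖ ≤ r :=
  (Padic.nonarchimedean x y).trans (max_le hx hy)

theorem padic_norm_sub_le {x y : ℚ_[p]} {r : ℝ} (hx : ‖x‖ ≤ r) (hy : ‖y‖ ≤ r) : ‖x - y‖ ≤ r := by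
  rw [sub_eq_add_neg]
  exact padic_norm_add_le hx (by rwa [norm_neg])

theorem norm_mul_le_one {x y : ℚ_[p]} (hx : ‖x‖ ≤ 1) (hy : ‖y‖ ≤ 1) : ‖x * y‖ ≤ 1 := by
  rw [norm_mul]
  exact mul_le_one₀ hx (norm_nonneg _) hy

theorem norm_sum_le_one {ι : Type*} {s : Finset ι} {f : ι → ℚ_[p]} (h : ∀ i ∈ s, ‖f i‖ ≤ 1) :
    ‖∑ i ∈ s, f i‖ ≤ 1 :=
  IsUltrametricDist.norm_sum_le_of_forall_le_of_nonneg zero_le_one h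

theorem norm_p_zpow_mul_le {m n : ℤ} {x : ℚ_[p]} (h : ‖x‖ ≤ (p : ℝ) ^ (n + m)) :
    ‖(p : ℚ_[p]) ^ m * x‖ ≤ (p : ℝ) ^ n := by
  have hp : (0 : ℝ) < p := by exact_mod_cast (Fact.out : p.Prime).pos
  rw [norm_mul, Padic.norm_p_zpow]
  calc (p : ℝ) ^ (-m) * ‖x‖ ≤ (p : ℝ) ^ (-m) * (p : ℝ) ^ (n + m) := by gcongr
    _ = (p : ℝ) ^ n := by rw [← zpow_add₀ hp.ne']; congr 1; ring

theorem norm_sub_le_of_toZModPow_eq {k : ℕ} {a b : ℤ_[p]}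
    (h : PadicInt.toZModPow k a = PadicInt.toZModPow k b) :
    ‖(a : ℚ_[p]) - b‖ ≤ (p : ℝ) ^ (-(k : ℤ)) := by
  rw [← sub_eq_zero, ← map_sub, ← RingHom.mem_ker, PadicInt.ker_toZModPow,
    ← PadicInt.norm_le_pow_iff_mem_span_pow, PadicInt.norm_def, PadicInt.coe_sub] at h
  exact h

/-- The elements of norm at most `p ^ m` fall into `p ^ (m - n)` classes modulo the elements of
norm at most `p ^ n`. -/
theorem exists_coloring {m n : ℤ} (h : n ≤ m) :
    ∃ c : ℚ_[p] → Fin (p ^ (m - n).toNat), ∀ x y, ‖x‖ ≤ (p : ℝ) ^ m → ‖y‖ ≤ (p : ℝ) ^ m →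
      c x = c y → ‖x - y‖ ≤ (p : ℝ) ^ n := by
  classical
  have hp0 : p ≠ 0 := (Fact.out : p.Prime).ne_zero
  have hpK : (p : ℚ_[p]) ≠ 0 := by exact_mod_cast hp0
  set k := (m - n).toNat with hk
  have : NeZero (p ^ k) := ⟨pow_ne_zero _ hp0⟩
  have hs : ∀ x : ℚ_[p], ‖x‖ ≤ (p : ℝ) ^ m → ‖(p : ℚ_[p]) ^ m * x‖ ≤ 1 := fun x hx => by
    simpa using norm_p_zpow_mul_le (m := m) (n := 0) (x := x) (by simpa using hx)
  let c₀ : ℚ_[p] → ZMod (p ^ k) := fun x =>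
    if hx : ‖(p : ℚ_[p]) ^ m * x‖ ≤ 1 then PadicInt.toZModPow k (⟨_, hx⟩ : ℤ_[p]) else 0
  refine ⟨fun x => (ZMod.finEquiv (p ^ k)).symm (c₀ x), fun x y hx hy hc => ?_⟩
  have hc' : c₀ x = c₀ y := (ZMod.finEquiv (p ^ k)).symm.injective hc
  simp only [c₀, dif_pos (hs x hx), dif_pos (hs y hy)] at hc'
  have h1 : ‖(p : ℚ_[p]) ^ m * (x - y)‖ ≤ (p : ℝ) ^ (-(k : ℤ)) := by
    rw [mul_sub]
    exact norm_sub_le_of_toZModPow_eq hc'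
  have h2 := norm_p_zpow_mul_le (m := -m) (n := n) (x := (p : ℚ_[p]) ^ m * (x - y))
    (h1.trans_eq (by congr 1; omega))
  rwa [← mul_assoc, ← zpow_add₀ hpK, neg_add_cancel, zpow_zero, one_mul] at h2

/-- The lattice of the vectors that `Y` maps to integral vectors. -/
def latticeOf (Y : Matrix (Fin 4) (Fin 4) ℚ_[p]) : Set (Fin 4 → ℚ_[p]) :=
  {v | ∀ i, ‖(Y *ᵥ v) i‖ ≤ 1}

variable {Y Y' : Matrix (Fin 4) (Fin 4) ℚ_[p]} {v w : Fin 4 → ℚ_[p]}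

theorem latticeOf_add (hv : v ∈ latticeOf Y) (hw : w ∈ latticeOf Y) : v + w ∈ latticeOf Y :=
  fun i => by
    rw [mulVec_add]
    exact padic_norm_add_le (hv i) (hw i)

theorem latticeOf_smul {r : ℚ_[p]} (hr : ‖r‖ ≤ 1) (hv : v ∈ latticeOf Y) :
    r • v ∈ latticeOf Y := fun i => by
  rw [mulVec_smul]
  exact norm_mul_le_one hr (hv i)

theorem latticeOf_sub (hv : v ∈ latticeOf Y) (hw : w ∈ latticeOf Y) : v - w ∈ latticeOf Y :=
  fun i => by
    rw [mulVec_sub]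
    exact padic_norm_sub_le (hv i) (hw i)

theorem zero_mem_latticeOf : (0 : Fin 4 → ℚ_[p]) ∈ latticeOf Y := fun i => by simp

/-- `f` generates the image under the `k`-th coordinate of the vectors of `L` that vanish beyond
the `k`-th coordinate. -/
structure IsPivot (L : Set (Fin 4 → ℚ_[p])) (k : Fin 4) (n : ℤ) (f : Fin 4 → ℚ_[p]) : Prop where
  mem : f ∈ L
  above : ∀ j, k < j → f j = 0
  pivot : f k = (p : ℚ_[p]) ^ (-n)
  le_norm : ∀ v ∈ L, (∀ j, k < j → v j = 0) → ‖v k‖ ≤ (p : ℝ) ^ n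

theorem exists_norm_le_zpow (x : ℝ) : ∃ k : ℤ, x ≤ (p : ℝ) ^ k := by
  obtain ⟨k, hk⟩ := pow_unbounded_of_one_lt x
    (show (1 : ℝ) < p by exact_mod_cast (Fact.out : p.Prime).one_lt)
  exact ⟨k, by rw [zpow_natCast]; exact hk.le⟩

theorem exists_norm_apply_le (hY : Y.det ≠ 0) :
    ∃ B : ℤ, ∀ v ∈ latticeOf Y, ∀ k, ‖v k‖ ≤ (p : ℝ) ^ B := by
  obtain ⟨B, hB⟩ := exists_norm_le_zpow (p := p) (∑ i, ∑ j, ‖Y⁻¹ i j‖)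
  refine ⟨B, fun v hv k => ?_⟩
  have h : v = Y⁻¹ *ᵥ (Y *ᵥ v) := by
    rw [mulVec_mulVec, nonsing_inv_mul _ (isUnit_iff_ne_zero.2 hY), one_mulVec]
  rw [h]
  refine le_trans ?_ hB
  calc ‖(Y⁻¹ *ᵥ (Y *ᵥ v)) k‖ ≤ ∑ j, ‖Y⁻¹ k j * (Y *ᵥ v) j‖ :=
        norm_sum_le Finset.univ fun j => Y⁻¹ k j * (Y *ᵥ v) j
    _ ≤ ∑ j, ‖Y⁻¹ k j‖ := Finset.sum_le_sum fun j _ => by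
        rw [norm_mul]
        exact mul_le_of_le_one_right (norm_nonneg _) (hv j)
    _ ≤ _ := Finset.single_le_sum (f := fun i => ∑ j, ‖Y⁻¹ i j‖)
        (fun i _ => Finset.sum_nonneg fun j _ => norm_nonneg _) (Finset.mem_univ k)

theorem exists_single_mem_latticeOf (Y : Matrix (Fin 4) (Fin 4) ℚ_[p]) (k : Fin 4) :
    ∃ r : ℚ_[p], r ≠ 0 ∧ Pi.single k r ∈ latticeOf Y := by
  have hp0 : p ≠ 0 := (Fact.out : p.Prime).ne_zero
  obtain ⟨B, hB⟩ := exists_norm_le_zpow (p := p) (∑ i, ‖Y i k‖)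
  refine ⟨(p : ℚ_[p]) ^ B, zpow_ne_zero _ (by exact_mod_cast hp0), fun i => ?_⟩
  have h1 : ‖Y i k‖ ≤ (p : ℝ) ^ B := (Finset.single_le_sum (f := fun i => ‖Y i k‖)
    (fun i _ => norm_nonneg _) (Finset.mem_univ i)).trans hB
  have h2 := norm_p_zpow_mul_le (p := p) (m := B) (n := 0) (x := Y i k) (by simpa using h1)
  rw [mulVec_single]
  simpa [mul_comm] using h2

theorem exists_isPivot (hY : Y.det ≠ 0) (k : Fin 4) :
    ∃ n f, IsPivot (latticeOf Y) k n f := by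
  have hp1 : (1 : ℝ) < p := by exact_mod_cast (Fact.out : p.Prime).one_lt
  have hp0 : (p : ℝ) ≠ 0 := by positivity
  have hpK : (p : ℚ_[p]) ≠ 0 := by exact_mod_cast (Fact.out : p.Prime).ne_zero
  obtain ⟨B, hB⟩ := exists_norm_apply_le hY
  obtain ⟨r, hr0, hr⟩ := exists_single_mem_latticeOf Y k
  obtain ⟨n, ⟨v, hv, hv0, hvn⟩, hn⟩ := Int.exists_greatest_of_bdd
    (P := fun m => ∃ v ∈ latticeOf Y, (∀ j, k < j → v j = 0) ∧ ‖v k‖ = (p : ℝ) ^ m)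
    ⟨B, by
      rintro m ⟨v, hv, -, hm⟩
      exact (zpow_le_zpow_iff_right₀ hp1).1 (hm ▸ hB v hv k)⟩
    ⟨-r.valuation, Pi.single k r, hr, fun j hj => by simp [hj.ne'], by
      simpa using Padic.norm_eq_zpow_neg_valuation hr0⟩
  have hvk : v k ≠ 0 := by
    rw [← norm_pos_iff, hvn]
    positivity
  refine ⟨n, ((p : ℚ_[p]) ^ (-n) * (v k)⁻¹) • v, latticeOf_smul ?_ hv, fun j hj => ?_, ?_, ?_⟩
  · rw [norm_mul, norm_inv, hvn, Padic.norm_p_zpow, neg_neg, mul_inv_cancel₀]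
    positivity
  · simp [hv0 j hj]
  · simp [mul_assoc, inv_mul_cancel₀ hvk]
  · intro w hw hw0
    by_cases hwk : w k = 0
    · rw [hwk, norm_zero]
      positivity
    rw [Padic.norm_eq_zpow_neg_valuation hwk, zpow_le_zpow_iff_right₀ hp1]
    exact hn _ ⟨w, hw, hw0, Padic.norm_eq_zpow_neg_valuation hwk⟩

/-- `L` and `L'` contain the same vectors supported on the first `k` coordinates. -/
def AgreeBelow (k : ℕ) (L L' : Set (Fin 4 → ℚ_[p])) : Prop :=
  ∀ v : Fin 4 → ℚ_[p], (∀ j : Fin 4, k ≤ j → v j = 0) → (v ∈ L ↔ v ∈ L')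

theorem agreeBelow_zero : AgreeBelow 0 (latticeOf Y) (latticeOf Y') := fun v hv => by
  have : v = 0 := funext fun j => hv j (Nat.zero_le _)
  simp [this, zero_mem_latticeOf]

theorem mem_of_agreeBelow {k : Fin 4} {n : ℤ} {f f' : Fin 4 → ℚ_[p]}
    (h : AgreeBelow k (latticeOf Y) (latticeOf Y')) (hf : IsPivot (latticeOf Y) k n f)
    (hf' : IsPivot (latticeOf Y') k n f') (hff : f - f' ∈ latticeOf Y)
    (hv0 : ∀ j, k < j → v j = 0) (hv : v ∈ latticeOf Y) : v ∈ latticeOf Y' := by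
  have hpK : (p : ℚ_[p]) ≠ 0 := by exact_mod_cast (Fact.out : p.Prime).ne_zero
  have hvk : ‖(p : ℚ_[p]) ^ n * v k‖ ≤ 1 := by
    have h := norm_p_zpow_mul_le (m := n) (n := 0) ((hf.le_norm v hv hv0).trans_eq
      (by rw [zero_add]))
    rwa [zpow_zero] at h
  set r := (p : ℚ_[p]) ^ n * v k with hr
  have hvan : ∀ {g : Fin 4 → ℚ_[p]}, (∀ j, k < j → g j = 0) → g k = 0 →
      ∀ j : Fin 4, (k : ℕ) ≤ j → g j = 0 := fun hg hgk j hj => by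
    rcases (show k ≤ j from hj).eq_or_lt with rfl | hlt
    exacts [hgk, hg j hlt]
  have h1 : f - f' ∈ latticeOf Y' := (h _ (hvan (fun j hj => by simp [hf.above j hj,
    hf'.above j hj]) (by simp [hf.pivot, hf'.pivot]))).1 hff
  have h2 : v - r • f ∈ latticeOf Y' := (h _ (hvan (fun j hj => by simp [hf.above j hj,
    hv0 j hj]) (by
      simp [hf.pivot, hr, mul_right_comm _ (v k), mul_inv_cancel₀ (zpow_ne_zero n hpK)]))).1
      (latticeOf_sub hv (latticeOf_smul hvk hf.mem))
  have h3 : v = (v - r • f) + (r • (f - f') + r • f') := by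
    rw [smul_sub]
    abel
  rw [h3]
  exact latticeOf_add h2 (latticeOf_add (latticeOf_smul hvk h1) (latticeOf_smul hvk hf'.mem))

theorem AgreeBelow.symm {k : ℕ} {L L' : Set (Fin 4 → ℚ_[p])} (h : AgreeBelow k L L') :
    AgreeBelow k L' L := fun v hv => (h v hv).symm

theorem AgreeBelow.succ {k : Fin 4} {n : ℤ} {f f' : Fin 4 → ℚ_[p]}
    (h : AgreeBelow k (latticeOf Y) (latticeOf Y')) (hf : IsPivot (latticeOf Y) k n f)
    (hf' : IsPivot (latticeOf Y') k n f') (hff : f - f' ∈ latticeOf Y) :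
    AgreeBelow (k + 1) (latticeOf Y) (latticeOf Y') := by
  intro v hv
  have hv0 : ∀ j, k < j → v j = 0 := fun j hj => hv j hj
  refine ⟨mem_of_agreeBelow h hf hf' hff hv0, mem_of_agreeBelow h.symm hf' hf ?_ hv0⟩
  have h1 : f' - f ∈ latticeOf Y := by
    simpa using latticeOf_sub zero_mem_latticeOf hff
  refine (h _ fun j hj => ?_).1 h1
  rcases (show k ≤ j from hj).eq_or_lt with rfl | hlt
  · simp [hf.pivot, hf'.pivot]
  · simp [hf.above j hlt, hf'.above j hlt]

end LocalLattices

section LocalCount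

variable {p : ℕ} [Fact p.Prime]

/-- The bilinear form with Gram matrix `diagonal τ`. -/
def diagForm (τ v w : Fin 4 → ℚ_[p]) : ℚ_[p] := ∑ k, τ k * v k * w k

/-- `Y` represents the diagonal form `diagonal τ` by the integral matrix `A`. -/
structure IsDiagRep (A : Matrix (Fin 4) (Fin 4) ℚ_[p]) (τ : Fin 4 → ℚ_[p])
    (Y : Matrix (Fin 4) (Fin 4) ℚ_[p]) : Prop where
  norm_le : ∀ i j, ‖A i j‖ ≤ 1
  ne_zero : ∀ k, τ k ≠ 0
  gram : Yᵀ * A * Y = diagonal τ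

variable {A Y Y' : Matrix (Fin 4) (Fin 4) ℚ_[p]} {τ v w : Fin 4 → ℚ_[p]}

theorem norm_det_le_one (hA : ∀ i j, ‖A i j‖ ≤ 1) : ‖A.det‖ ≤ 1 := by
  rw [det_apply]
  refine norm_sum_le_one fun σ _ => ?_
  rw [Units.smul_def, zsmul_eq_mul]
  refine norm_mul_le_one (Padic.norm_int_le_one _) ?_
  rw [norm_prod]
  exact Finset.prod_le_one (fun i _ => norm_nonneg _) fun i _ => hA _ _

theorem norm_adjugate_le_one (hA : ∀ i j, ‖A i j‖ ≤ 1) (i j : Fin 4) : ‖A.adjugate i j‖ ≤ 1 := by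
  rw [adjugate_apply]
  refine norm_det_le_one fun a b => ?_
  rw [updateRow_apply]
  split_ifs
  · rw [Pi.single_apply]
    split_ifs <;> simp
  · exact hA a b

theorem norm_mulVec_le_one (hA : ∀ i j, ‖A i j‖ ≤ 1) (hv : ∀ i, ‖v i‖ ≤ 1) (i : Fin 4) :
    ‖(A *ᵥ v) i‖ ≤ 1 := by
  rw [mulVec, dotProduct]
  exact norm_sum_le_one fun j _ => norm_mul_le_one (hA i j) (hv j)

namespace IsDiagRep

theorem diagForm_eq (h : IsDiagRep A τ Y) (v w : Fin 4 → ℚ_[p]) :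
    diagForm τ v w = (Y *ᵥ v) ⬝ᵥ (A *ᵥ (Y *ᵥ w)) := by
  have : (Y *ᵥ v) ⬝ᵥ (A *ᵥ (Y *ᵥ w)) = v ⬝ᵥ (diagonal τ *ᵥ w) := by
    rw [← h.gram, ← mulVec_mulVec, ← mulVec_mulVec, dotProduct_mulVec v, vecMul_transpose]
  rw [this]
  simp only [diagForm, dotProduct, mulVec_diagonal]
  exact Finset.sum_congr rfl fun k _ => by ring

theorem norm_diagForm_le (h : IsDiagRep A τ Y) (hv : v ∈ latticeOf Y) (hw : w ∈ latticeOf Y) :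
    ‖diagForm τ v w‖ ≤ 1 := by
  rw [h.diagForm_eq]
  exact norm_sum_le_one fun i _ => norm_mul_le_one (hv i) (norm_mulVec_le_one h.norm_le hw i)

theorem det_ne_zero (h : IsDiagRep A τ Y) : Y.det ≠ 0 := fun h0 => by
  have h1 := congrArg det h.gram
  rw [det_mul, det_mul, h0, mul_zero, det_diagonal] at h1
  exact Finset.prod_ne_zero_iff.2 (fun k _ => h.ne_zero k) h1.symm

theorem det_smul_mem (h : IsDiagRep A τ Y) (hw : ∀ v ∈ latticeOf Y, ‖diagForm τ v w‖ ≤ 1) :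
    A.det • w ∈ latticeOf Y := by
  have hY := isUnit_iff_ne_zero.2 h.det_ne_zero
  have h1 : ∀ i, ‖(A *ᵥ (Y *ᵥ w)) i‖ ≤ 1 := fun i => by
    have h2 : Y *ᵥ (Y⁻¹ *ᵥ Pi.single i 1) = Pi.single i 1 := by
      rw [mulVec_mulVec, mul_nonsing_inv _ hY, one_mulVec]
    have h3 := hw (Y⁻¹ *ᵥ Pi.single i 1) fun j => by
      rw [h2, Pi.single_apply]
      split_ifs <;> simp
    rwa [h.diagForm_eq, h2, single_one_dotProduct] at h3
  have h4 : Y *ᵥ (A.det • w) = A.adjugate *ᵥ (A *ᵥ (Y *ᵥ w)) := by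
    rw [mulVec_mulVec, adjugate_mul, smul_mulVec, one_mulVec, mulVec_smul]
  intro i
  rw [h4]
  exact norm_mulVec_le_one (norm_adjugate_le_one h.norm_le) h1 i

end IsDiagRep

theorem IsPivot.decompose {d : ℤ} {f : Fin 4 → ℚ_[p]} (hf : IsPivot (latticeOf Y) 3 d f)
    (hv : v ∈ latticeOf Y) : ∃ (ρ : ℚ_[p]) (m : Fin 4 → ℚ_[p]), ‖ρ‖ ≤ 1 ∧ m ∈ latticeOf Y ∧
      m 3 = 0 ∧ v = ρ • f + m := by
  have hpK : (p : ℚ_[p]) ≠ 0 := by exact_mod_cast (Fact.out : p.Prime).ne_zero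
  have hρ : ‖(p : ℚ_[p]) ^ d * v 3‖ ≤ 1 := by
    have h := norm_p_zpow_mul_le (m := d) (n := 0) ((hf.le_norm v hv
      fun j hj => absurd hj (by omega)).trans_eq (by rw [zero_add]))
    rwa [zpow_zero] at h
  refine ⟨_, v - ((p : ℚ_[p]) ^ d * v 3) • f, hρ, latticeOf_sub hv (latticeOf_smul hρ hf.mem),
    ?_, by simp⟩
  simp [hf.pivot, mul_right_comm _ (v 3), mul_inv_cancel₀ (zpow_ne_zero d hpK)]

/-- Up to sign and bounded index, the lattice is determined by its intersection with the
hyperplane orthogonal to the last basis vector. -/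
theorem exists_sign_smul_mem (h : IsDiagRep A τ Y) (h' : IsDiagRep A τ Y')
    (hagree : AgreeBelow 3 (latticeOf Y) (latticeOf Y')) {d : ℤ} {f f' : Fin 4 → ℚ_[p]}
    (hf : IsPivot (latticeOf Y) 3 d f) (hf' : IsPivot (latticeOf Y') 3 d f') :
    ∃ σ : ℤˣ, (2 * A.det ^ 3) • ((f' - Pi.single 3 ((p : ℚ_[p]) ^ (-d))) -
      ((σ : ℤ) : ℚ_[p]) • (f - Pi.single 3 ((p : ℚ_[p]) ^ (-d)))) ∈ latticeOf Y := by
  have hpK : (p : ℚ_[p]) ≠ 0 := by exact_mod_cast (Fact.out : p.Prime).ne_zero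
  set D := A.det with hD
  set q : ℚ_[p] := (p : ℚ_[p]) ^ (-d) with hq
  have hq0 : q ≠ 0 := zpow_ne_zero _ hpK
  have hD1 : ‖D‖ ≤ 1 := norm_det_le_one h.norm_le
  have h21 : ‖(2 : ℚ_[p])‖ ≤ 1 := by exact_mod_cast Padic.norm_int_le_one (p := p) 2
  set z : Fin 4 → ℚ_[p] := f - Pi.single 3 q with hz
  set z' : Fin 4 → ℚ_[p] := f' - Pi.single 3 q with hz'
  have hz3 : z 3 = 0 := by simp [hz, hf.pivot, hq]
  have hz3' : z' 3 = 0 := by simp [hz', hf'.pivot, hq]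
  have ez : ∀ j, j ≠ 3 → z j = f j := fun j hj => by simp [hz, hj]
  have ez' : ∀ j, j ≠ 3 → z' j = f' j := fun j hj => by simp [hz', hj]
  have hfz : f = z + Pi.single 3 q := by simp [hz]
  have hfz' : f' = z' + Pi.single 3 q := by simp [hz']
  have hmem' : ∀ m ∈ latticeOf Y, m 3 = 0 → m ∈ latticeOf Y' := fun m hm hm3 =>
    (hagree m fun j hj => by
      have : j = 3 := by omega
      rw [this, hm3]).1 hm
  have orth : ∀ m : Fin 4 → ℚ_[p], m 3 = 0 → diagForm τ m f = diagForm τ m z := fun m hm => by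
    simp [diagForm, Fin.sum_univ_four, hm, ez]
  set lam : ℚ_[p] := -(diagForm τ z z' / (τ 3 * q)) with hlam
  set l : Fin 4 → ℚ_[p] := z' + Pi.single 3 lam with hl
  have hlf : diagForm τ f l = 0 := by
    have h3 := h.ne_zero 3
    have : diagForm τ f l = diagForm τ z z' + τ 3 * q * lam := by
      rw [hfz, hl]
      simp [diagForm, Fin.sum_univ_four, hz3, hz3']
    rw [this, hlam]
    field_simp
    ring
  have hDl : D • l ∈ latticeOf Y := h.det_smul_mem fun v hv => by
    obtain ⟨ρ, m, hρ, hm, hm3, rfl⟩ := hf.decompose hv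
    have e1 : diagForm τ (ρ • f + m) l = ρ * diagForm τ f l + diagForm τ m f' := by
      rw [hl, hfz']
      simp [diagForm, Fin.sum_univ_four, hm3]
      ring
    rw [e1, hlf, mul_zero, zero_add]
    exact h'.norm_diagForm_le (hmem' m hm hm3) hf'.mem
  obtain ⟨ρ, m, hρ, hm, hm3, hDlm⟩ := hf.decompose hDl
  have hDz' : D • z' = ρ • z + m := by
    ext j
    by_cases hj : j = 3
    · simp [hj, hz3, hz3', hm3]
    · have := congrFun hDlm j
      simpa [hl, hj, ez j hj] using this
  have hzz : diagForm τ z z - diagForm τ z' z' = diagForm τ f f - diagForm τ f' f' := by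
    rw [hfz, hfz']
    simp [diagForm, Fin.sum_univ_four, hz3, hz3']
  have hkey : (D - ρ) * (D + ρ) * diagForm τ z z =
      D ^ 2 * (diagForm τ f f - diagForm τ f' f') +
        (2 * ρ * diagForm τ m f + diagForm τ m m) := by
    have e2 : D ^ 2 * diagForm τ z' z' = diagForm τ (D • z') (D • z') := by
      simp [diagForm, Fin.sum_univ_four]
      ring
    have e3 : diagForm τ (ρ • z + m) (ρ • z + m) =
        ρ ^ 2 * diagForm τ z z + 2 * ρ * diagForm τ m z + diagForm τ m m := by
      simp [diagForm, Fin.sum_univ_four]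
      ring
    rw [← hzz, orth m hm3]
    rw [hDz', e3] at e2
    linear_combination e2
  have hkey1 : ‖(D - ρ) * (D + ρ) * diagForm τ z z‖ ≤ 1 := by
    rw [hkey]
    refine padic_norm_add_le (norm_mul_le_one ?_ ?_) (padic_norm_add_le (norm_mul_le_one
      (norm_mul_le_one h21 hρ) (h.norm_diagForm_le hm hf.mem)) (h.norm_diagForm_le hm hm))
    · rw [norm_pow]
      exact pow_le_one₀ (norm_nonneg _) hD1
    · exact padic_norm_sub_le (h.norm_diagForm_le hf.mem hf.mem)
        (h'.norm_diagForm_le hf'.mem hf'.mem)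
  obtain ⟨σ, hσ⟩ : ∃ σ : ℤˣ, ‖2 * D * (ρ - ((σ : ℤ) : ℚ_[p]) * D) * diagForm τ z z‖ ≤ 1 := by
    have hmax : ‖2 * D‖ ≤ max ‖D - ρ‖ ‖D + ρ‖ := by
      have := Padic.nonarchimedean (D - ρ) (D + ρ)
      rwa [show D - ρ + (D + ρ) = 2 * D by ring] at this
    rcases le_max_iff.1 hmax with h1 | h1
    · refine ⟨-1, le_trans ?_ hkey1⟩
      rw [mul_assoc, mul_assoc (D - ρ), norm_mul, norm_mul (D - ρ)]
      have : ρ - (((-1 : ℤˣ) : ℤ) : ℚ_[p]) * D = D + ρ := by push_cast; ring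
      rw [this]
      gcongr
    · refine ⟨1, le_trans ?_ hkey1⟩
      rw [mul_comm (D - ρ), mul_assoc, mul_assoc (D + ρ), norm_mul, norm_mul (D + ρ)]
      have : ρ - (((1 : ℤˣ) : ℤ) : ℚ_[p]) * D = -(D - ρ) := by push_cast; ring
      rw [this, neg_mul, norm_neg]
      gcongr
  set r := ρ - ((σ : ℤ) : ℚ_[p]) * D with hr
  have hr1 : ‖r‖ ≤ 1 :=
    padic_norm_sub_le hρ (norm_mul_le_one (Padic.norm_int_le_one _) hD1)
  have hDw : D • ((2 * D * r) • z) ∈ latticeOf Y := h.det_smul_mem fun v hv => by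
    obtain ⟨μ, u, hμ, hu, hu3, rfl⟩ := hf.decompose hv
    have e1 : diagForm τ (μ • f + u) ((2 * D * r) • z) =
        μ * (2 * D * r * diagForm τ z z) + 2 * D * r * diagForm τ u f := by
      rw [hfz]
      simp [diagForm, Fin.sum_univ_four, hu3, hz3]
      ring
    rw [e1]
    exact padic_norm_add_le (norm_mul_le_one hμ hσ) (norm_mul_le_one (norm_mul_le_one
      (norm_mul_le_one h21 hD1) hr1) (h.norm_diagForm_le hu hf.mem))
  refine ⟨σ, ?_⟩
  have hfin : (2 * D ^ 3) • (z' - ((σ : ℤ) : ℚ_[p]) • z) =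
      (2 * D ^ 2) • m + D • ((2 * D * r) • z) := by
    ext j
    have := congrFun hDz' j
    simp only [Pi.smul_apply, Pi.add_apply, Pi.sub_apply, smul_eq_mul] at this ⊢
    rw [hr]
    linear_combination 2 * D ^ 2 * this
  rw [hfin]
  refine latticeOf_add (latticeOf_smul (norm_mul_le_one h21 ?_) hm) hDw
  rw [norm_pow]
  exact pow_le_one₀ (norm_nonneg _) hD1

end LocalCount

theorem card_le_of_coloring {ι γ : Type*} [Fintype γ] [DecidableEq γ] (s : Finset ι) (c : ι → γ)
    {B : ℕ} (h : ∀ a, (s.filter (c · = a)).card ≤ B) : s.card ≤ Fintype.card γ * B := by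
  rw [mul_comm]
  exact Finset.card_le_mul_card_image_of_maps_to (t := Finset.univ)
    (fun i _ => Finset.mem_univ (c i)) B fun a _ => h a

section LocalCount

variable {p : ℕ} [Fact p.Prime] {ι : Type*} {A : Matrix (Fin 4) (Fin 4) ℚ_[p]}
  {τ : Fin 4 → ℚ_[p]} {Y : ι → Matrix (Fin 4) (Fin 4) ℚ_[p]} {f : ι → Fin 4 → Fin 4 → ℚ_[p]}
  {n : Fin 4 → ℤ} {s : Finset ι}

theorem AgreeBelow.trans {k : ℕ} {L L' L'' : Set (Fin 4 → ℚ_[p])} (h : AgreeBelow k L L')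
    (h' : AgreeBelow k L' L'') : AgreeBelow k L L'' := fun v hv => (h v hv).trans (h' v hv)

theorem AgreeBelow.mem_of_sub {k : Fin 4} {m : ℤ} {L L' L₀ : Set (Fin 4 → ℚ_[p])}
    {g g' : Fin 4 → ℚ_[p]} (h : AgreeBelow k L₀ L) (hg : IsPivot L k m g)
    (hg' : IsPivot L' k m g') (hmem : g - g' ∈ L₀) : g - g' ∈ L := by
  refine (h _ fun j hj => ?_).1 hmem
  rcases (show k ≤ j from hj).eq_or_lt with rfl | hlt
  · simp [hg.pivot, hg'.pivot]
  · simp [hg.above j hlt, hg'.above j hlt]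

theorem card_le_of_agreeBelow_three (hrep : ∀ i, IsDiagRep A τ (Y i))
    (hinj : ∀ i j, latticeOf (Y i) = latticeOf (Y j) → i = j)
    (hf : ∀ i ∈ s, ∀ k, IsPivot (latticeOf (Y i)) k (n k) (f i k))
    (hagree : ∀ i ∈ s, ∀ j ∈ s, AgreeBelow 3 (latticeOf (Y i)) (latticeOf (Y j)))
    {e : ℕ} (he : ‖2 * A.det ^ 3‖ = (p : ℝ) ^ (-(e : ℤ))) : s.card ≤ 2 * p ^ (4 * e) := by
  classical
  rcases s.eq_empty_or_nonempty with rfl | ⟨o, ho⟩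
  · simp
  have hp0 : (0 : ℝ) < p := by exact_mod_cast (Fact.out : p.Prime).pos
  have hex : ∀ i, ∃ σ : ℤˣ, i ∈ s →
      (2 * A.det ^ 3) • ((f i 3 - Pi.single 3 ((p : ℚ_[p]) ^ (-n 3))) -
      ((σ : ℤ) : ℚ_[p]) • (f o 3 - Pi.single 3 ((p : ℚ_[p]) ^ (-n 3)))) ∈ latticeOf (Y o) := by
    intro i
    by_cases hi : i ∈ s
    · obtain ⟨σ, hσ⟩ := exists_sign_smul_mem (hrep o) (hrep i) (hagree o ho i hi) (hf o ho 3)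
        (hf i hi 3)
      exact ⟨σ, fun _ => hσ⟩
    · exact ⟨1, fun h => absurd h hi⟩
  choose σ hσ using hex
  set E := 2 * A.det ^ 3 with hE
  obtain ⟨c, hc⟩ := exists_coloring (p := p) (m := 0) (n := -(e : ℤ)) (by omega)
  set w : ι → Fin 4 → ℚ_[p] := fun i => E • ((f i 3 - Pi.single 3 ((p : ℚ_[p]) ^ (-n 3))) -
      ((σ i : ℤ) : ℚ_[p]) • (f o 3 - Pi.single 3 ((p : ℚ_[p]) ^ (-n 3)))) with hw
  have hcard := Finset.card_le_card_of_injOn (s := s)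
    (t := (Finset.univ : Finset (ℤˣ × (Fin 4 → Fin (p ^ (0 - -(e : ℤ)).toNat)))))
    (fun i => (σ i, fun k => c ((Y o *ᵥ w i) k))) (fun i _ => Finset.mem_univ _)
    (fun i hi j hj hij => by
      rw [Prod.mk.injEq] at hij
      have hsub : f i 3 - f j 3 ∈ latticeOf (Y o) := fun k => by
        have h1 := hc _ _ (by rw [zpow_zero]; exact hσ i hi k)
          (by rw [zpow_zero]; exact hσ j hj k) (congrFun hij.2 k)
        have h2 : (Y o *ᵥ w i) k - (Y o *ᵥ w j) k = E * (Y o *ᵥ (f i 3 - f j 3)) k := by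
          rw [← Pi.sub_apply, ← mulVec_sub, ← smul_eq_mul, ← Pi.smul_apply, ← mulVec_smul]
          congr 2
          simp only [hw, hij.1, ← smul_sub]
          congr 1
          abel
        rw [h2, norm_mul, he] at h1
        exact le_of_mul_le_mul_left (h1.trans_eq (mul_one _).symm) (by positivity)
      refine hinj i j (Set.ext fun v => ?_)
      exact ((hagree i hi j hj).succ (k := 3) (hf i hi 3) (hf j hj 3)
        ((hagree o ho i hi).mem_of_sub (k := 3) (hf i hi 3) (hf j hj 3) hsub)) v
        fun j hj => absurd hj (by simp))
  refine hcard.trans_eq ?_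
  simp [← pow_mul, mul_comm]

theorem IsPivot.single_mem {L₀ : Matrix (Fin 4) (Fin 4) ℚ_[p]} {b : ℤ} {g : Fin 4 → ℚ_[p]}
    (hg : IsPivot (latticeOf L₀) 0 b g) {x : ℚ_[p]} (hx : ‖x‖ ≤ (p : ℝ) ^ b) :
    Pi.single 0 x ∈ latticeOf L₀ := by
  have hpK : (p : ℚ_[p]) ≠ 0 := by exact_mod_cast (Fact.out : p.Prime).ne_zero
  have h1 : ‖(p : ℚ_[p]) ^ b * x‖ ≤ 1 := by
    have h := norm_p_zpow_mul_le (m := b) (n := 0) (hx.trans_eq (by rw [zero_add]))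
    rwa [zpow_zero] at h
  have h2 : Pi.single 0 x = ((p : ℚ_[p]) ^ b * x) • g := by
    ext j
    rcases (Fin.zero_le j).eq_or_lt with rfl | hlt
    · simp [hg.pivot, mul_right_comm _ x, mul_inv_cancel₀ (zpow_ne_zero b hpK)]
    · simp [hg.above j hlt, hlt.ne']
  rw [h2]
  exact latticeOf_smul h1 hg.mem

theorem IsPivot.zero_le {L : Set (Fin 4 → ℚ_[p])} {k : Fin 4} {b : ℤ} {g : Fin 4 → ℚ_[p]}
    (hg : IsPivot L k b g) (h : Pi.single k 1 ∈ L) : 0 ≤ b := by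
  have hp1 : (1 : ℝ) < p := by exact_mod_cast (Fact.out : p.Prime).one_lt
  have h1 := hg.le_norm _ h fun j hj => by simp [hj.ne']
  rw [Pi.single_eq_same, norm_one] at h1
  by_contra! hb
  exact absurd h1 (not_le.2 (zpow_lt_one_of_neg₀ hp1 hb))

/-- A `p`-adic number is close to one of the two square roots. -/
theorem exists_sign_norm_sub_le {a x y : ℚ_[p]} (h : ‖a * (x ^ 2 - y ^ 2)‖ ≤ 1) {t : ℝ}
    (ht : ∀ u : ℚ_[p], ‖a * u ^ 2‖ ≤ 1 → ‖u‖ ≤ t) :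
    ∃ σ : ℤˣ, ‖x - ((σ : ℤ) : ℚ_[p]) * y‖ ≤ t := by
  have hfac : x ^ 2 - y ^ 2 = (x - y) * (x + y) := by ring
  rw [hfac, norm_mul, norm_mul] at h
  rcases le_total ‖x - y‖ ‖x + y‖ with hle | hle
  · refine ⟨1, ht _ (le_trans ?_ h)⟩
    simp only [Units.val_one, Int.cast_one, one_mul, norm_mul, sq]
    gcongr
  · refine ⟨-1, ht _ (le_trans ?_ h)⟩
    simp only [Units.val_neg, Units.val_one, Int.cast_neg, Int.cast_one, neg_mul, one_mul,
      sub_neg_eq_add, norm_mul, sq]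
    gcongr

theorem card_le_of_agreeBelow_two_of_norm_sub_le (hrep : ∀ i, IsDiagRep A τ (Y i))
    (hinj : ∀ i j, latticeOf (Y i) = latticeOf (Y j) → i = j)
    (hf : ∀ i ∈ s, ∀ k, IsPivot (latticeOf (Y i)) k (n k) (f i k))
    (hagree : ∀ i ∈ s, ∀ j ∈ s, AgreeBelow 2 (latticeOf (Y i)) (latticeOf (Y j)))
    (hclose : ∀ i ∈ s, ∀ j ∈ s, ‖f i 2 1 - f j 2 1‖ ≤ (p : ℝ) ^ n 1)
    {h : ℤ} (hh : ∀ u : ℚ_[p], ‖τ 0 * u ^ 2‖ ≤ 1 → ‖u‖ ≤ (p : ℝ) ^ h) (hn : n 0 ≤ h)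
    {e : ℕ} (he : ‖2 * A.det ^ 3‖ = (p : ℝ) ^ (-(e : ℤ))) :
    s.card ≤ 2 * p ^ (h - n 0).toNat * (2 * p ^ (4 * e)) := by
  classical
  rcases s.eq_empty_or_nonempty with rfl | ⟨o, ho⟩
  · simp
  have hpK : (p : ℚ_[p]) ≠ 0 := by exact_mod_cast (Fact.out : p.Prime).ne_zero
  set r : ι → ℚ_[p] := fun i => (p : ℚ_[p]) ^ n 1 * (f i 2 1 - f o 2 1) with hr
  have hr1 : ∀ i ∈ s, ‖r i‖ ≤ 1 := fun i hi => by
    have h := norm_p_zpow_mul_le (m := n 1) (n := 0) ((hclose i hi o ho).trans_eq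
      (by rw [zero_add]))
    rwa [zpow_zero] at h
  set g : ι → Fin 4 → ℚ_[p] := fun i => f i 2 - r i • f o 1 with hg
  have hg1 : ∀ i ∈ s, g i 1 = f o 2 1 := fun i hi => by
    have h1 := mul_inv_cancel₀ (zpow_ne_zero (n 1) hpK)
    simp only [hg, hr, Pi.sub_apply, Pi.smul_apply, (hf o ho 1).pivot, smul_eq_mul, _root_.zpow_neg]
    linear_combination (f o 2 1 - f i 2 1) * h1
  have hg2 : ∀ i ∈ s, g i 2 = (p : ℚ_[p]) ^ (-n 2) := fun i hi => by
    simp [hg, (hf i hi 2).pivot, (hf o ho 1).above 2 (by decide)]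
  have hg3 : ∀ i ∈ s, g i 3 = 0 := fun i hi => by
    simp [hg, (hf i hi 2).above 3 (by decide), (hf o ho 1).above 3 (by decide)]
  have hf1 : ∀ i ∈ s, f o 1 ∈ latticeOf (Y i) := fun i hi =>
    (hagree o ho i hi _ fun j hj => (hf o ho 1).above j (by omega)).1 (hf o ho 1).mem
  have hgm : ∀ i ∈ s, g i ∈ latticeOf (Y i) := fun i hi =>
    latticeOf_sub (hf i hi 2).mem (latticeOf_smul (hr1 i hi) (hf1 i hi))
  have hex : ∀ i, ∃ σ : ℤˣ, i ∈ s → ‖g i 0 - ((σ : ℤ) : ℚ_[p]) * g o 0‖ ≤ (p : ℝ) ^ h := by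
    intro i
    by_cases hi : i ∈ s
    · obtain ⟨σ, hσ⟩ := exists_sign_norm_sub_le (a := τ 0) (x := g i 0) (y := g o 0) (by
        have h1 : τ 0 * (g i 0 ^ 2 - g o 0 ^ 2) =
            diagForm τ (g i) (g i) - diagForm τ (g o) (g o) := by
          simp only [diagForm, Fin.sum_univ_four, hg1 i hi, hg1 o ho, hg2 i hi, hg2 o ho, hg3 i hi,
            hg3 o ho]
          ring
        rw [h1]
        exact padic_norm_sub_le ((hrep i).norm_diagForm_le (hgm i hi) (hgm i hi))
          ((hrep o).norm_diagForm_le (hgm o ho) (hgm o ho))) hh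
      exact ⟨σ, fun _ => hσ⟩
    · exact ⟨1, fun h => absurd h hi⟩
  choose σ hσ using hex
  obtain ⟨c, hc⟩ := exists_coloring (p := p) hn
  refine (card_le_of_coloring s (fun i => (σ i, c (g i 0 - ((σ i : ℤ) : ℚ_[p]) * g o 0)))
    (B := 2 * p ^ (4 * e)) fun a => ?_).trans_eq (by simp)
  refine card_le_of_agreeBelow_three (f := f) (n := n) hrep hinj
    (fun i hi => hf i (Finset.mem_filter.1 hi).1) (fun i hi j hj => ?_) he
  obtain ⟨hi, hia⟩ := Finset.mem_filter.1 hi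
  obtain ⟨hj, hja⟩ := Finset.mem_filter.1 hj
  have hij := hia.trans hja.symm
  rw [Prod.mk.injEq] at hij
  have h1 := hc _ _ (hσ i hi) (hσ j hj) hij.2
  rw [hij.1, sub_sub_sub_cancel_right] at h1
  refine (hagree i hi j hj).succ (k := 2) (hf i hi 2) (hf j hj 2)
    ((hagree o ho i hi).mem_of_sub (k := 2) (hf i hi 2) (hf j hj 2) ?_)
  have h2 : f i 2 - f j 2 = Pi.single 0 (g i 0 - g j 0) + (r i - r j) • f o 1 := by
    have h3 : g i - g j = Pi.single 0 (g i 0 - g j 0) := by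
      ext k
      fin_cases k
      · simp
      · simp [hg1 i hi, hg1 j hj]
      · simp [hg2 i hi, hg2 j hj]
      · simp [hg3 i hi, hg3 j hj]
    rw [← h3]
    simp only [hg, sub_smul]
    abel
  rw [h2]
  exact latticeOf_add ((hf o ho 0).single_mem h1)
    (latticeOf_smul (padic_norm_sub_le (hr1 i hi) (hr1 j hj)) (hf o ho 1).mem)

theorem card_le_of_agreeBelow_two (hrep : ∀ i, IsDiagRep A τ (Y i))
    (hinj : ∀ i j, latticeOf (Y i) = latticeOf (Y j) → i = j)
    (hone : ∀ i, Pi.single 1 1 ∈ latticeOf (Y i))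
    (hf : ∀ i ∈ s, ∀ k, IsPivot (latticeOf (Y i)) k (n k) (f i k))
    (hagree : ∀ i ∈ s, ∀ j ∈ s, AgreeBelow 2 (latticeOf (Y i)) (latticeOf (Y j)))
    {h : ℤ} (hh : ∀ u : ℚ_[p], ‖τ 0 * u ^ 2‖ ≤ 1 → ‖u‖ ≤ (p : ℝ) ^ h) (hn : n 0 ≤ h)
    {κ : ℤ} (hκ : ‖τ 1‖ = (p : ℝ) ^ (-κ)) (hnκ : n 1 ≤ κ)
    {e : ℕ} (he : ‖2 * A.det ^ 3‖ = (p : ℝ) ^ (-(e : ℤ))) :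
    s.card ≤ p ^ (κ - n 1).toNat * (2 * p ^ (h - n 0).toNat * (2 * p ^ (4 * e))) := by
  classical
  have hp0 : (0 : ℝ) < p := by exact_mod_cast (Fact.out : p.Prime).pos
  have hbd : ∀ i ∈ s, ‖f i 2 1‖ ≤ (p : ℝ) ^ κ := fun i hi => by
    have h1 := (hrep i).norm_diagForm_le (hf i hi 2).mem (hone i)
    have h2 : diagForm τ (f i 2) (Pi.single 1 1) = τ 1 * f i 2 1 := by
      simp [diagForm, Fin.sum_univ_four]
    rw [h2, norm_mul, hκ, _root_.zpow_neg, inv_mul_le_iff₀ (by positivity), mul_one] at h1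
    exact h1
  obtain ⟨c, hc⟩ := exists_coloring (p := p) hnκ
  refine (card_le_of_coloring s (fun i => c (f i 2 1)) fun a => ?_).trans_eq
    (by rw [Fintype.card_fin])
  refine card_le_of_agreeBelow_two_of_norm_sub_le (f := f) (n := n) hrep hinj
    (fun i hi => hf i (Finset.mem_filter.1 hi).1)
    (fun i hi j hj => hagree i (Finset.mem_filter.1 hi).1 j (Finset.mem_filter.1 hj).1)
    (fun i hi j hj => ?_) hh hn he
  obtain ⟨hi, hia⟩ := Finset.mem_filter.1 hi
  obtain ⟨hj, hja⟩ := Finset.mem_filter.1 hj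
  exact hc _ _ (hbd i hi) (hbd j hj) (hia.trans hja.symm)

theorem card_le_of_isPivot (hrep : ∀ i, IsDiagRep A τ (Y i))
    (hinj : ∀ i j, latticeOf (Y i) = latticeOf (Y j) → i = j)
    (hzero : ∀ i, Pi.single 0 1 ∈ latticeOf (Y i)) (hone : ∀ i, Pi.single 1 1 ∈ latticeOf (Y i))
    (hf : ∀ i ∈ s, ∀ k, IsPivot (latticeOf (Y i)) k (n k) (f i k))
    {h : ℕ} (hh : ∀ u : ℚ_[p], ‖τ 0 * u ^ 2‖ ≤ 1 → ‖u‖ ≤ (p : ℝ) ^ (h : ℤ))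
    {κ : ℕ} (hκ : ‖τ 1‖ = (p : ℝ) ^ (-(κ : ℤ)))
    {e : ℕ} (he : ‖2 * A.det ^ 3‖ = (p : ℝ) ^ (-(e : ℤ))) :
    s.card ≤ 4 * p ^ (κ + h + 4 * e) := by
  classical
  rcases s.eq_empty_or_nonempty with rfl | ⟨o, ho⟩
  · simp
  have hp1 : (1 : ℝ) < p := by exact_mod_cast (Fact.out : p.Prime).one_lt
  have hp0 : (0 : ℝ) < p := by positivity
  have hpK : (p : ℚ_[p]) ≠ 0 := by exact_mod_cast (Fact.out : p.Prime).ne_zero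
  have hn0 := (hf o ho 0).zero_le (hzero o)
  have hn1 := (hf o ho 1).zero_le (hone o)
  have hn0h : n 0 ≤ h := by
    have h1 := hh (f o 0 0) (by
      have h2 : τ 0 * f o 0 0 ^ 2 = diagForm τ (f o 0) (f o 0) := by
        simp [diagForm, Fin.sum_univ_four, (hf o ho 0).above, sq, mul_assoc]
      rw [h2]
      exact (hrep o).norm_diagForm_le (hf o ho 0).mem (hf o ho 0).mem)
    rwa [(hf o ho 0).pivot, Padic.norm_p_zpow, neg_neg, zpow_le_zpow_iff_right₀ hp1] at h1
  have hn1κ : n 1 ≤ κ := by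
    have h1 := (hrep o).norm_diagForm_le (hf o ho 1).mem (hone o)
    have h2 : diagForm τ (f o 1) (Pi.single 1 1) = τ 1 * f o 1 1 := by
      simp [diagForm, Fin.sum_univ_four]
    rw [h2, norm_mul, hκ, _root_.zpow_neg, inv_mul_le_iff₀ (by positivity), mul_one,
      (hf o ho 1).pivot,
      Padic.norm_p_zpow, neg_neg, zpow_le_zpow_iff_right₀ hp1] at h1
    exact h1
  have hbd : ∀ i ∈ s, ‖f i 1 0‖ ≤ (p : ℝ) ^ (n 0 + n 1) := fun i hi => by
    have h1 := mul_inv_cancel₀ (zpow_ne_zero (n 1) hpK)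
    have h2 : Pi.single 0 ((p : ℚ_[p]) ^ n 1 * f i 1 0) =
        (p : ℚ_[p]) ^ n 1 • f i 1 - Pi.single 1 1 := by
      ext k
      rcases lt_or_ge 1 k with hk | hk
      · simp [(hf i hi 1).above k hk, hk.ne', (zero_lt_one.trans hk).ne']
      · obtain rfl | rfl : k = 0 ∨ k = 1 := by omega
        · simp
        · simp [(hf i hi 1).pivot, h1]
    have h3 : Pi.single 0 ((p : ℚ_[p]) ^ n 1 * f i 1 0) ∈ latticeOf (Y i) := by
      rw [h2]
      refine latticeOf_sub (latticeOf_smul ?_ (hf i hi 1).mem) (hone i)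
      rw [Padic.norm_p_zpow]
      exact zpow_le_one_of_nonpos₀ hp1.le (by omega)
    have h4 := (hf i hi 0).le_norm _ h3 fun j hj => by simp [hj.ne']
    rw [Pi.single_eq_same, norm_mul, Padic.norm_p_zpow, _root_.zpow_neg,
      inv_mul_le_iff₀ (by positivity), ← zpow_add₀ hp0.ne', add_comm] at h4
    exact h4
  have hagree : ∀ i ∈ s, ∀ j ∈ s, AgreeBelow 1 (latticeOf (Y i)) (latticeOf (Y j)) :=
    fun i hi j hj => agreeBelow_zero.succ (k := 0) (hf i hi 0) (hf j hj 0) (by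
      have : f i 0 - f j 0 = 0 := by
        ext k
        rcases (Fin.zero_le k).eq_or_lt with rfl | hlt
        · simp [(hf i hi 0).pivot, (hf j hj 0).pivot]
        · simp [(hf i hi 0).above k hlt, (hf j hj 0).above k hlt]
      rw [this]
      exact zero_mem_latticeOf)
  obtain ⟨c, hc⟩ := exists_coloring (p := p) (show n 0 ≤ n 0 + n 1 by omega)
  refine (card_le_of_coloring s (fun i => c (f i 1 0)) (B := p ^ (κ - n 1).toNat *
    (2 * p ^ (h - n 0).toNat * (2 * p ^ (4 * e)))) fun a => ?_).trans ?_
  · refine card_le_of_agreeBelow_two (f := f) (n := n) hrep hinj hone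
      (fun i hi => hf i (Finset.mem_filter.1 hi).1) (fun i hi j hj => ?_) hh hn0h hκ hn1κ he
    obtain ⟨hi, hia⟩ := Finset.mem_filter.1 hi
    obtain ⟨hj, hja⟩ := Finset.mem_filter.1 hj
    have h1 := hc _ _ (hbd i hi) (hbd j hj) (hia.trans hja.symm)
    refine (hagree i hi j hj).succ (k := 1) (hf i hi 1) (hf j hj 1) ?_
    have h2 : f i 1 - f j 1 = Pi.single 0 (f i 1 0 - f j 1 0) := by
      ext k
      rcases lt_or_ge 1 k with hk | hk
      · simp [(hf i hi 1).above k hk, (hf j hj 1).above k hk, (zero_lt_one.trans hk).ne']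
      · obtain rfl | rfl : k = 0 ∨ k = 1 := by omega
        · simp
        · simp [(hf i hi 1).pivot, (hf j hj 1).pivot]
    rw [h2]
    exact (hf i hi 0).single_mem h1
  · rw [Fintype.card_fin]
    calc p ^ (n 0 + n 1 - n 0).toNat * (p ^ (κ - n 1).toNat *
          (2 * p ^ (h - n 0).toNat * (2 * p ^ (4 * e))))
        = 4 * p ^ ((n 0 + n 1 - n 0).toNat + (κ - n 1).toNat + (h - n 0).toNat + 4 * e) := by
          rw [pow_add, pow_add, pow_add]
          ring
      _ ≤ _ := by
          refine Nat.mul_le_mul_left _ (Nat.pow_le_pow_right (Fact.out : p.Prime).pos ?_)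
          omega

/-- The number of lattices between `latticeOf P` and `p ^ (-H) • latticeOf P` on which the form
`diagonal τ` is represented by `A`. -/
theorem card_le_of_isDiagRep (hrep : ∀ i, IsDiagRep A τ (Y i))
    (hinj : ∀ i j, latticeOf (Y i) = latticeOf (Y j) → i = j)
    (hzero : ∀ i, Pi.single 0 1 ∈ latticeOf (Y i)) (hone : ∀ i, Pi.single 1 1 ∈ latticeOf (Y i))
    {h : ℕ} (hh : ∀ u : ℚ_[p], ‖τ 0 * u ^ 2‖ ≤ 1 → ‖u‖ ≤ (p : ℝ) ^ (h : ℤ))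
    {κ : ℕ} (hκ : ‖τ 1‖ = (p : ℝ) ^ (-(κ : ℤ)))
    {e : ℕ} (he : ‖2 * A.det ^ 3‖ = (p : ℝ) ^ (-(e : ℤ)))
    {P : Matrix (Fin 4) (Fin 4) ℚ_[p]} (hP : P.det ≠ 0) {H : ℕ}
    (hle : ∀ i, latticeOf P ⊆ latticeOf (Y i))
    (hge : ∀ i, ∀ v ∈ latticeOf (Y i), (p : ℚ_[p]) ^ (H : ℤ) • v ∈ latticeOf P)
    (s : Finset ι) : s.card ≤ (H + 1) ^ 4 * (4 * p ^ (κ + h + 4 * e)) := by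
  classical
  have hp1 : (1 : ℝ) < p := by exact_mod_cast (Fact.out : p.Prime).one_lt
  choose n f hf using fun i k => exists_isPivot (hrep i).det_ne_zero k
  choose n₀ f₀ hf₀ using fun k => exists_isPivot hP k
  have hn : ∀ i k, n₀ k ≤ n i k ∧ n i k ≤ n₀ k + H := fun i k => by
    constructor
    · have h1 := (hf i k).le_norm _ (hle i (hf₀ k).mem) (hf₀ k).above
      rwa [(hf₀ k).pivot, Padic.norm_p_zpow, neg_neg, zpow_le_zpow_iff_right₀ hp1] at h1
    · have h1 := (hf₀ k).le_norm _ (hge i _ (hf i k).mem) fun j hj => by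
        simp [(hf i k).above j hj]
      rw [Pi.smul_apply, smul_eq_mul, norm_mul, (hf i k).pivot, Padic.norm_p_zpow,
        Padic.norm_p_zpow, neg_neg, ← zpow_add₀ (by positivity), zpow_le_zpow_iff_right₀ hp1] at h1
      omega
  refine (card_le_of_coloring s (fun i => fun k => (⟨(n i k - n₀ k).toNat, by
    have := hn i k
    omega⟩ : Fin (H + 1))) (B := 4 * p ^ (κ + h + 4 * e)) fun a => ?_).trans_eq (by simp)
  refine card_le_of_isPivot (f := f) (n := fun k => n₀ k + (a k : ℕ)) hrep hinj hzero hone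
    (fun i hi k => ?_) hh hκ he
  have h1 := congrFun (Finset.mem_filter.1 hi).2 k
  have h2 := congrArg Fin.val h1
  have h3 : n i k = n₀ k + (a k : ℕ) := by
    have := (hn i k).1
    simp only at h2
    omega
  rw [← h3]
  exact hf i k

end LocalCount

section BilinearValue

variable {R S : Type*} [CommRing R] [CommRing S] {T : Matrix (Fin 4) (Fin 4) R}

/-- The value of the bilinear form with Gram matrix `T`. -/
def formVal (T : Matrix (Fin 4) (Fin 4) R) (v w : Fin 4 → R) : R := v ⬝ᵥ T *ᵥ w

theorem formVal_add_left (u v w : Fin 4 → R) :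
    formVal T (u + v) w = formVal T u w + formVal T v w := by
  simp [formVal]

theorem formVal_add_right (u v w : Fin 4 → R) :
    formVal T u (v + w) = formVal T u v + formVal T u w := by
  simp [formVal, mulVec_add]

theorem formVal_smul_left (r : R) (v w : Fin 4 → R) :
    formVal T (r • v) w = r * formVal T v w := by
  simp [formVal]

theorem formVal_smul_right (r : R) (v w : Fin 4 → R) :
    formVal T v (r • w) = r * formVal T v w := by
  simp [formVal, mulVec_smul]

theorem formVal_comm (hT : T.IsSymm) (v w : Fin 4 → R) : formVal T v w = formVal T w v := by
  rw [formVal, dotProduct_mulVec, ← mulVec_transpose, hT.eq, dotProduct_comm, formVal]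

theorem formVal_map (f : R →+* S) (v w : Fin 4 → R) :
    formVal (T.map f) (f ∘ v) (f ∘ w) = f (formVal T v w) := by
  rw [formVal, formVal, RingHom.map_dotProduct]
  congr 1
  ext i
  exact (RingHom.map_mulVec f T w i).symm

theorem mul_mul_transpose_apply (B : Matrix (Fin 4) (Fin 4) R) (i j : Fin 4) :
    (B * T * Bᵀ) i j = formVal T (B i) (B j) := by
  rw [formVal, dotProduct_mulVec]
  rfl

end BilinearValue

/-- A pair of nonzero orthogonal vectors extends to an orthogonal basis. -/
theorem exists_orthogonal_completion {T : Matrix (Fin 4) (Fin 4) ℚ} (hT : T.IsSymm)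
    (hpos : ∀ v, v ≠ 0 → 0 < formVal T v v) {x y : Fin 4 → ℚ} (hx : x ≠ 0) (hy : y ≠ 0)
    (hxy : formVal T x y = 0) : ∃ (B : Matrix (Fin 4) (Fin 4) ℚ) (τ : Fin 4 → ℚ),
      B 0 = x ∧ B 1 = y ∧ (∀ k, τ k ≠ 0) ∧ B * T * Bᵀ = diagonal τ := by
  obtain ⟨z, hz, hz'⟩ := exists_mulVec_eq_zero_iff.2
    (det_eq_zero_of_row_eq_zero (A := of ![x ᵥ* T, y ᵥ* T, 0, 0]) 3 fun j => by simp)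
  obtain ⟨w, hw, hw'⟩ := exists_mulVec_eq_zero_iff.2
    (det_eq_zero_of_row_eq_zero (A := of ![x ᵥ* T, y ᵥ* T, z ᵥ* T, 0]) 3 fun j => by simp)
  have hxz : formVal T x z = 0 := by
    rw [formVal, dotProduct_mulVec]
    exact congrFun hz' 0
  have hyz : formVal T y z = 0 := by
    rw [formVal, dotProduct_mulVec]
    exact congrFun hz' 1
  have hxw : formVal T x w = 0 := by
    rw [formVal, dotProduct_mulVec]
    exact congrFun hw' 0
  have hyw : formVal T y w = 0 := by
    rw [formVal, dotProduct_mulVec]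
    exact congrFun hw' 1
  have hzw : formVal T z w = 0 := by
    rw [formVal, dotProduct_mulVec]
    exact congrFun hw' 2
  refine ⟨of ![x, y, z, w], ![formVal T x x, formVal T y y, formVal T z z, formVal T w w],
    rfl, rfl, fun k => ?_, ?_⟩
  · fin_cases k
    exacts [(hpos x hx).ne', (hpos y hy).ne', (hpos z hz).ne', (hpos w hw).ne']
  · have key : ∀ i j : Fin 4, formVal T (![x, y, z, w] i) (![x, y, z, w] j) =
        diagonal ![formVal T x x, formVal T y y, formVal T z z, formVal T w w] i j := by
      intro i j
      fin_cases i <;> fin_cases j <;>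
        simp [hxy, hxz, hyz, hxw, hyw, hzw, formVal_comm hT _ x, formVal_comm hT _ y,
          formVal_comm hT w z]
    exact ext fun i j => (mul_mul_transpose_apply _ i j).trans (key i j)

section IntegralForm

variable {M : Matrix (Fin 4) (Fin 4) ℚ} {T : Matrix (Fin 4) (Fin 4) ℤ}

theorem IsIntegralPosDefForm.exists_two_smul (hM : IsIntegralPosDefForm M) :
    ∃ T : Matrix (Fin 4) (Fin 4) ℤ, T.map (Int.castRingHom ℚ) = 2 • M := by
  choose T hT using hM.2.2.1
  refine ⟨of T, ext fun i j => ?_⟩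
  simp [← hT i j]

theorem IsIntegralPosDefForm.isSymm (hM : IsIntegralPosDefForm M)
    (hT : T.map (Int.castRingHom ℚ) = 2 • M) : T.IsSymm := by
  refine map_injective (f := Int.castRingHom ℚ) Int.cast_injective ?_
  change Tᵀ.map _ = T.map _
  rw [transpose_map, hT, transpose_smul, hM.1.eq]

theorem IsIntegralPosDefForm.formVal_map_pos (hM : IsIntegralPosDefForm M)
    (hT : T.map (Int.castRingHom ℚ) = 2 • M) {v : Fin 4 → ℚ} (hv : v ≠ 0) :
    0 < formVal (T.map (Int.castRingHom ℚ)) v v := by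
  rw [hT, formVal, smul_mulVec, dotProduct_smul]
  exact nsmul_pos (hM.2.2.2 v hv) two_ne_zero

theorem IsIntegralPosDefForm.formVal_pos (hM : IsIntegralPosDefForm M)
    (hT : T.map (Int.castRingHom ℚ) = 2 • M) {v : Fin 4 → ℤ} (hv : v ≠ 0) :
    0 < formVal T v v := by
  have h := hM.formVal_map_pos hT (v := Int.castRingHom ℚ ∘ v) fun h => hv <| funext fun i => by
    simpa using congrFun h i
  rw [formVal_map, eq_intCast] at h
  exact_mod_cast h

theorem two_pow_mul_gramDet (hT : T.map (Int.castRingHom ℚ) = 2 • M) {j : ℕ}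
    (u : Fin j → Fin 4 → ℤ) :
    2 ^ j * gramDet M u = ((of fun a b => formVal T (u a) (u b)).det : ℤ) := by
  have h : ((of fun a b => formVal T (u a) (u b)).map (Int.castRingHom ℚ)) =
      (2 : ℚ) • of fun a b => (fun i => ((u a i : ℚ))) ⬝ᵥ M.mulVec fun i => ((u b i : ℚ)) := by
    ext a b
    have h1 := formVal_map (T := T) (Int.castRingHom ℚ) (u a) (u b)
    rw [hT, formVal, smul_mulVec, dotProduct_smul] at h1
    rw [nsmul_eq_mul, Nat.cast_two] at h1
    exact h1.symm
  have h2 := congrArg det h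
  rw [det_smul, Fintype.card_fin] at h2
  rw [gramDet, ← h2, ← RingHom.mapMatrix_apply, ← RingHom.map_det]
  rfl

variable {p : ℕ}

theorem exists_primitive_smul (w : Fin 4 → ℤ) :
    ∃ (d : ℤ) (v c : Fin 4 → ℤ), w = d • v ∧ v ≠ 0 ∧ ∑ i, c i * v i = 1 := by
  obtain ⟨v, hv, hv1⟩ := Finset.extract_gcd w (Finset.univ_nonempty (α := Fin 4))
  obtain ⟨c, hc⟩ := Finset.gcd_eq_sum_mul Finset.univ v
  refine ⟨Finset.univ.gcd w, v, c, funext fun i => hv i (Finset.mem_univ i), ?_, ?_⟩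
  · rintro rfl
    exact zero_ne_one ((Finset.gcd_eq_zero_iff.2 fun _ _ => rfl).symm.trans hv1)
  · rw [← hv1, hc]
    simp [mul_comm]

theorem kSum_one_le_of_primitive (hM : IsIntegralPosDefForm M)
    (hT : T.map (Int.castRingHom ℚ) = 2 • M) {v c : Fin 4 → ℤ} (hv : v ≠ 0)
    (hc : ∑ i, c i * v i = 1) : kSum M 1 p ≤ padicValInt p (formVal T v v) := by
  refine Nat.sInf_le ⟨![v], ?_, fun w hw => ?_, ?_, ?_⟩
  · rw [linearIndependent_unique_iff]
    exact hv
  · simp only [Set.range_unique, Submodule.mem_span_singleton] at hw ⊢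
    obtain ⟨r, hr⟩ := hw
    have hr' : ∀ i, r * (v i : ℚ) = w i := fun i => congrFun hr i
    have h1 : r = ((∑ i, c i * w i : ℤ) : ℚ) := by
      have h2 : ((∑ i, c i * v i : ℤ) : ℚ) = 1 := by rw [hc, Int.cast_one]
      push_cast at h2 ⊢
      rw [← mul_one r, ← h2, Finset.mul_sum]
      exact Finset.sum_congr rfl fun i _ => by rw [← hr' i]; ring
    refine ⟨∑ i, c i * w i, funext fun i => ?_⟩
    have h3 := hr' i
    rw [h1] at h3
    exact_mod_cast h3
  · rw [two_pow_mul_gramDet hT]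
    simpa using (hM.formVal_pos hT hv).ne'
  · rw [two_pow_mul_gramDet hT]
    simp

theorem kSum_one_le [Fact p.Prime] (hM : IsIntegralPosDefForm M)
    (hT : T.map (Int.castRingHom ℚ) = 2 • M) {w : Fin 4 → ℤ} (hw : w ≠ 0) :
    kSum M 1 p ≤ padicValInt p (formVal T w w) := by
  obtain ⟨d, v, c, rfl, hv, hc⟩ := exists_primitive_smul w
  refine (kSum_one_le_of_primitive hM hT hv hc).trans ?_
  have hd : d ≠ 0 := fun h => hw (by rw [h, zero_smul])
  have hv0 := (hM.formVal_pos hT hv).ne'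
  rw [formVal_smul_left, formVal_smul_right, padicValInt.mul hd (mul_ne_zero hd hv0),
    padicValInt.mul hd hv0]
  omega

theorem exists_padicValInt_eq_kSum {j : ℕ} (hj : j ≤ 4) (hT : T.map (Int.castRingHom ℚ) = 2 • M)
    (h0 : (of fun a b : Fin j => formVal T (Pi.single (Fin.castLE hj a) 1)
      (Pi.single (Fin.castLE hj b) 1)).det ≠ 0) :
    ∃ u : Fin j → Fin 4 → ℤ, (of fun a b => formVal T (u a) (u b)).det ≠ 0 ∧
      padicValInt p (of fun a b => formVal T (u a) (u b)).det = kSum M j p := by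
  have hne : {v : ℕ | ∃ u : Fin j → Fin 4 → ℤ,
      LinearIndependent ℤ u ∧
      (∀ w : Fin 4 → ℤ,
        (fun i => ((w i : ℚ))) ∈
            Submodule.span ℚ (Set.range fun a => fun i => ((u a i : ℚ))) →
          w ∈ Submodule.span ℤ (Set.range u)) ∧
      2 ^ j * gramDet M u ≠ 0 ∧
      (v : ℤ) = padicValRat p (2 ^ j * gramDet M u)}.Nonempty := by
    refine ⟨padicValInt p (of fun a b : Fin j => formVal T (Pi.single (Fin.castLE hj a) 1)
      (Pi.single (Fin.castLE hj b) 1)).det, fun a => Pi.single (Fin.castLE hj a) 1,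
      ?_, fun w hw => ?_, ?_, ?_⟩
    · have h := (Pi.basisFun ℤ (Fin 4)).linearIndependent.comp _ (Fin.castLE_injective hj)
      convert h using 1
      · ext a
        simp
      · exact Subsingleton.elim _ _
    · rw [Submodule.mem_span_range_iff_exists_fun] at hw ⊢
      obtain ⟨c, hc⟩ := hw
      have hc' : ∀ a, c a = w (Fin.castLE hj a) := fun a => by
        have h := congrFun hc (Fin.castLE hj a)
        simpa [Finset.sum_apply, Pi.single_apply, Fin.castLE_inj] using h
      refine ⟨fun a => w (Fin.castLE hj a), funext fun i => ?_⟩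
      have h := congrFun hc i
      simp only [hc', Finset.sum_apply, Pi.smul_apply, smul_eq_mul] at h ⊢
      exact_mod_cast h
    · rw [two_pow_mul_gramDet hT]
      exact_mod_cast h0
    · rw [two_pow_mul_gramDet hT, padicValRat.of_int]
  obtain ⟨u, -, -, hu0, hu⟩ := Nat.sInf_mem hne
  rw [two_pow_mul_gramDet hT] at hu0 hu
  rw [padicValRat.of_int] at hu
  exact ⟨u, by exact_mod_cast hu0, (Nat.cast_injective hu).symm⟩

theorem exists_padicValInt_eq_kSum_one (p : ℕ) (hM : IsIntegralPosDefForm M)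
    (hT : T.map (Int.castRingHom ℚ) = 2 • M) :
    ∃ v : Fin 4 → ℤ, formVal T v v ≠ 0 ∧ padicValInt p (formVal T v v) = kSum M 1 p := by
  obtain ⟨u, hu⟩ := exists_padicValInt_eq_kSum (p := p) (j := 1) (by norm_num) hT (by
    rw [det_fin_one]
    exact (hM.formVal_pos hT (by simp)).ne')
  rw [det_fin_one] at hu
  exact ⟨u 0, hu⟩

theorem formVal_sq_lt (hM : IsIntegralPosDefForm M) (hT : T.map (Int.castRingHom ℚ) = 2 • M)
    {v w : Fin 4 → ℤ} (hv : v ≠ 0) (h : formVal T v v • w - formVal T v w • v ≠ 0) :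
    formVal T v w ^ 2 < formVal T v v * formVal T w w := by
  have h1 := hM.formVal_pos hT h
  have h2 := hM.formVal_pos hT hv
  rw [sub_eq_add_neg, ← neg_smul] at h1
  simp only [formVal_add_left, formVal_add_right, formVal_smul_left, formVal_smul_right,
    formVal_comm (hM.isSymm hT) w v] at h1
  have h3 : 0 < formVal T v v * (formVal T v v * formVal T w w - formVal T v w ^ 2) := by
    linarith
  linarith [pos_of_mul_pos_right h3 h2.le]

theorem exists_padicValInt_eq_kSum_two (p : ℕ) (hM : IsIntegralPosDefForm M)
    (hT : T.map (Int.castRingHom ℚ) = 2 • M) :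
    ∃ v w : Fin 4 → ℤ, formVal T v v * formVal T w w - formVal T v w ^ 2 ≠ 0 ∧
      padicValInt p (formVal T v v * formVal T w w - formVal T v w ^ 2) = kSum M 2 p := by
  obtain ⟨u, hu⟩ := exists_padicValInt_eq_kSum (p := p) (j := 2) (by norm_num) hT (by
    rw [det_fin_two]
    have h0 : (Pi.single 0 1 : Fin 4 → ℤ) ≠ 0 := by simp
    have h1 := formVal_sq_lt hM hT (w := Pi.single 1 1) h0 fun h => by
      have h2 := congrFun h 1
      simp at h2
      exact (hM.formVal_pos hT h0).ne' h2
    rw [sq] at h1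
    nth_rewrite 2 [formVal_comm (hM.isSymm hT)] at h1
    exact (sub_pos.2 h1).ne')
  rw [det_fin_two] at hu
  refine ⟨u 0, u 1, ?_⟩
  rw [sq, ← congrArg (formVal T (u 0) (u 1) * ·) (formVal_comm (hM.isSymm hT) (u 1) (u 0))]
  exact hu

end IntegralForm

section LocalBasis

variable {p : ℕ} [Fact p.Prime] {M : Matrix (Fin 4) (Fin 4) ℚ} {T : Matrix (Fin 4) (Fin 4) ℤ}

theorem norm_intCast_eq_zpow {z : ℤ} (hz : z ≠ 0) :
    ‖(z : ℚ_[p])‖ = (p : ℝ) ^ (-(padicValInt p z : ℤ)) := by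
  have h : ((z : ℚ) : ℚ_[p]) = z := by norm_cast
  rw [← h, Padic.eq_padicNorm, padicNorm.eq_zpow_of_nonzero (by exact_mod_cast hz),
    padicValRat.of_int]
  push_cast
  rfl

theorem norm_formVal_self_le (hM : IsIntegralPosDefForm M)
    (hT : T.map (Int.castRingHom ℚ) = 2 • M) {v : Fin 4 → ℤ} (hv : formVal T v v ≠ 0)
    (hk : padicValInt p (formVal T v v) = kSum M 1 p) (w : Fin 4 → ℤ) :
    ‖((formVal T w w : ℤ) : ℚ_[p])‖ ≤ ‖((formVal T v v : ℤ) : ℚ_[p])‖ := by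
  have hp1 : (1 : ℝ) ≤ p := by exact_mod_cast (Fact.out : p.Prime).one_le
  by_cases hw : w = 0
  · simp [formVal, hw]
  · rw [norm_intCast_eq_zpow (hM.formVal_pos hT hw).ne', norm_intCast_eq_zpow hv, hk]
    exact zpow_le_zpow_right₀ hp1 (neg_le_neg (by exact_mod_cast kSum_one_le hM hT hw))

theorem norm_two_mul_formVal_le (hM : IsIntegralPosDefForm M)
    (hT : T.map (Int.castRingHom ℚ) = 2 • M) {v : Fin 4 → ℤ} (hv : formVal T v v ≠ 0)
    (hk : padicValInt p (formVal T v v) = kSum M 1 p) (w : Fin 4 → ℤ) :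
    ‖2 * ((formVal T v w : ℤ) : ℚ_[p])‖ ≤ ‖((formVal T v v : ℤ) : ℚ_[p])‖ := by
  have h : 2 * ((formVal T v w : ℤ) : ℚ_[p]) =
      (formVal T (v + w) (v + w) : ℤ) - (formVal T v v : ℤ) - (formVal T w w : ℤ) := by
    rw [formVal_add_left, formVal_add_right, formVal_add_right,
      formVal_comm (hM.isSymm hT) w v]
    push_cast
    ring
  rw [h]
  exact padic_norm_sub_le (padic_norm_sub_le (norm_formVal_self_le hM hT hv hk _) le_rfl)
    (norm_formVal_self_le hM hT hv hk _)

theorem norm_sixteen_mul_le {τ t₁ t₂ a b c G : ℚ_[p]} {m : ℝ} (hτ : τ ≠ 0) (h₁ : ‖2 * t₁‖ ≤ ‖τ‖)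
    (h₂ : ‖2 * t₂‖ ≤ ‖τ‖) (ha : ‖a‖ ≤ m) (hb : ‖b‖ ≤ m) (hc : ‖2 * c‖ ≤ m)
    (hm : ‖(4 : ℚ_[p])‖ * m ≤ ‖τ‖ ^ 2)
    (h : τ ^ 2 * G = t₁ ^ 2 * b - 2 * t₁ * t₂ * c + t₂ ^ 2 * a + (a * b - c ^ 2)) :
    ‖16 * G‖ ≤ m := by
  have hm0 : 0 ≤ m := (norm_nonneg _).trans ha
  have hτ0 : 0 < ‖τ‖ ^ 2 := pow_pos (norm_pos_iff.2 hτ) 2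
  have hn4 : ‖(4 : ℚ_[p])‖ ≤ 1 := by exact_mod_cast Padic.norm_int_le_one (p := p) 4
  have h4 : ∀ x y z : ℚ_[p], ‖x‖ ≤ ‖τ‖ → ‖y‖ ≤ ‖τ‖ → ‖z‖ ≤ m →
      ‖(4 : ℚ_[p]) * (x * y * z)‖ ≤ ‖τ‖ ^ 2 * m := fun x y z hx hy hz => by
    rw [norm_mul, norm_mul, norm_mul, sq]
    calc _ ≤ 1 * (‖τ‖ * ‖τ‖ * m) := by gcongr
      _ = _ := one_mul _
  have h5 : ∀ x y : ℚ_[p], ‖x‖ ≤ m → ‖y‖ ≤ m → ‖(4 : ℚ_[p]) * (x * y)‖ ≤ ‖τ‖ ^ 2 * m :=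
      fun x y hx hy => by
    rw [norm_mul, norm_mul]
    calc ‖(4 : ℚ_[p])‖ * (‖x‖ * ‖y‖) ≤ ‖(4 : ℚ_[p])‖ * (m * m) := by gcongr
      _ = ‖(4 : ℚ_[p])‖ * m * m := by ring
      _ ≤ _ := by gcongr
  have h6 : τ ^ 2 * (16 * G) = 4 * (2 * t₁ * (2 * t₁) * b) - 4 * (2 * t₁ * (2 * t₂) * (2 * c)) +
      4 * (2 * t₂ * (2 * t₂) * a) + (4 * (2 * a * (2 * b)) - 4 * (2 * c * (2 * c))) := by
    linear_combination 16 * h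
  have h2m : ∀ x : ℚ_[p], ‖x‖ ≤ m → ‖2 * x‖ ≤ m := fun x hx => by
    rw [norm_mul]
    have h21 : ‖(2 : ℚ_[p])‖ ≤ 1 := by exact_mod_cast Padic.norm_int_le_one (p := p) 2
    calc _ ≤ 1 * m := by gcongr
      _ = m := one_mul m
  refine le_of_mul_le_mul_left ?_ hτ0
  rw [← norm_pow, ← norm_mul, h6, norm_pow]
  exact padic_norm_add_le (padic_norm_add_le (padic_norm_sub_le (h4 _ _ _ h₁ h₁ hb)
    (h4 _ _ _ h₁ h₂ hc)) (h4 _ _ _ h₂ h₂ ha)) (padic_norm_sub_le (h5 _ _ (h2m a ha) (h2m b hb))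
    (h5 _ _ hc hc))

/-- A vector of minimal `p`-adic norm can be completed to a pair of almost minimal Gram
determinant. -/
theorem exists_norm_gram_ge (hM : IsIntegralPosDefForm M)
    (hT : T.map (Int.castRingHom ℚ) = 2 • M) {v : Fin 4 → ℤ} (hv : formVal T v v ≠ 0)
    (hk : padicValInt p (formVal T v v) = kSum M 1 p) :
    ∃ w : Fin 4 → ℤ, ‖(16 : ℚ_[p])‖ * (p : ℝ) ^ (-(kSum M 2 p : ℤ)) ≤
      ‖((formVal T v v : ℤ) * (formVal T w w : ℤ) - (formVal T v w : ℤ) ^ 2 : ℚ_[p])‖ := by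
  obtain ⟨u₁, u₂, hG, hGk⟩ := exists_padicValInt_eq_kSum_two p hM hT
  obtain ⟨w, -, hw⟩ := Finset.exists_max_image {u₁, u₂, u₁ + u₂}
    (fun w => ‖((formVal T v v : ℤ) * (formVal T w w : ℤ) - (formVal T v w : ℤ) ^ 2 : ℚ_[p])‖)
    ⟨u₁, by simp⟩
  refine ⟨w, ?_⟩
  have hsymm := hM.isSymm hT
  have h12 := hw u₁ (by simp)
  have h22 := hw u₂ (by simp)
  have hsum := hw (u₁ + u₂) (by simp)
  rw [← hGk, ← norm_intCast_eq_zpow hG, ← norm_mul]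
  refine norm_sixteen_mul_le (τ := (formVal T v v : ℤ)) (t₁ := (formVal T v u₁ : ℤ))
    (t₂ := (formVal T v u₂ : ℤ))
    (c := (formVal T v v : ℤ) * (formVal T u₁ u₂ : ℤ) - (formVal T v u₁ : ℤ) * (formVal T v u₂ : ℤ))
    (by exact_mod_cast hv) (norm_two_mul_formVal_le hM hT hv hk _)
    (norm_two_mul_formVal_le hM hT hv hk _) h12 h22 ?_ ?_ ?_
  · have h : 2 * ((formVal T v v : ℤ) * (formVal T u₁ u₂ : ℤ) -
        (formVal T v u₁ : ℤ) * (formVal T v u₂ : ℤ) : ℚ_[p]) =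
        ((formVal T v v : ℤ) * (formVal T (u₁ + u₂) (u₁ + u₂) : ℤ) -
          (formVal T v (u₁ + u₂) : ℤ) ^ 2) -
        ((formVal T v v : ℤ) * (formVal T u₁ u₁ : ℤ) - (formVal T v u₁ : ℤ) ^ 2) -
        ((formVal T v v : ℤ) * (formVal T u₂ u₂ : ℤ) - (formVal T v u₂ : ℤ) ^ 2) := by
      simp only [formVal_add_left, formVal_add_right, formVal_comm hsymm u₂ u₁]
      push_cast
      ring
    rw [h]
    exact padic_norm_sub_le (padic_norm_sub_le hsum h12) h22
  · have hn4 : ‖(4 : ℚ_[p])‖ ≤ 1 := by exact_mod_cast Padic.norm_int_le_one (p := p) 4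
    rw [← norm_mul, show (4 : ℚ_[p]) * ((formVal T v v : ℤ) * (formVal T w w : ℤ) -
        (formVal T v w : ℤ) ^ 2) =
      4 * ((formVal T v v : ℤ) * (formVal T w w : ℤ)) -
        2 * (formVal T v w : ℤ) * (2 * (formVal T v w : ℤ)) by ring]
    have h2 := norm_two_mul_formVal_le hM hT hv hk w
    have h1 := norm_formVal_self_le hM hT hv hk w
    refine padic_norm_sub_le ?_ ?_
    · rw [norm_mul, norm_mul, sq]
      calc _ ≤ 1 * (‖((formVal T v v : ℤ) : ℚ_[p])‖ * ‖((formVal T v v : ℤ) : ℚ_[p])‖) := by gcongr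
        _ = _ := one_mul _
    · rw [norm_mul, sq]
      gcongr
  · push_cast
    ring

theorem norm_le_of_norm_mul_sq_le {a u : ℚ_[p]} {k : ℤ} {k₂ : ℕ}
    (ha : ‖(64 : ℚ_[p])‖ * (p : ℝ) ^ (-k) ≤ ‖a‖) (hk : k ≤ k₂) (h : ‖a * u ^ 2‖ ≤ 1) :
    ‖u‖ ≤ (p : ℝ) ^ ((k₂ / 2 + 3 * padicValNat p 2 : ℕ) : ℤ) := by
  have hp1 : (1 : ℝ) < p := by exact_mod_cast (Fact.out : p.Prime).one_lt
  by_cases hu : u = 0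
  · rw [hu, norm_zero]
    positivity
  have h2 : ‖(2 : ℚ_[p])‖ = (p : ℝ) ^ (-(padicValNat p 2 : ℤ)) := by
    have := norm_intCast_eq_zpow (p := p) (z := 2) two_ne_zero
    exact_mod_cast this
  have h8 : ‖(8 : ℚ_[p])‖ = (p : ℝ) ^ (-(3 * padicValNat p 2 : ℤ)) := by
    rw [show (8 : ℚ_[p]) = 2 ^ 3 by norm_num, norm_pow, h2, ← zpow_natCast, ← _root_.zpow_mul]
    congr 1
    push_cast
    ring
  have h64 : ‖(64 : ℚ_[p])‖ = ‖(8 : ℚ_[p])‖ ^ 2 := by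
    rw [← norm_pow]
    norm_num
  obtain ⟨j, hj⟩ : ∃ j : ℤ, ‖u‖ = (p : ℝ) ^ j := ⟨_, Padic.norm_eq_zpow_neg_valuation hu⟩
  rw [hj, zpow_le_zpow_iff_right₀ hp1]
  have h3 : (p : ℝ) ^ (-(3 * padicValNat p 2 : ℤ) * 2 + -k + j * 2) ≤ (p : ℝ) ^ (0 : ℤ) := by
    rw [zpow_add₀ (by positivity), zpow_add₀ (by positivity), _root_.zpow_mul, _root_.zpow_mul,
      ← h8, ← hj,
      zpow_zero]
    refine le_trans ?_ h
    rw [norm_mul, norm_pow]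
    refine mul_le_mul_of_nonneg_right ?_ (by positivity)
    rwa [h64] at ha
  rw [zpow_le_zpow_iff_right₀ hp1] at h3
  omega

/-- A basis that is orthogonal for `T` and whose first two members are `p`-adically integral with
controlled norms. -/
theorem exists_diagonal_basis (p : ℕ) [Fact p.Prime] (hM : IsIntegralPosDefForm M)
    (hT : T.map (Int.castRingHom ℚ) = 2 • M) :
    ∃ (B : Matrix (Fin 4) (Fin 4) ℚ) (τ : Fin 4 → ℚ), (∀ k, τ k ≠ 0) ∧
      B * T.map (Int.castRingHom ℚ) * Bᵀ = diagonal τ ∧ (∀ i, ‖(B 0 i : ℚ_[p])‖ ≤ 1) ∧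
      (∀ i, ‖(B 1 i : ℚ_[p])‖ ≤ 1) ∧ ‖(τ 1 : ℚ_[p])‖ = (p : ℝ) ^ (-(kSum M 1 p : ℤ)) ∧
      ∀ u : ℚ_[p], ‖(τ 0 : ℚ_[p]) * u ^ 2‖ ≤ 1 →
        ‖u‖ ≤ (p : ℝ) ^ (((kSum M 2 p - kSum M 1 p) / 2 + 3 * padicValNat p 2 : ℕ) : ℤ) := by
  obtain ⟨v, hv, hk⟩ := exists_padicValInt_eq_kSum_one p hM hT
  obtain ⟨w, hw⟩ := exists_norm_gram_ge hM hT hv hk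
  have hp0 : (0 : ℝ) < p := by exact_mod_cast (Fact.out : p.Prime).pos
  set f := Int.castRingHom ℚ with hf
  set t : ℚ := (formVal T v w : ℤ) / (formVal T v v : ℤ) with ht
  have hvQ : ((formVal T v v : ℤ) : ℚ) ≠ 0 := by exact_mod_cast hv
  have hsymm := hM.isSymm hT
  have hsymm' : (T.map f).IsSymm := by rw [IsSymm, ← transpose_map, hsymm.eq]
  set x : Fin 4 → ℚ := (2 : ℚ) • (f ∘ w - t • (f ∘ v)) with hx
  have hxx : formVal (T.map f) x x =
      4 * (((formVal T v v : ℤ) * (formVal T w w : ℤ) - (formVal T v w : ℤ) ^ 2) /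
      (formVal T v v : ℤ)) := by
    rw [hx, sub_eq_add_neg, ← neg_smul]
    simp only [formVal_add_left, formVal_add_right, formVal_smul_left, formVal_smul_right,
      formVal_map, formVal_comm hsymm w v, hf, eq_intCast, ht]
    field_simp
    ring
  have hxv : formVal (T.map f) x (f ∘ v) = 0 := by
    rw [hx, sub_eq_add_neg, ← neg_smul]
    simp only [formVal_add_left, formVal_smul_left, formVal_map, formVal_comm hsymm w v, hf,
      eq_intCast, ht]
    field_simp
    ring
  have hg : ((formVal T v v : ℤ) * (formVal T w w : ℤ) - (formVal T v w : ℤ) ^ 2 : ℚ_[p]) ≠ 0 := by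
    rw [← norm_pos_iff]
    refine lt_of_lt_of_le ?_ hw
    have : (16 : ℚ_[p]) ≠ 0 := by norm_num
    positivity
  have hxx0 : formVal (T.map f) x x ≠ 0 := by
    rw [hxx]
    have : ((formVal T v v : ℤ) * (formVal T w w : ℤ) - (formVal T v w : ℤ) ^ 2 : ℚ) ≠ 0 := by
      exact_mod_cast hg
    positivity
  obtain ⟨B, τ, hB0, hB1, hτ, hB⟩ := exists_orthogonal_completion hsymm'
    (fun z hz => hM.formVal_map_pos hT hz) (x := x) (y := f ∘ v)
    (fun h => hxx0 (by rw [h]; simp [formVal])) (fun h => hvQ (by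
      have := formVal_map (T := T) f v v
      rw [h] at this
      simpa [formVal] using this.symm)) hxv
  have hτk : ∀ k, τ k = formVal (T.map f) (B k) (B k) := fun k => by
    rw [← mul_mul_transpose_apply, hB, diagonal_apply_eq]
  have hτ1 : τ 1 = formVal T v v := by rw [hτk, hB1, formVal_map, hf, eq_intCast]
  refine ⟨B, τ, hτ, hB, fun i => ?_, fun i => ?_, ?_, fun u hu => ?_⟩
  · have h1 : ((x i : ℚ) : ℚ_[p]) =
        2 * w i - 2 * (formVal T v w : ℤ) / (formVal T v v : ℤ) * v i := by
      simp only [hx, ht, hf, Pi.smul_apply, Pi.sub_apply, Function.comp, eq_intCast, smul_eq_mul]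
      push_cast
      ring
    rw [hB0, h1]
    refine padic_norm_sub_le (norm_mul_le_one ?_ (Padic.norm_int_le_one _))
      (norm_mul_le_one ?_ (Padic.norm_int_le_one _))
    · exact_mod_cast Padic.norm_int_le_one (p := p) 2
    · rw [norm_div]
      exact div_le_one_of_le₀ (norm_two_mul_formVal_le hM hT hv hk w) (norm_nonneg _)
  · rw [hB1]
    simpa [hf] using Padic.norm_int_le_one (p := p) (v i)
  · rw [hτ1, Rat.cast_intCast, norm_intCast_eq_zpow hv, hk]
  · refine norm_le_of_norm_mul_sq_le (k := (kSum M 2 p : ℤ) - kSum M 1 p) ?_ (by omega) hu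
    rw [hτk, hB0, hxx]
    push_cast
    rw [norm_mul, norm_div, norm_intCast_eq_zpow hv, hk, neg_sub, sub_eq_add_neg, add_comm,
      zpow_add₀ hp0.ne', show (64 : ℚ_[p]) = 4 * 16 by norm_num, norm_mul,
      _root_.zpow_neg _ (kSum M 1 p : ℤ),
      div_inv_eq_mul]
    calc _ = ‖(4 : ℚ_[p])‖ * (‖(16 : ℚ_[p])‖ * (p : ℝ) ^ (-(kSum M 2 p : ℤ)) *
          (p : ℝ) ^ (kSum M 1 p : ℤ)) := by ring
      _ ≤ _ := by gcongr

end LocalBasis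

section Representations

variable {p : ℕ} [Fact p.Prime]

theorem mem_latticeOf_mul {X P : Matrix (Fin 4) (Fin 4) ℚ_[p]} {v : Fin 4 → ℚ_[p]} :
    v ∈ latticeOf (X * P) ↔ P *ᵥ v ∈ latticeOf X := by
  simp only [latticeOf, Set.mem_ofPred_eq, mulVec_mulVec]

theorem latticeOf_mul_injective {X X' P : Matrix (Fin 4) (Fin 4) ℚ_[p]} (hP : P.det ≠ 0)
    (h : latticeOf (X * P) = latticeOf (X' * P)) : latticeOf X = latticeOf X' := by
  ext v
  have hv : P *ᵥ (P⁻¹ *ᵥ v) = v := by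
    rw [mulVec_mulVec, mul_nonsing_inv _ (isUnit_iff_ne_zero.2 hP), one_mulVec]
  rw [← hv, ← mem_latticeOf_mul (P := P), ← mem_latticeOf_mul (P := P), h]

theorem norm_map_intCast_le_one (X : Matrix (Fin 4) (Fin 4) ℤ) (i j : Fin 4) :
    ‖X.map (Int.castRingHom ℚ_[p]) i j‖ ≤ 1 := Padic.norm_int_le_one _

theorem det_smul_mulVec {R : Type*} [CommRing R] (X : Matrix (Fin 4) (Fin 4) R) (v : Fin 4 → R) :
    X.det • v = X.adjugate *ᵥ (X *ᵥ v) := by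
  rw [mulVec_mulVec, adjugate_mul, smul_mulVec, one_mulVec]

/-- The index of `ℤ_p⁴` in the lattice of a representation of `T` is controlled by `det T`. -/
theorem zpow_smul_mem_latticeOf_one {A T X : Matrix (Fin 4) (Fin 4) ℤ} (hT : T.det ≠ 0)
    (hX : Xᵀ * A * X = T) {v : Fin 4 → ℚ_[p]}
    (hv : v ∈ latticeOf (X.map (Int.castRingHom ℚ_[p]))) :
    (p : ℚ_[p]) ^ (padicValInt p T.det : ℤ) • v ∈ latticeOf 1 := fun i => by
  have hdet : T.det = X.det * (A.det * X.det) := by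
    rw [← hX, det_mul, det_mul, det_transpose, mul_assoc]
  have hle : ‖(T.det : ℚ_[p])‖ ≤ ‖(X.det : ℚ_[p])‖ := by
    rw [hdet, Int.cast_mul, norm_mul]
    exact mul_le_of_le_one_right (norm_nonneg _) (Padic.norm_int_le_one _)
  have h := norm_mulVec_le_one (norm_adjugate_le_one (norm_map_intCast_le_one X)) hv i
  have hXdet : (X.map (Int.castRingHom ℚ_[p])).det = (X.det : ℚ_[p]) := by
    rw [← RingHom.mapMatrix_apply, ← RingHom.map_det, eq_intCast]
  rw [← det_smul_mulVec, hXdet, Pi.smul_apply, smul_eq_mul, norm_mul] at h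
  rw [one_mulVec, Pi.smul_apply, smul_eq_mul, norm_mul, norm_zpow, Padic.norm_p, _root_.inv_zpow',
    ← norm_intCast_eq_zpow hT]
  exact (mul_le_mul_of_nonneg_right hle (norm_nonneg _)).trans h

open Classical in
theorem card_image_latticeOf_le (p : ℕ) [Fact p.Prime] {M : Matrix (Fin 4) (Fin 4) ℚ}
    {A T : Matrix (Fin 4) (Fin 4) ℤ} (hM : IsIntegralPosDefForm M)
    (hT : T.map (Int.castRingHom ℚ) = 2 • M) (hA : A.det ≠ 0)
    (s : Finset (Matrix (Fin 4) (Fin 4) ℤ)) (hs : ∀ X ∈ s, Xᵀ * A * X = T) :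
    (s.image fun X => latticeOf (X.map (Int.castRingHom ℚ_[p]))).card ≤
      (padicValInt p T.det + 1) ^ 4 *
        (4 * p ^ (kSum M 1 p + ((kSum M 2 p - kSum M 1 p) / 2 + 3 * padicValNat p 2) +
          4 * padicValInt p (2 * A.det ^ 3))) := by
  obtain ⟨B, τ, hτ, hB, hB0, hB1, hτ1, hτ0⟩ := exists_diagonal_basis p hM hT
  have hcast (Z : Matrix (Fin 4) (Fin 4) ℤ) : Z.map (Int.castRingHom ℚ_[p]) =
      (Z.map (Int.castRingHom ℚ)).map (Rat.castHom ℚ_[p]) := by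
    ext i j
    simp
  have hT0 : T.det ≠ 0 := fun h0 => by
    have h1 := congrArg det hB
    rw [det_mul, det_mul, det_diagonal, ← RingHom.mapMatrix_apply, ← RingHom.map_det, h0, map_zero,
      mul_zero, zero_mul] at h1
    exact Finset.prod_ne_zero_iff.2 (fun k _ => hτ k) h1.symm
  set P : Matrix (Fin 4) (Fin 4) ℚ_[p] := (B.map (Rat.castHom ℚ_[p]))ᵀ with hPdef
  set τ' : Fin 4 → ℚ_[p] := fun k => (τ k : ℚ_[p]) with hτ'
  have hPT : Pᵀ * T.map (Int.castRingHom ℚ_[p]) * P = diagonal τ' := by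
    rw [hcast, hPdef, transpose_transpose, ← transpose_map, ← Matrix.map_mul, ← Matrix.map_mul, hB,
      diagonal_map (map_zero _)]
    rfl
  have hτ'0 (k) : τ' k ≠ 0 := by simpa [hτ'] using hτ k
  have hP : P.det ≠ 0 := fun h0 => by
    have h1 := congrArg det hPT
    rw [det_mul, h0, mul_zero, det_diagonal] at h1
    exact Finset.prod_ne_zero_iff.2 (fun k _ => hτ'0 k) h1.symm
  have hcol (X : Matrix (Fin 4) (Fin 4) ℤ) (k : Fin 4) (hk : ∀ i, ‖(B k i : ℚ_[p])‖ ≤ 1) :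
      Pi.single k 1 ∈ latticeOf (X.map (Int.castRingHom ℚ_[p]) * P) := by
    rw [mem_latticeOf_mul, mulVec_single_one]
    exact norm_mulVec_le_one (norm_map_intCast_le_one X) hk
  obtain ⟨t, hts, ht, himage⟩ := Finset.exists_subset_injOn_image_eq_of_surjOn s
    (s.image fun X => latticeOf (X.map (Int.castRingHom ℚ_[p])))
    (f := fun X : Matrix (Fin 4) (Fin 4) ℤ => latticeOf (X.map (Int.castRingHom ℚ_[p]))) (by
      rw [Finset.coe_image]
      exact Set.surjOn_image _ _)
  rw [← himage, Finset.card_image_of_injOn ht, ← Finset.card_attach]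
  have hP1 (v : Fin 4 → ℚ_[p]) : v ∈ latticeOf P ↔ P *ᵥ v ∈ latticeOf 1 := by
    rw [← mem_latticeOf_mul, one_mul]
  refine card_le_of_isDiagRep (ι := t) (A := A.map (Int.castRingHom ℚ_[p])) (τ := τ')
    (Y := fun X => X.1.map (Int.castRingHom ℚ_[p]) * P)
    (fun X => ⟨norm_map_intCast_le_one A, hτ'0, ?_⟩)
    (fun X X' h => Subtype.ext (ht X.2 X'.2 (latticeOf_mul_injective hP h)))
    (fun X => hcol _ _ hB0) (fun X => hcol _ _ hB1) hτ0 hτ1 ?_ hP (fun X v hv => ?_)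
    (fun X v hv => ?_) t.attach
  · rw [← hPT, ← hs X.1 (hts X.2), Matrix.map_mul, Matrix.map_mul, transpose_mul, ← transpose_map]
    simp only [Matrix.mul_assoc]
  · have h2 : (2 * A.det ^ 3 : ℤ) ≠ 0 := mul_ne_zero two_ne_zero (pow_ne_zero _ hA)
    rw [← norm_intCast_eq_zpow h2, ← RingHom.mapMatrix_apply, ← RingHom.map_det, eq_intCast]
    push_cast
    rfl
  · rw [mem_latticeOf_mul]
    rw [hP1] at hv
    refine norm_mulVec_le_one (norm_map_intCast_le_one X.1) fun i => ?_
    simpa using hv i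
  · rw [hP1, mulVec_smul]
    exact zpow_smul_mem_latticeOf_one hT0 (hs X.1 (hts X.2)) (mem_latticeOf_mul.1 hv)

end Representations

section GlobalCount

variable {M : Matrix (Fin 4) (Fin 4) ℚ} {A T X Y : Matrix (Fin 4) (Fin 4) ℤ}

theorem formVal_sq_le (hM : IsIntegralPosDefForm M) (hT : T.map (Int.castRingHom ℚ) = 2 • M)
    (v w : Fin 4 → ℤ) : formVal T v w ^ 2 ≤ formVal T v v * formVal T w w := by
  by_cases hv : v = 0
  · simp [hv, formVal]
  by_cases h : formVal T v v • w - formVal T v w • v = 0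
  · have h1 := congrArg (formVal T w) (sub_eq_zero.1 h)
    rw [formVal_smul_right, formVal_smul_right, formVal_comm (hM.isSymm hT) w v] at h1
    exact (sq _).trans_le h1.ge
  · exact (formVal_sq_lt hM hT hv h).le

theorem finite_setOf_representation (hM : IsIntegralPosDefForm M)
    (hA : A.map (Int.castRingHom ℚ) = 2 • M) (hdet : A.det ≠ 0)
    (T : Matrix (Fin 4) (Fin 4) ℤ) : {X | Xᵀ * A * X = T}.Finite := by
  have h (N : Fin 4 → Fin 4 → ℤ) : {X : Matrix (Fin 4) (Fin 4) ℤ |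
      ∀ i j, X i j ∈ Set.Icc (-N i j) (N i j)}.Finite :=
    Set.Finite.pi' (t := fun i => {v : Fin 4 → ℤ | ∀ j, v j ∈ Set.Icc (-N i j) (N i j)})
      fun i => Set.Finite.pi' fun j => Set.finite_Icc _ _
  refine (h fun i j => formVal A (A.adjugate i) (A.adjugate i) * T j j).subset
    fun X (hX : Xᵀ * A * X = T) i j => ?_
  have h1 : formVal A (A.adjugate i) (Xᵀ j) = A.det * X i j :=
    (congrFun (det_smul_mulVec A (Xᵀ j)) i).symm
  have h2 : T j j = formVal A (Xᵀ j) (Xᵀ j) := by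
    rw [← mul_mul_transpose_apply, transpose_transpose, hX]
  have h3 := formVal_sq_le hM hA (A.adjugate i) (Xᵀ j)
  rw [h1, ← h2, mul_pow] at h3
  have h4 : 1 ≤ A.det ^ 2 := Int.add_one_le_iff.2 (sq_pos_of_ne_zero hdet)
  have h5 : X i j ^ 2 ≤ _ := (le_mul_of_one_le_left (sq_nonneg _) h4).trans h3
  have h6 := Int.le_self_sq (X i j)
  have h7 := Int.le_self_sq (-X i j)
  rw [neg_sq] at h7
  rw [Set.mem_Icc]
  constructor <;> linarith

theorem dvd_of_forall_padic_norm_le {a b : ℤ}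
    (h : ∀ (p : ℕ) [Fact p.Prime], ‖(a : ℚ_[p])‖ ≤ ‖(b : ℚ_[p])‖) : b ∣ a := by
  rw [← Int.natAbs_dvd_natAbs, Nat.dvd_iff_prime_pow_dvd_dvd]
  intro p k hp hk
  have : Fact p.Prime := ⟨hp⟩
  rw [← Int.natCast_dvd, Nat.cast_pow, ← Padic.norm_int_le_pow_iff_dvd] at hk ⊢
  exact (h p).trans hk

theorem norm_mul_adjugate_le {p : ℕ} [Fact p.Prime] (hX : X.det ≠ 0)
    (h : latticeOf (X.map (Int.castRingHom ℚ_[p])) ⊆ latticeOf (Y.map (Int.castRingHom ℚ_[p])))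
    (i j : Fin 4) : ‖(((Y * X.adjugate) i j : ℤ) : ℚ_[p])‖ ≤ ‖(X.det : ℚ_[p])‖ := by
  set X' := X.map (Int.castRingHom ℚ_[p]) with hX'
  have hdet : X'.det = (X.det : ℚ_[p]) := by
    rw [hX', ← RingHom.mapMatrix_apply, ← RingHom.map_det, eq_intCast]
  have hdet0 : X'.det ≠ 0 := by rwa [hdet, Int.cast_ne_zero]
  have hmem : X'.det⁻¹ • X'.adjugate *ᵥ Pi.single j 1 ∈ latticeOf X' := fun k => by
    rw [mulVec_smul, mulVec_mulVec, mul_adjugate, smul_mulVec, smul_smul, inv_mul_cancel₀ hdet0,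
      one_smul, one_mulVec, Pi.single_apply]
    split_ifs <;> simp
  have h1 := h hmem i
  have h2 : (((Y * X.adjugate) i j : ℤ) : ℚ_[p]) =
      (Y.map (Int.castRingHom ℚ_[p]) * X'.adjugate) i j := by
    rw [hX', ← RingHom.mapMatrix_apply, ← RingHom.mapMatrix_apply, ← RingHom.map_adjugate,
      ← map_mul]
    rfl
  rw [mulVec_smul, mulVec_mulVec, mulVec_single_one, Pi.smul_apply, smul_eq_mul, norm_mul,
    norm_inv, col_apply, ← h2, hdet] at h1
  rwa [inv_mul_le_iff₀ (norm_pos_iff.2 (hdet ▸ hdet0)), mul_one] at h1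

theorem exists_mul_eq_of_latticeOf_subset (hX : X.det ≠ 0)
    (h : ∀ (p : ℕ) [Fact p.Prime], p ∣ X.det.natAbs →
      latticeOf (X.map (Int.castRingHom ℚ_[p])) ⊆ latticeOf (Y.map (Int.castRingHom ℚ_[p]))) :
    ∃ g : Matrix (Fin 4) (Fin 4) ℤ, g * X = Y := by
  have hdvd (i j : Fin 4) : X.det ∣ (Y * X.adjugate) i j := by
    refine dvd_of_forall_padic_norm_le fun p _ => ?_
    by_cases hp : p ∣ X.det.natAbs
    · exact norm_mul_adjugate_le hX (h p hp) i j
    · rw [← Int.natCast_dvd, ← Padic.norm_intCast_lt_one_iff, not_lt] at hp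
      exact (Padic.norm_int_le_one _).trans hp
  choose g hg using hdvd
  refine ⟨of g, smul_right_injective _ hX ?_⟩
  have h1 : Y * X.adjugate = X.det • of g := by
    ext i j
    exact hg i j
  simp only
  rw [← smul_mul, ← h1, Matrix.mul_assoc, adjugate_mul, Matrix.mul_smul, Matrix.mul_one]

theorem transpose_mul_mul_eq_of_mul (hX : X.det ≠ 0) {g : Matrix (Fin 4) (Fin 4) ℤ}
    (h : (g * X)ᵀ * A * (g * X) = Xᵀ * A * X) : gᵀ * A * g = A := by
  have hreg : IsRegular X := isRegular_of_isLeftRegular_det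
    (IsLeftCancelMulZero.mul_left_cancel_of_ne_zero hX)
  have hreg' : IsRegular Xᵀ := isRegular_of_isLeftRegular_det
    (IsLeftCancelMulZero.mul_left_cancel_of_ne_zero (by rwa [det_transpose]))
  apply hreg.right
  apply hreg'.left
  simpa only [transpose_mul, Matrix.mul_assoc] using h

theorem card_image_pi_le {α I : Type*} [Fintype I] [DecidableEq I] {β : I → Type*}
    [∀ i, DecidableEq (β i)] (c : ∀ i, α → β i) (s : Finset α) :
    (s.image fun x i => c i x).card ≤ ∏ i, (s.image (c i)).card := by
  rw [← Fintype.card_piFinset]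
  refine Finset.card_le_card fun f hf => ?_
  obtain ⟨x, hx, rfl⟩ := Finset.mem_image.1 hf
  exact Fintype.mem_piFinset.2 fun i => Finset.mem_image_of_mem _ hx

open Classical in
theorem ncard_representations_le {MQ : Matrix (Fin 4) (Fin 4) ℚ} (hQ : IsIntegralPosDefForm MQ)
    (hA : A.map (Int.castRingHom ℚ) = 2 • MQ) (hA0 : A.det ≠ 0) (hM : IsIntegralPosDefForm M)
    (hT : T.map (Int.castRingHom ℚ) = 2 • M) (hT0 : T.det ≠ 0) :
    {X | Xᵀ * A * X = T}.ncard ≤ {g | gᵀ * A * g = A}.ncard *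
      ∏ p ∈ T.det.natAbs.primeFactors, (padicValInt p T.det + 1) ^ 4 *
        (4 * p ^ (kSum M 1 p + ((kSum M 2 p - kSum M 1 p) / 2 + 3 * padicValNat p 2) +
          4 * padicValInt p (2 * A.det ^ 3))) := by
  have hS := finite_setOf_representation hQ hA hA0 T
  have hO := finite_setOf_representation hQ hA hA0 A
  rw [Set.ncard_eq_toFinset_card _ hS, Set.ncard_eq_toFinset_card _ hO]
  have hfact (p : T.det.natAbs.primeFactors) : Fact (p : ℕ).Prime :=
    ⟨Nat.prime_of_mem_primeFactors p.2⟩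
  let c (p : T.det.natAbs.primeFactors) (X : Matrix (Fin 4) (Fin 4) ℤ) :
      Set (Fin 4 → ℚ_[(p : ℕ)]) := latticeOf (X.map (Int.castRingHom ℚ_[(p : ℕ)]))
  have hdet {X : Matrix (Fin 4) (Fin 4) ℤ} (hX : Xᵀ * A * X = T) : X.det ∣ T.det := by
    rw [← hX, det_mul]
    exact dvd_mul_left _ _
  refine (Finset.card_le_mul_card_image (f := fun X p => c p X) _ _ fun b hb => ?_).trans
    (Nat.mul_le_mul_left _ ((card_image_pi_le c _).trans ?_))
  · obtain ⟨X, hX, rfl⟩ := Finset.mem_image.1 hb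
    rw [Set.Finite.mem_toFinset] at hX
    have hX0 : X.det ≠ 0 := fun h0 => hT0 (zero_dvd_iff.1 (h0 ▸ hdet hX))
    refine (Finset.card_le_card (t := hO.toFinset.image (· * X)) fun Y hY => ?_).trans
      Finset.card_image_le
    obtain ⟨hY, hYX⟩ := Finset.mem_filter.1 hY
    rw [Set.Finite.mem_toFinset] at hY
    obtain ⟨g, rfl⟩ := exists_mul_eq_of_latticeOf_subset (Y := Y) hX0 fun p hp hpX =>
      (congrFun hYX ⟨p, Nat.mem_primeFactors.2 ⟨hp.out, hpX.trans
        (Int.natAbs_dvd_natAbs.2 (hdet hX)), Int.natAbs_ne_zero.2 hT0⟩⟩).ge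
    refine Finset.mem_image.2 ⟨g, ?_, rfl⟩
    rw [Set.Finite.mem_toFinset]
    exact transpose_mul_mul_eq_of_mul hX0 (Eq.trans hY (Eq.symm hX))
  · rw [← Finset.prod_coe_sort T.det.natAbs.primeFactors]
    refine Finset.prod_le_prod (fun _ _ => Nat.zero_le _) fun p _ => ?_
    exact card_image_latticeOf_le p hM hT hA0 _ fun X hX => hS.mem_toFinset.1 hX

end GlobalCount

section Bounds

theorem exists_natCast_eq_of_padicValRat_nonneg {q : ℚ} (hq : 0 < q)
    (h : ∀ p : ℕ, p.Prime → 0 ≤ padicValRat p q) : ∃ n : ℕ, q = n := by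
  have hden : q.den = 1 := by
    by_contra hne
    obtain ⟨p, hp, hpd⟩ := Nat.exists_prime_and_dvd hne
    have : Fact p.Prime := ⟨hp⟩
    have h1 := h p hp
    have h2 : padicValInt p q.num = 0 := by
      rw [padicValInt.eq_zero_iff]
      refine Or.inr (Or.inr fun hn => ?_)
      exact Nat.not_coprime_of_dvd_of_dvd hp.one_lt (Int.natCast_dvd.1 hn) hpd q.reduced
    have h3 := one_le_padicValNat_of_dvd q.den_nz hpd
    rw [padicValRat, h2] at h1
    omega
  refine ⟨q.num.toNat, ?_⟩
  have h1 : ((q.num.toNat : ℤ) : ℚ) = q.num := by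
    rw [Int.toNat_of_nonneg (Rat.num_nonneg.2 hq.le)]
  rw [← Int.cast_natCast, h1, Rat.coe_int_num_of_den_eq_one hden]

theorem half_le_padicValNat_of_maximal {m : ℚ} {m' : ℕ} {p : ℕ} [Fact p.Prime] (hm : m ≠ 0)
    (hm' : 0 < m') (h : ∃ z : ℤ, m = (m' : ℚ) ^ 2 * z)
    (hmax : ∀ k : ℕ, 0 < k → (∃ z : ℤ, m = (k : ℚ) ^ 2 * z) → k ≤ m') {k : ℕ}
    (hk : (k : ℤ) ≤ padicValRat p m) : k / 2 ≤ padicValNat p m' := by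
  have hp : p.Prime := Fact.out
  obtain ⟨z, rfl⟩ := h
  by_contra! hlt
  have hz : z ≠ 0 := by
    rintro rfl
    simp at hm
  rw [padicValRat.mul (by positivity) (by exact_mod_cast hz), sq,
    padicValRat.mul (by positivity) (by positivity),
    padicValRat.of_nat, padicValRat.of_int] at hk
  have h2 : 2 ≤ padicValInt p z := by
    omega
  obtain ⟨y, rfl⟩ := (padicValInt_dvd_iff 2 z).2 (Or.inr h2)
  have h3 := hmax (p * m') (Nat.mul_pos hp.pos hm') ⟨y, by
    push_cast
    ring⟩
  nlinarith [hp.two_le]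

theorem prod_prime_pow_le {s : Finset ℕ} (hs : ∀ p ∈ s, p.Prime) {D : ℕ} (hD : D ≠ 0)
    {a : ℕ → ℕ} (ha : ∀ p ∈ s, a p ≤ padicValNat p D) : ∏ p ∈ s, p ^ a p ≤ D := by
  refine Nat.le_of_dvd (Nat.pos_of_ne_zero hD) (Finset.prod_dvd_of_isRelPrime ?_ fun p hp => ?_)
  · intro p hp q hq hpq
    exact Nat.coprime_iff_isRelPrime.1
      (Nat.Coprime.pow _ _ ((Nat.coprime_primes (hs p hp) (hs q hq)).2 hpq))
  · exact (pow_dvd_pow p (ha p hp)).trans pow_padicValNat_dvd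

theorem exists_pow_le_mul_pow {r : ℝ} (hr : 1 < r) :
    ∃ K : ℝ, 1 ≤ K ∧ ∀ v : ℕ, 4 * ((v : ℝ) + 1) ^ 4 ≤ K * r ^ v := by
  obtain ⟨K, hK⟩ := (tendsto_pow_const_div_const_pow_of_one_lt 4 hr).bddAbove_range
  refine ⟨max 1 (4 * K * r), le_max_left _ _, fun v => ?_⟩
  have h := hK ⟨v + 1, rfl⟩
  have hr0 : 0 < r := one_pos.trans hr
  rw [div_le_iff₀ (pow_pos hr0 _)] at h
  push_cast at h
  calc 4 * ((v : ℝ) + 1) ^ 4 ≤ 4 * (K * r ^ (v + 1)) := by gcongr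
    _ = 4 * K * r * r ^ v := by ring
    _ ≤ _ := by gcongr; exact le_max_right _ _

theorem exists_prod_le_rpow {ε : ℝ} (hε : 0 < ε) :
    ∃ C : ℝ, 0 ≤ C ∧ ∀ N : ℕ, N ≠ 0 →
      ∏ p ∈ N.primeFactors, (4 * ((padicValNat p N : ℝ) + 1) ^ 4) ≤ C * (N : ℝ) ^ ε := by
  have hr : 1 < (2 : ℝ) ^ ε := Real.one_lt_rpow one_lt_two hε
  obtain ⟨K, hK1, hK⟩ := exists_pow_le_mul_pow hr
  obtain ⟨p₀, hp₀⟩ := exists_nat_ge ((64 : ℝ) ^ ε⁻¹)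
  have h64 : (64 : ℝ) ≤ (p₀ : ℝ) ^ ε := by
    rwa [← Real.rpow_inv_le_iff_of_pos (by norm_num) (by positivity) hε]
  have hlocal (p : ℕ) (hp : 2 ≤ p) (v : ℕ) (hv : 1 ≤ v) : 4 * ((v : ℝ) + 1) ^ 4 ≤
      (if p < p₀ then K else 1) * ((p ^ v : ℕ) : ℝ) ^ ε := by
    have hpow : ((p ^ v : ℕ) : ℝ) ^ ε = ((p : ℝ) ^ ε) ^ v := by
      rw [Nat.cast_pow, ← Real.rpow_natCast, ← Real.rpow_natCast, ← Real.rpow_mul (by positivity),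
        ← Real.rpow_mul (by positivity), mul_comm]
    rw [hpow]
    split_ifs with h
    · refine (hK v).trans ?_
      have : (2 : ℝ) ≤ p := by exact_mod_cast hp
      gcongr
    · have hle : (64 : ℝ) ≤ (p : ℝ) ^ ε := h64.trans (by
        have : (p₀ : ℝ) ≤ p := by exact_mod_cast not_lt.1 h
        gcongr)
      have h2 : (v : ℝ) + 1 ≤ 2 ^ v := by exact_mod_cast Nat.lt_two_pow_self
      calc 4 * ((v : ℝ) + 1) ^ 4 ≤ 4 ^ v * (2 ^ v) ^ 4 := by
            gcongr
            exact le_self_pow₀ (by norm_num) (by omega)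
        _ = 64 ^ v := by rw [← pow_mul, mul_comm v, pow_mul, ← mul_pow]; norm_num
        _ ≤ 1 * ((p : ℝ) ^ ε) ^ v := by
            rw [one_mul]
            gcongr
  refine ⟨K ^ p₀, by positivity, fun N hN => ?_⟩
  calc ∏ p ∈ N.primeFactors, (4 * ((padicValNat p N : ℝ) + 1) ^ 4)
      ≤ ∏ p ∈ N.primeFactors,
          (if p < p₀ then K else 1) * ((p ^ padicValNat p N : ℕ) : ℝ) ^ ε :=
        Finset.prod_le_prod (fun _ _ => by positivity) fun p hp =>
          have : Fact p.Prime := ⟨Nat.prime_of_mem_primeFactors hp⟩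
          hlocal p this.out.two_le _
            (one_le_padicValNat_of_dvd hN (Nat.dvd_of_mem_primeFactors hp))
    _ = (∏ p ∈ N.primeFactors, if p < p₀ then K else 1) * (N : ℝ) ^ ε := by
        rw [Finset.prod_mul_distrib, Real.finsetProd_rpow _ _ fun _ _ => Nat.cast_nonneg _,
          ← Nat.cast_prod]
        congr 3
        conv_rhs => rw [← Nat.prod_factorization_pow_eq_self hN]
        rw [Nat.prod_factorization_eq_prod_primeFactors]
        refine Finset.prod_congr rfl fun p hp => ?_
        rw [Nat.factorization_def _ (Nat.prime_of_mem_primeFactors hp)]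
    _ ≤ K ^ p₀ * (N : ℝ) ^ ε := by
        gcongr
        rw [Finset.prod_ite, Finset.prod_const, Finset.prod_const_one, mul_one]
        refine pow_le_pow_right₀ hK1 ((Finset.card_le_card (t := Finset.range p₀)
          fun p hp => ?_).trans (Finset.card_range p₀).le)
        exact Finset.mem_range.2 (Finset.mem_filter.1 hp).2

theorem IsIntegralPosDefForm.det_pos {M : Matrix (Fin 4) (Fin 4) ℚ}
    {T : Matrix (Fin 4) (Fin 4) ℤ} (hM : IsIntegralPosDefForm M)
    (hT : T.map (Int.castRingHom ℚ) = 2 • M) : 0 < T.det := by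
  have : Fact (Nat.Prime 2) := ⟨Nat.prime_two⟩
  obtain ⟨B, τ, hτ, hB, -⟩ := exists_diagonal_basis 2 hM hT
  have hpos (k : Fin 4) : 0 < τ k := by
    have h1 : formVal (T.map (Int.castRingHom ℚ)) (B k) (B k) = τ k := by
      rw [← mul_mul_transpose_apply, hB, diagonal_apply_eq]
    rw [← h1]
    refine hM.formVal_map_pos hT fun h0 => hτ k ?_
    rw [← h1, h0]
    simp [formVal]
  have h1 := congrArg det hB
  rw [det_mul, det_mul, det_diagonal, det_transpose, ← RingHom.mapMatrix_apply, ← RingHom.map_det,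
    eq_intCast] at h1
  have h2 : 0 < B.det * (T.det : ℚ) * B.det := h1 ▸ Finset.prod_pos fun k _ => hpos k
  have h3 : (0 : ℚ) < T.det := by
    by_contra! h
    nlinarith [mul_self_nonneg B.det]
  exact_mod_cast h3

theorem setOf_representation_eq {MQ M : Matrix (Fin 4) (Fin 4) ℚ}
    {A T : Matrix (Fin 4) (Fin 4) ℤ} (hA : A.map (Int.castRingHom ℚ) = 2 • MQ)
    (hT : T.map (Int.castRingHom ℚ) = 2 • M) :
    {X : Matrix (Fin 4) (Fin 4) ℤ |
      (X.map (Int.cast : ℤ → ℚ))ᵀ * MQ * X.map (Int.cast : ℤ → ℚ) = M} =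
      {X | Xᵀ * A * X = T} := by
  ext X
  have h : (Xᵀ * A * X).map (Int.castRingHom ℚ) =
      2 • ((X.map (Int.cast : ℤ → ℚ))ᵀ * MQ * X.map (Int.cast : ℤ → ℚ)) := by
    rw [Matrix.map_mul, Matrix.map_mul, hA, Matrix.mul_smul, Matrix.smul_mul, transpose_map]
    rfl
  have hinj : Function.Injective fun Z : Matrix (Fin 4) (Fin 4) ℤ => Z.map (Int.castRingHom ℚ) :=
    Matrix.map_injective (RingHom.injective_int _)
  change _ = _ ↔ _ = _
  rw [← hinj.eq_iff, hT, h]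
  refine ⟨fun h1 => by rw [h1], fun h1 => ?_⟩
  ext i j
  simpa using congrFun (congrFun h1 i) j

end Bounds

/-- equal rank 4.  Fix a positive definite integral quaternary form `Q`.
For every `ε > 0` there is a constant `C = C(Q, ε)` such that for every positive definite
integral quaternary form `q`, the number of representations of `q` by `Q` is at most
`C·m_1(q)·m_2'(q)·disc(q)^ε`. -/
theorem representation_count_equal_rank
    (MQ : Matrix (Fin 4) (Fin 4) ℚ) (hQ : IsIntegralPosDefForm MQ)
    (ε : ℝ) (hε : 0 < ε) :
    ∃ Cst : ℝ, ∀ Mq : Matrix (Fin 4) (Fin 4) ℚ, IsIntegralPosDefForm Mq →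
      ∀ (m1 m2 : ℚ) (m2' : ℕ), IsM1M2M2' Mq m1 m2 m2' →
        (({X : Matrix (Fin 4) (Fin 4) ℤ |
              (X.map (Int.cast : ℤ → ℚ))ᵀ * MQ * X.map (Int.cast : ℤ → ℚ) = Mq}).ncard : ℝ)
          ≤ Cst * (m1 : ℝ) * (m2' : ℝ) * ((Mq.det : ℝ) ^ ε) := by
  obtain ⟨A, hA⟩ := hQ.exists_two_smul
  obtain ⟨C, hC0, hC⟩ := exists_prod_le_rpow hε
  have hA0 := (hQ.det_pos hA).ne'
  set D := 2 ^ 3 * (2 * A.det ^ 3).natAbs ^ 4 with hD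
  have hD1 : (2 * A.det ^ 3).natAbs ≠ 0 :=
    Int.natAbs_ne_zero.2 (mul_ne_zero two_ne_zero (pow_ne_zero _ hA0))
  have hD0 : D ≠ 0 := mul_ne_zero (by norm_num) (pow_ne_zero _ hD1)
  set O := {g : Matrix (Fin 4) (Fin 4) ℤ | gᵀ * A * g = A}.ncard
  refine ⟨O * C * 16 ^ ε * D, fun Mq hq m1 m2 m2' ⟨hm1, hv1, hm2, hv2, hm2', hsq, hmax⟩ => ?_⟩
  obtain ⟨T, hT⟩ := hq.exists_two_smul
  have hT0 := hq.det_pos hT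
  obtain ⟨n1, rfl⟩ := exists_natCast_eq_of_padicValRat_nonneg hm1 fun p hp => by
    rw [hv1 p hp]
    exact Int.natCast_nonneg _
  have hn1 : n1 ≠ 0 := by
    rintro rfl
    simp at hm1
  set N := T.det.natAbs with hN
  have hN0 : N ≠ 0 := Int.natAbs_ne_zero.2 hT0.ne'
  have hNdet : (N : ℝ) = 16 * (Mq.det : ℝ) := by
    have h1 := congrArg det hT
    rw [← RingHom.mapMatrix_apply, ← RingHom.map_det, eq_intCast, ← Nat.cast_smul_eq_nsmul ℚ,
      det_smul, Fintype.card_fin] at h1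
    have h2 : ((T.det : ℚ) : ℝ) = N := by
      rw [Rat.cast_intCast, ← Int.cast_natCast, hN, Int.natAbs_of_nonneg hT0.le]
    rw [← h2, h1]
    push_cast
    norm_num
  have hdet : (0 : ℝ) ≤ Mq.det := by
    have : (0 : ℝ) ≤ N := Nat.cast_nonneg _
    linarith
  have hprod : ∏ p ∈ N.primeFactors,
      p ^ (kSum Mq 1 p + ((kSum Mq 2 p - kSum Mq 1 p) / 2 + 3 * padicValNat p 2) +
        4 * padicValInt p (2 * A.det ^ 3)) ≤ n1 * m2' * D := by
    refine prod_prime_pow_le (fun p hp => Nat.prime_of_mem_primeFactors hp)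
      (mul_ne_zero (mul_ne_zero hn1 hm2'.ne') hD0) fun p hp => ?_
    have hp := Nat.prime_of_mem_primeFactors hp
    have : Fact p.Prime := ⟨hp⟩
    rw [padicValNat.mul (mul_ne_zero hn1 hm2'.ne') hD0, padicValNat.mul hn1 hm2'.ne', hD,
      padicValNat.mul (by norm_num) (pow_ne_zero _ hD1), padicValNat.pow,
      padicValNat.pow]
    have h1 : kSum Mq 1 p = padicValNat p n1 := by
      have := hv1 p hp
      rw [padicValRat.of_nat] at this
      exact (Nat.cast_injective this).symm
    have h2 : (kSum Mq 2 p - kSum Mq 1 p) / 2 ≤ padicValNat p m2' := by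
      have hle := hv2 p hp
      by_cases h : kSum Mq 1 p ≤ kSum Mq 2 p
      · refine half_le_padicValNat_of_maximal hm2.ne' hm2' hsq hmax ?_
        rw [hle, Nat.cast_sub h]
      · rw [Nat.sub_eq_zero_of_le (not_le.1 h).le]
        exact Nat.zero_le _
    rw [← h1, padicValInt]
    omega
  have hcard := ncard_representations_le hQ hA hA0 hq hT hT0.ne'
  rw [← setOf_representation_eq hA hT] at hcard
  calc _ ≤ ((O * ∏ p ∈ N.primeFactors, (padicValInt p T.det + 1) ^ 4 *
        (4 * p ^ (kSum Mq 1 p + ((kSum Mq 2 p - kSum Mq 1 p) / 2 + 3 * padicValNat p 2) +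
          4 * padicValInt p (2 * A.det ^ 3))) : ℕ) : ℝ) := Nat.cast_le.2 hcard
    _ = O * (∏ p ∈ N.primeFactors, (4 * ((padicValNat p N : ℝ) + 1) ^ 4)) *
        ((∏ p ∈ N.primeFactors,
          p ^ (kSum Mq 1 p + ((kSum Mq 2 p - kSum Mq 1 p) / 2 + 3 * padicValNat p 2) +
            4 * padicValInt p (2 * A.det ^ 3)) : ℕ) : ℝ) := by
      rw [Nat.cast_mul, Nat.cast_prod, Nat.cast_prod, mul_assoc, ← Finset.prod_mul_distrib]
      congr 1
      refine Finset.prod_congr rfl fun p _ => ?_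
      rw [padicValInt, Nat.cast_mul, Nat.cast_mul, Nat.cast_pow, Nat.cast_succ]
      push_cast
      ring
    _ ≤ O * (C * (N : ℝ) ^ ε) * ((n1 * m2' * D : ℕ) : ℝ) := by
      gcongr
      exact hC N hN0
    _ = _ := by
      rw [hNdet, Real.mul_rpow (by norm_num) hdet]
      push_cast
      ring

end
end
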